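/- Fix θ > 0 and an integer m ≥ 1. Let {a(N) ∈ 𝒫_N}_{N≥1} be a regular sequence of ordered tuples with limiting measure μ, and assume Var[μ] > 0. For each N > m, let (a_j^{(k,N)})_{1≤j≤k≤N−1} be distributed according to the orbital beta process 𝕄^{a(N),θ} with top level a(N), and let (a_1^{(m,N)}, …, a_m^{(m,N)}) be its m-th level. Then, as N → ∞, the random m-dimensional vectors ( (a_1^{(m,N)} − N·𝔼[μ_N])/√(N·Var[μ]), …, (a_m^{(m,N)} − N·𝔼[μ_N])/√(N·Var[μ]) ), where μ_N := (1/N)∑_{i=1}^N δ_{a(N)_i/N}, converge weakly (in distribution) to the Gaussian beta ensemble 𝕄^{(θ)}_m. -/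

import Mathlib

open MeasureTheory Filter Topology
open scoped ENNReal

noncomputable section

/-- A triangular array with `M` levels: for `k : Fin M`, level `k+1` has `k+1` real entries. -/
abbrev Tri (M : ℕ) := ∀ k : Fin M, Fin (k.1 + 1) → ℝ

/-- `Interlaces u v` means `u ≺ v`, i.e. `v 1 > u 1 > v 2 > u 2 > ⋯ > v n > u n > v (n+1)`. -/
def Interlaces {n : ℕ} (u : Fin n → ℝ) (v : Fin (n + 1) → ℝ) : Prop :=
  ∀ i : Fin n, u i < v i.castSucc ∧ v i.succ < u i

/-- Level `k+1` (for `k < N`) of the configuration consisting of the triangular array `x`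
(levels `1, …, N-1`) together with the top level `a` (level `N`). -/
def lvl {N : ℕ} (a : Fin N → ℝ) (x : Tri (N - 1)) (k : ℕ) (hk : k < N) :
    Fin (k + 1) → ℝ :=
  if h : k < N - 1 then fun i => x ⟨k, h⟩ i
  else fun i => a ⟨i.1, by have := i.isLt; omega⟩

/-- The (unnormalized) density of the orbital beta process with top level `a`. -/
def obpWt (θ : ℝ) {N : ℕ} (a : Fin N → ℝ) (x : Tri (N - 1)) : ℝ :=
  ∏ k : Fin (N - 1),
    ((∏ i : Fin (k.1 + 1), ∏ j : Fin (k.1 + 1),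
        if i < j then |x k i - x k j| ^ (2 - 2 * θ) else 1) *
      ∏ s : Fin (k.1 + 2), ∏ r : Fin (k.1 + 1),
        |lvl a x (k.1 + 1) (by have := k.isLt; omega) s - x k r| ^ (θ - 1))

/-- The interlacing scheme `𝒫(a)`: arrays `(a⁽¹⁾ ≺ a⁽²⁾ ≺ ⋯ ≺ a⁽ᴺ⁻¹⁾ ≺ a)`. -/
def obpDomain {N : ℕ} (a : Fin N → ℝ) : Set (Tri (N - 1)) :=
  {x | ∀ k : Fin (N - 1),
      Interlaces (x k) (lvl a x (k.1 + 1) (by have := k.isLt; omega))}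

/-- The orbital beta process `𝕄^{a,θ}` with top level `a`. -/
def obp (θ : ℝ) {N : ℕ} (a : Fin N → ℝ) : Measure (Tri (N - 1)) :=
  (ENNReal.ofReal (∫ x in obpDomain a, obpWt θ a x))⁻¹ •
    volume.withDensity fun x =>
      ENNReal.ofReal ((obpDomain a).indicator (obpWt θ a) x)

/-- The Weyl chamber `𝒲_m = {x : x 0 ≥ x 1 ≥ ⋯}`. -/
def weylChamber (m : ℕ) : Set (Fin m → ℝ) :=
  {x | ∀ i j : Fin m, i ≤ j → x j ≤ x i}

/-- The (unnormalized) density of the Gaussian beta ensemble. -/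
def gbeWt (θ : ℝ) (m : ℕ) (x : Fin m → ℝ) : ℝ :=
  (∏ i : Fin m, ∏ j : Fin m, if i < j then |x i - x j| ^ (2 * θ) else 1) *
    Real.exp (-(θ / 2) * ∑ i, x i ^ 2)

/-- The Gaussian beta ensemble `𝕄^{(θ)}_m` of rank `m`. -/
def gbe (θ : ℝ) (m : ℕ) : Measure (Fin m → ℝ) :=
  (ENNReal.ofReal (∫ x in weylChamber m, gbeWt θ m x))⁻¹ •
    volume.withDensity fun x =>
      ENNReal.ofReal ((weylChamber m).indicator (gbeWt θ m) x)

/-- The empirical measure `μ_N = (1/N) ∑ δ_{a_i/N}`. -/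
def empMeasure {N : ℕ} (a : Fin N → ℝ) : Measure ℝ :=
  ((N : ℝ≥0∞))⁻¹ • ∑ i : Fin N, Measure.dirac (a i / N)

/-- The mean `𝔼[ν]` of a measure on `ℝ`. -/
def meanM (ν : Measure ℝ) : ℝ := ∫ t, t ∂ν

/-- The variance `Var[ν]` of a measure on `ℝ`. -/
def varM (ν : Measure ℝ) : ℝ := (∫ t, t ^ 2 ∂ν) - meanM ν ^ 2

/-- A regular sequence of ordered tuples with limiting measure `μ`. -/
def RegularSeq (a : (N : ℕ) → Fin N → ℝ) (μ : Measure ℝ) : Prop :=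
  (∀ N : ℕ, 1 ≤ N → StrictAnti (a N)) ∧
  (∃ C : ℝ, ∀ N : ℕ, ∀ hN : 1 ≤ N,
      |a N ⟨0, by omega⟩| ≤ C * N ∧ |a N ⟨N - 1, by omega⟩| ≤ C * N) ∧
  IsProbabilityMeasure μ ∧
  (∃ R : ℝ, μ {t : ℝ | |t| ≤ R}ᶜ = 0) ∧
  ∀ f : BoundedContinuousFunction ℝ ℝ,
    Tendsto (fun N : ℕ => ∫ t, f t ∂empMeasure (a N)) atTop (𝓝 (∫ t, f t ∂μ))

/-- Projection of a triangular array (with top level of size `N`) to its `m`-th level. -/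
def levelProj {N : ℕ} (m : ℕ) (h1 : 1 ≤ m) (h2 : m < N) (x : Tri (N - 1)) :
    Fin m → ℝ :=
  fun i => x ⟨m - 1, by omega⟩ ⟨i.1, (by have := i.isLt; omega : i.1 < m - 1 + 1)⟩

/-- Projection of a triangular array to its bottom `m` levels. -/
def triProj {N : ℕ} (m : ℕ) (h : m < N) (x : Tri (N - 1)) : Tri m :=
  fun k i => x ⟨k.1, by have := k.isLt; omega⟩ ⟨i.1, i.isLt⟩

/-- The top level of a triangular array with `m` levels. -/
def topLvl {m : ℕ} (hm : 1 ≤ m) (x : Tri m) : Fin m → ℝ :=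
  fun i => x ⟨m - 1, by omega⟩ ⟨i.1, (by have := i.isLt; omega : i.1 < m - 1 + 1)⟩

/-- The Gelfand–Tsetlin polytope `𝒲_{m,corners}` (weak interlacing). -/
def gtPoly (m : ℕ) : Set (Tri m) :=
  {x | ∀ k : Fin m, ∀ hk : k.1 + 1 < m, ∀ i : Fin (k.1 + 1),
      x k i ≤ x ⟨k.1 + 1, hk⟩ i.castSucc ∧ x ⟨k.1 + 1, hk⟩ i.succ ≤ x k i}

/-- Unnormalized density of the Gaussian beta corners process with `m` levels. -/
def gbcWt (θ : ℝ) {m : ℕ} (hm : 1 ≤ m) (x : Tri m) : ℝ :=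
  (∏ i : Fin m, ∏ j : Fin m,
      if i < j then topLvl hm x i - topLvl hm x j else 1) *
    Real.exp (-(θ / 2) * ∑ i, topLvl hm x i ^ 2) *
    ∏ k : Fin (m - 1),
      ((∏ i : Fin (k.1 + 1), ∏ j : Fin (k.1 + 1),
          if i < j then
            |x ⟨k.1, by have := k.isLt; omega⟩ i -
              x ⟨k.1, by have := k.isLt; omega⟩ j| ^ (2 - 2 * θ)
          else 1) *
        ∏ i : Fin (k.1 + 1), ∏ j : Fin (k.1 + 2),
          |x ⟨k.1, by have := k.isLt; omega⟩ i -
            x ⟨k.1 + 1, by have := k.isLt; omega⟩ j| ^ (θ - 1))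

/-- The Gaussian beta corners process `𝕄^{(θ)}_{m,corners}`. -/
def gbc (θ : ℝ) {m : ℕ} (hm : 1 ≤ m) : Measure (Tri m) :=
  (ENNReal.ofReal (∫ x in gtPoly m, gbcWt θ hm x))⁻¹ •
    volume.withDensity fun x =>
      ENNReal.ofReal ((gtPoly m).indicator (gbcWt θ hm) x)

/-- Strict interlacing domain `x⁽¹⁾ ≺ x⁽²⁾ ≺ ⋯ ≺ x⁽ᵐ⁾` inside `Tri m`. -/
def triDomain (m : ℕ) : Set (Tri m) :=
  {x | ∀ k : Fin m, ∀ hk : k.1 + 1 < m, Interlaces (x k) (x ⟨k.1 + 1, hk⟩)}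

/-- The θ-Gibbs conditional density of the bottom `n` levels given level `n+1`. -/
def gibbsWt (θ : ℝ) (n : ℕ) (x : Tri (n + 1)) : ℝ :=
  ((∏ k : Fin (n + 1), Real.Gamma ((k.1 + 1) * θ)) /
      Real.Gamma θ ^ ((n + 1) * (n + 2) / 2)) *
    (∏ i : Fin (n + 1), ∏ j : Fin (n + 1),
      if i < j then
        (x ⟨n, Nat.lt_succ_self n⟩ i - x ⟨n, Nat.lt_succ_self n⟩ j) ^ (1 - 2 * θ)
      else 1) *
    ∏ k : Fin n,
      ((∏ i : Fin (k.1 + 1), ∏ j : Fin (k.1 + 1),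
          if i < j then
            (x ⟨k.1, by have := k.isLt; omega⟩ i -
              x ⟨k.1, by have := k.isLt; omega⟩ j) ^ (2 - 2 * θ)
          else 1) *
        ∏ i : Fin (k.1 + 1), ∏ j : Fin (k.1 + 2),
          |x ⟨k.1, by have := k.isLt; omega⟩ i -
            x ⟨k.1 + 1, by have := k.isLt; omega⟩ j| ^ (θ - 1))

/-- `|a⁽ᵏ⁾|`, the sum of the entries of level `k` (with `a⁽⁰⁾ := 0` and `a⁽ᴺ⁾ := a`). -/
def sumLvl {N : ℕ} (a : Fin N → ℝ) (x : Tri (N - 1)) (k : ℕ) : ℝ :=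
  if k = 0 then 0
  else if h : k - 1 < N - 1 then ∑ i, x ⟨k - 1, h⟩ i
  else ∑ i, a i

/-- The multivariate Bessel function `𝓑_a(y; θ)`, defined through its combinatorial
integral representation over the interlacing scheme with top level `a`. -/
def MBF (θ : ℝ) {N : ℕ} (a : Fin N → ℝ) (y : Fin N → ℂ) : ℂ :=
  ((((∏ k : Fin N, Real.Gamma ((k.1 + 1) * θ)) /
        Real.Gamma θ ^ (N * (N + 1) / 2)) : ℝ) : ℂ) *
    (((∏ i : Fin N, ∏ j : Fin N,
        if i < j then |a i - a j| ^ (1 - 2 * θ) else 1) : ℝ) : ℂ) *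
    ∫ x in obpDomain a,
      Complex.exp (∑ k : Fin N,
        y k * ((sumLvl a x (k.1 + 1) - sumLvl a x k.1 : ℝ) : ℂ)) *
      ((obpWt θ a x : ℝ) : ℂ)

/-- Padding of an `m`-tuple with `N - m` zeros: `(y_1, …, y_m, 0^{N-m})`. -/
def padC {m N : ℕ} (_h : m ≤ N) (y : Fin m → ℂ) : Fin N → ℂ :=
  fun k => if h' : k.1 < m then y ⟨k.1, h'⟩ else 0

/-- Integrand `exp(yz) ∏ (z - a_i)^{-θ}` of the left-directed contour integral,
with `w^{-θ} := exp(-θ Log w)` for the principal branch `Log`. -/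
def contourFnL (θ : ℝ) {N : ℕ} (a : Fin N → ℝ) (y z : ℂ) : ℂ :=
  Complex.exp (y * z) *
    ∏ i : Fin N, Complex.exp (-(θ : ℂ) * Complex.log (z - (a i : ℂ)))

/-- Integrand `exp(-yz) ∏ (a_i - z)^{-θ}` of the right-directed contour integral. -/
def contourFnR (θ : ℝ) {N : ℕ} (a : Fin N → ℝ) (y z : ℂ) : ℂ :=
  Complex.exp (-y * z) *
    ∏ i : Fin N, Complex.exp (-(θ : ℂ) * Complex.log ((a i : ℂ) - z))

/-- `(y_1, …, y_m, y_{m+1})` with `y_{m+1} := y - (z_1 + ⋯ + z_m)`. -/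
def Yext {m : ℕ} (ys : Fin m → ℝ) (y : ℝ) (z : Fin m → ℝ) : Fin (m + 1) → ℝ :=
  fun j => if h : j.1 < m then ys ⟨j.1, h⟩ else y - ∑ i, z i

/-- `(z_1, …, z_m, z_{m+1})` with `z_{m+1} := 0`. -/
def Zext {m : ℕ} (z : Fin m → ℝ) : Fin (m + 1) → ℝ :=
  fun j => if h : j.1 < m then z ⟨j.1, h⟩ else 0

/-- The function `G_{θ, y_1, …, y_m, y}(z_1, …, z_m)`. -/
def Gfn (θ : ℝ) {m : ℕ} (ys : Fin m → ℝ) (y : ℝ) (z : Fin m → ℝ) : ℝ :=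
  (∏ i : Fin m, ∏ j : Fin m,
      if i < j then (ys i - ys j + z i) ^ (θ - 1) else 1) *
    ∏ i : Fin (m + 1), ∏ j : Fin (m + 1),
      if i < j then
        (Yext ys y z i - Yext ys y z j + Zext z i - Zext z j) *
          (Yext ys y z i - Yext ys y z j - Zext z j) ^ (θ - 1)
      else 1

/-- The function `F_{y_1, …, y_m, y}(z_1, …, z_m)`. -/
def Ffn {m : ℕ} (ys : Fin m → ℝ) (y : ℝ) (z : Fin m → ℝ) : ℝ :=
  (1 - (∑ i, z i) / y) * ∏ i, (1 + z i / ys i)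

open Polynomial in
/-- The polynomial `∏ i ∈ s, (1 - x i T)`. -/
def genPoly {ι : Type*} (s : Finset ι) (x : ι → ℝ) : ℝ[X] := ∏ i ∈ s, (1 - C (x i) * X)

/-- The signed elementary symmetric function `(-1) ^ k e_k(x)`. -/
def sgnEsymm {n : ℕ} (k : ℕ) (x : Fin n → ℝ) : ℝ := (genPoly Finset.univ x).coeff k

/-- The power sum `∑ x_i ^ j`. -/
def powerSum {n : ℕ} (j : ℕ) (x : Fin n → ℝ) : ℝ := ∑ i, x i ^ j

open Polynomial in
lemma genPoly_coeff_erase {ι : Type*} [DecidableEq ι] (s : Finset ι) (x : ι → ℝ) {i : ι}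
    (hi : i ∈ s) (k : ℕ) :
    (genPoly (s.erase i) x).coeff k =
      ∑ j ∈ Finset.range (k + 1), x i ^ j * (genPoly s x).coeff (k - j) := by
  have h : genPoly s x = (1 - C (x i) * X) * genPoly (s.erase i) x := by
    rw [genPoly, genPoly, Finset.mul_prod_erase s (fun i => (1 - C (x i) * X)) hi]
  induction k with
  | zero => simp [h, sub_mul, mul_assoc]
  | succ k ih =>
    have h1 : (genPoly s x).coeff (k + 1) =
        (genPoly (s.erase i) x).coeff (k + 1) - x i * (genPoly (s.erase i) x).coeff k := by
      rw [h, sub_mul, one_mul, coeff_sub, mul_assoc, coeff_C_mul, coeff_X_mul]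
    rw [Finset.sum_range_succ']
    simp only [pow_zero, one_mul, Nat.sub_zero, Nat.add_sub_add_right]
    rw [h1, ih, Finset.mul_sum]
    simp only [pow_succ']
    simp [mul_assoc]

@[simp] lemma sgnEsymm_zero {n : ℕ} (x : Fin n → ℝ) : sgnEsymm 0 x = 1 := by
  simp [sgnEsymm, genPoly, Polynomial.coeff_zero_prod]

open Polynomial in
/-- Newton's identities. -/
lemma sgnEsymm_newton {n : ℕ} (k : ℕ) (x : Fin n → ℝ) :
    (k + 1 : ℝ) * sgnEsymm (k + 1) x =
      -∑ j ∈ Finset.range (k + 1), powerSum (j + 1) x * sgnEsymm (k - j) x := by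
  classical
  have h := coeff_derivative (genPoly Finset.univ x) k
  rw [mul_comm, ← sgnEsymm] at h
  rw [← h, genPoly, Polynomial.derivative_prod_finset, finsetSum_coeff]
  have : ∀ i : Fin n, ((∏ j ∈ Finset.univ.erase i, (1 - C (x j) * X)) *
      derivative (1 - C (x i) * X)).coeff k =
      -∑ j ∈ Finset.range (k + 1), x i ^ (j + 1) * sgnEsymm (k - j) x := by
    intro i
    have h2 := genPoly_coeff_erase Finset.univ x (Finset.mem_univ i) k
    rw [show derivative (1 - C (x i) * X) = C (-(x i)) by simp, coeff_mul_C, ← genPoly, h2,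
      mul_comm, neg_mul, Finset.mul_sum]
    simp only [pow_succ', mul_assoc, sgnEsymm]
  rw [Finset.sum_congr rfl fun i _ => this i, Finset.sum_neg_distrib, Finset.sum_comm]
  simp only [powerSum, Finset.sum_mul]

/-- Product of signed elementary symmetric functions. -/
def sgnProd {n : ℕ} (κ : List ℕ) (x : Fin n → ℝ) : ℝ := (κ.map (sgnEsymm · x)).prod

@[simp] lemma sgnProd_nil {n : ℕ} (x : Fin n → ℝ) : sgnProd [] x = 1 := rfl
@[simp] lemma sgnProd_cons {n : ℕ} (k : ℕ) (κ : List ℕ) (x : Fin n → ℝ) :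
    sgnProd (k :: κ) x = sgnEsymm k x * sgnProd κ x := by simp [sgnProd]
lemma sgnProd_append {n : ℕ} (κ κ' : List ℕ) (x : Fin n → ℝ) :
    sgnProd (κ ++ κ') x = sgnProd κ x * sgnProd κ' x := by simp [sgnProd]

/-- `F` is a combination of products `sgnProd κ` with `κ` of positive parts and size at most `D`,
whose coefficients have weighted `ℓ¹` norm at most `B`. -/
def SymRep (n : ℕ) (D : ℤ) (B : ℝ) (F : (Fin n → ℝ) → ℝ) : Prop :=
  ∃ (ι : Type) (_ : Fintype ι) (c : ι → ℝ) (κ : ι → List ℕ),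
    (∀ i, 0 ∉ κ i ∧ ((κ i).sum : ℤ) ≤ D) ∧ ∑ i, |c i| * (n : ℝ) ^ (κ i).sum ≤ B ∧
    ∀ x, F x = ∑ i, c i * sgnProd (κ i) x

namespace SymRep
variable {n : ℕ} {D D' : ℤ} {B B' : ℝ} {F G : (Fin n → ℝ) → ℝ}

lemma weaken (h : SymRep n D B F) (hD : D ≤ D') (hB : B ≤ B') : SymRep n D' B' F := by
  obtain ⟨ι, _, c, κ, h1, h2, h3⟩ := h
  exact ⟨ι, _, c, κ, fun i => ⟨(h1 i).1, (h1 i).2.trans hD⟩, h2.trans hB, h3⟩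

lemma add (hF : SymRep n D B F) (hG : SymRep n D B' G) : SymRep n D (B + B') (fun x => F x + G x) := by
  obtain ⟨ι, _, c, κ, h1, h2, h3⟩ := hF
  obtain ⟨ι', _, c', κ', h1', h2', h3'⟩ := hG
  refine ⟨ι ⊕ ι', inferInstance, Sum.elim c c', Sum.elim κ κ', ?_, ?_, ?_⟩
  · rintro (i | i)
    exacts [h1 i, h1' i]
  · simpa using add_le_add h2 h2'
  · intro x; simp [h3, h3']

lemma mul (hF : SymRep n D B F) (hG : SymRep n D' B' G) :
    SymRep n (D + D') (B * B') (fun x => F x * G x) := by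
  obtain ⟨ι, _, c, κ, h1, h2, h3⟩ := hF
  obtain ⟨ι', _, c', κ', h1', h2', h3'⟩ := hG
  refine ⟨ι × ι', inferInstance, fun p => c p.1 * c' p.2, fun p => κ p.1 ++ κ' p.2, ?_, ?_, ?_⟩
  · rintro ⟨i, j⟩
    refine ⟨by simp [(h1 i).1, (h1' j).1], ?_⟩
    have := (h1 i).2; have := (h1' j).2
    simp only [List.sum_append, Nat.cast_add]; omega
  · have : ∑ p : ι × ι', |c p.1 * c' p.2| * (n : ℝ) ^ (κ p.1 ++ κ' p.2).sum =
        (∑ i, |c i| * (n : ℝ) ^ (κ i).sum) * ∑ i, |c' i| * (n : ℝ) ^ (κ' i).sum := by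
      rw [Fintype.sum_prod_type, Finset.sum_mul_sum]
      refine Finset.sum_congr rfl fun i _ => Finset.sum_congr rfl fun j _ => ?_
      rw [abs_mul, List.sum_append, pow_add]; ring
    rw [this]
    have hB : 0 ≤ B := le_trans (Finset.sum_nonneg fun i _ => by positivity) h2
    exact mul_le_mul h2 h2' (Finset.sum_nonneg fun i _ => by positivity) hB
  · intro x
    simp only [h3, h3']
    rw [Fintype.sum_prod_type, Finset.sum_mul_sum]
    refine Finset.sum_congr rfl fun i _ => Finset.sum_congr rfl fun j _ => ?_
    rw [sgnProd_append]; ring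

lemma nonneg (hF : SymRep n D B F) : 0 ≤ B := by
  obtain ⟨ι, _, c, κ, h1, h2, h3⟩ := hF
  exact le_trans (Finset.sum_nonneg fun i _ => by positivity) h2

lemma const (c : ℝ) : SymRep n 0 |c| (fun _ => c) :=
  ⟨Unit, inferInstance, fun _ => c, fun _ => [], by simp, by simp, by simp⟩

lemma zero (hB : 0 ≤ B) : SymRep n D B (fun _ => 0) :=
  ⟨Empty, inferInstance, Empty.elim, Empty.elim, by simp, by simpa, by simp⟩

lemma smul (hF : SymRep n D B F) (c : ℝ) : SymRep n D (|c| * B) (fun x => c * F x) := by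
  simpa using (const c).mul hF

lemma sgnEsymm (k : ℕ) : SymRep n k ((n : ℝ) ^ k) (fun x => _root_.sgnEsymm k x) := by
  rcases Nat.eq_zero_or_pos k with rfl | hk
  · simpa using const (n := n) 1
  · exact ⟨Unit, inferInstance, fun _ => 1, fun _ => [k], by simp [hk.ne], by simp, by simp⟩

lemma sum {α : Type*} (s : Finset α) {B : α → ℝ} {F : α → (Fin n → ℝ) → ℝ}
    (h : ∀ i ∈ s, SymRep n D (B i) (F i)) : SymRep n D (∑ i ∈ s, B i) (fun x => ∑ i ∈ s, F i x) := by
  classical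
  induction s using Finset.induction_on with
  | empty => simpa using zero le_rfl
  | insert a s ha ih =>
    simp only [Finset.sum_insert ha]
    exact (h a (by simp)).add (ih fun i hi => h i (by simp [hi]))

lemma sgnProd (κ : List ℕ) : SymRep n κ.sum ((n : ℝ) ^ κ.sum) (fun x => _root_.sgnProd κ x) := by
  induction κ with
  | nil => simpa using const (n := n) 1
  | cons k κ ih => simpa [pow_add] using (sgnEsymm (n := n) k).mul ih

end SymRep

/-- A family `F n` of functions on `ℝ ^ n`, uniformly `SymRep`resented with norms `O(n ^ E)`. -/
def SymFam (D E : ℤ) (F : ∀ n, (Fin n → ℝ) → ℝ) : Prop :=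
  ∃ C : ℝ, ∀ n, 1 ≤ n → SymRep n D (C * (n : ℝ) ^ E) (F n)

namespace SymFam
variable {D D' E E' : ℤ} {F G : ∀ n, (Fin n → ℝ) → ℝ}

lemma weaken (h : SymFam D E F) (hD : D ≤ D') (hE : E ≤ E') : SymFam D' E' F := by
  obtain ⟨C, hC⟩ := h
  refine ⟨C, fun n hn => (hC n hn).weaken hD ?_⟩
  have hn' : (1 : ℝ) ≤ n := by exact_mod_cast hn
  have h0 : 0 ≤ C := by
    have := (hC 1 le_rfl).nonneg
    simpa using this
  gcongr

lemma add (hF : SymFam D E F) (hG : SymFam D E G) : SymFam D E (fun n x => F n x + G n x) := by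
  obtain ⟨C, hC⟩ := hF
  obtain ⟨C', hC'⟩ := hG
  refine ⟨C + C', fun n hn => ?_⟩
  simpa [add_mul] using (hC n hn).add (hC' n hn)

lemma mul (hF : SymFam D E F) (hG : SymFam D' E' G) :
    SymFam (D + D') (E + E') (fun n x => F n x * G n x) := by
  obtain ⟨C, hC⟩ := hF
  obtain ⟨C', hC'⟩ := hG
  refine ⟨C * C', fun n hn => ?_⟩
  have hn' : (n : ℝ) ≠ 0 := by positivity
  convert (hC n hn).mul (hC' n hn) using 1
  rw [zpow_add₀ hn']; ring

lemma const {c : ℕ → ℝ} {C : ℝ} (hc : ∀ n : ℕ, 1 ≤ n → |c n| ≤ C * (n : ℝ) ^ E) :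
    SymFam 0 E (fun n _ => c n) :=
  ⟨C, fun n hn => (SymRep.const (c n)).weaken le_rfl (hc n hn)⟩

lemma zero : SymFam D E (fun _ _ => 0) := ⟨0, fun n _ => by simpa using SymRep.zero le_rfl⟩

lemma smul (hF : SymFam D E F) (c : ℝ) : SymFam D E (fun n x => c * F n x) := by
  simpa using (const (E := 0) (c := fun _ => c) (C := |c|) (by simp)).mul hF

lemma neg (hF : SymFam D E F) : SymFam D E (fun n x => -F n x) := by simpa using hF.smul (-1)

lemma sub (hF : SymFam D E F) (hG : SymFam D E G) : SymFam D E (fun n x => F n x - G n x) := by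
  simpa [sub_eq_add_neg] using hF.add hG.neg

lemma sgnEsymm (k : ℕ) : SymFam k k (fun _ x => _root_.sgnEsymm k x) :=
  ⟨1, fun n _ => by simpa using SymRep.sgnEsymm (n := n) k⟩

lemma sgnProd (κ : List ℕ) : SymFam κ.sum κ.sum (fun _ x => _root_.sgnProd κ x) :=
  ⟨1, fun n _ => by
    rw [one_mul, zpow_natCast]
    exact SymRep.sgnProd (n := n) κ⟩

lemma sum {α : Type*} (s : Finset α) {F : α → ∀ n, (Fin n → ℝ) → ℝ}
    (h : ∀ i ∈ s, SymFam D E (F i)) : SymFam D E (fun n x => ∑ i ∈ s, F i n x) := by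
  classical
  induction s using Finset.induction_on with
  | empty => simpa using zero
  | insert a s ha ih =>
    simp only [Finset.sum_insert ha]
    exact (h a (by simp)).add (ih fun i hi => h i (by simp [hi]))

lemma congr (h : SymFam D E F) (hFG : ∀ n, 1 ≤ n → ∀ x, F n x = G n x) : SymFam D E G := by
  obtain ⟨C, hC⟩ := h
  refine ⟨C, fun n hn => ?_⟩
  rw [show G n = F n from funext fun x => (hFG n hn x).symm]
  exact hC n hn

lemma powerSum_succ (j : ℕ) : SymFam (j + 1) (j + 1) (fun _ x => powerSum (j + 1) x) := by
  induction j using Nat.strong_induction_on with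
  | _ k ih =>
  have h1 : SymFam (k + 1) (k + 1) (fun n x => -(k + 1 : ℝ) * _root_.sgnEsymm (k + 1) x
      - ∑ j ∈ Finset.range k, powerSum (j + 1) x * _root_.sgnEsymm (k - j) x) := by
    refine sub ?_ (sum _ fun j hj => ?_)
    · exact_mod_cast (sgnEsymm (k + 1)).smul _
    · have hj' := Finset.mem_range.1 hj
      exact ((ih j hj').mul (sgnEsymm (k - j))).weaken (by omega) (by omega)
  refine h1.congr fun n _ x => ?_
  have := sgnEsymm_newton k x
  rw [Finset.sum_range_succ] at this
  simp at this
  linarith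

lemma powerSum_pos {j : ℕ} (hj : 0 < j) : SymFam j j (fun _ x => powerSum j x) := by
  obtain ⟨j, rfl⟩ : ∃ i, j = i + 1 := ⟨j - 1, by omega⟩
  exact_mod_cast powerSum_succ j

lemma powerSum (j : ℕ) : SymFam j (j + 1) (fun _ x => _root_.powerSum j x) := by
  rcases Nat.eq_zero_or_pos j with rfl | hj
  · refine (const (E := 1) (c := fun n => (n : ℝ)) (C := 1) (by simp)).congr fun n _ x => ?_
    simp [_root_.powerSum]
  · exact (powerSum_pos hj).weaken le_rfl (by omega)

end SymFam

/-- All lists obtained from `J` by adding `j` to one of its entries. -/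
def bumpList (j : ℕ) : List ℕ → List (List ℕ)
  | [] => []
  | l :: J => ((l + j) :: J) :: (bumpList j J).map (l :: ·)

lemma length_of_mem_bumpList {j : ℕ} {J K : List ℕ} (h : K ∈ bumpList j J) :
    K.length = J.length := by
  induction J generalizing K with
  | nil => simp [bumpList] at h
  | cons l J ih =>
    simp only [bumpList, List.mem_cons, List.mem_map] at h
    rcases h with rfl | ⟨K', hK', rfl⟩
    · simp
    · simp [ih hK']

lemma sum_of_mem_bumpList {j : ℕ} {J K : List ℕ} (h : K ∈ bumpList j J) :
    K.sum = j + J.sum := by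
  induction J generalizing K with
  | nil => simp [bumpList] at h
  | cons l J ih =>
    simp only [bumpList, List.mem_cons, List.mem_map] at h
    rcases h with rfl | ⟨K', hK', rfl⟩
    · simp; omega
    · simp [ih hK']; omega

lemma forall_of_mem_bumpList {P : ℕ → Prop} (hP : ∀ i j, P i → P j → P (i + j)) {j : ℕ}
    (hj : P j) {J K : List ℕ} (hJ : ∀ l ∈ J, P l) (h : K ∈ bumpList j J) : ∀ l ∈ K, P l := by
  induction J generalizing K with
  | nil => simp [bumpList] at h
  | cons l J ih =>
    simp only [List.mem_cons, forall_eq_or_imp] at hJ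
    simp only [bumpList, List.mem_cons, List.mem_map] at h
    rcases h with rfl | ⟨K', hK', rfl⟩
    · simp only [List.mem_cons, forall_eq_or_imp]
      exact ⟨hP _ _ hJ.1 hj, hJ.2⟩
    · simp only [List.mem_cons, forall_eq_or_imp]
      exact ⟨hJ.1, ih hJ.2 hK'⟩

/-- Product law of `n` independent gamma variables with shape `θ` and rate `r`. -/
def gammaPi (θ r : ℝ) (n : ℕ) : Measure (Fin n → ℝ) :=
  Measure.pi fun _ => ProbabilityTheory.gammaMeasure θ r

/-- Joint moment of the weighted sums `∑ x_i ^ j g_i`, `j ∈ J`, of independent gamma variables. -/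
def gammaMoment (θ r : ℝ) {n : ℕ} (J : List ℕ) (x : Fin n → ℝ) : ℝ :=
  ∫ g, (J.map fun j => ∑ i, x i ^ j * g i).prod ∂(gammaPi θ r n)

open ProbabilityTheory in
lemma measurable_gammaPDF (θ r : ℝ) : Measurable (gammaPDF θ r) :=
  (measurable_gammaPDFReal θ r).ennreal_ofReal

open ProbabilityTheory in
lemma ae_nonneg_gammaMeasure (θ r : ℝ) : ∀ᵐ x ∂(gammaMeasure θ r), 0 ≤ x := by
  rw [gammaMeasure, ae_withDensity_iff (measurable_gammaPDF θ r)]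
  refine Eventually.of_forall fun x hx => ?_
  by_contra h
  exact hx (gammaPDF_of_neg (not_le.1 h))

open ProbabilityTheory in
lemma lintegral_pow_gammaMeasure {θ r : ℝ} (hθ : 0 < θ) (hr : 0 < r) (k : ℕ) :
    ∫⁻ x, ENNReal.ofReal (x ^ k) ∂(gammaMeasure θ r) =
      ENNReal.ofReal (Real.Gamma (θ + k) / (Real.Gamma θ * r ^ k)) := by
  have h1 := Real.Gamma_pos_of_pos hθ
  have hk : 0 < θ + k := by positivity
  have h2 := Real.Gamma_pos_of_pos hk
  rw [gammaMeasure, lintegral_withDensity_eq_lintegral_mul _ (measurable_gammaPDF θ r)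
    (by fun_prop), ← mul_one (ENNReal.ofReal _), ← lintegral_gammaPDF_eq_one hk hr,
    ← lintegral_const_mul _ (measurable_gammaPDF _ r)]
  refine lintegral_congr_ae ?_
  filter_upwards [(Measure.ae_ne volume (0 : ℝ))] with x hx0
  rcases lt_or_gt_of_ne hx0 with hx | hx
  · simp [gammaPDF_of_neg hx]
  · simp only [Pi.mul_apply]
    rw [gammaPDF_of_nonneg hx.le, gammaPDF_of_nonneg hx.le, ← ENNReal.ofReal_mul (by positivity),
      ← ENNReal.ofReal_mul (by positivity)]
    congr 1
    rw [show θ + k - 1 = (θ - 1) + k by ring, Real.rpow_add_natCast hx.ne',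
      Real.rpow_add_natCast hr.ne']
    field_simp

open ProbabilityTheory in
lemma integrable_pow_gammaMeasure {θ r : ℝ} (hθ : 0 < θ) (hr : 0 < r) (k : ℕ) :
    Integrable (fun x => x ^ k) (gammaMeasure θ r) := by
  refine ⟨by fun_prop, ?_⟩
  rw [hasFiniteIntegral_iff_ofReal, lintegral_pow_gammaMeasure hθ hr]
  · simp
  · filter_upwards [ae_nonneg_gammaMeasure θ r] with x hx
    exact pow_nonneg hx k

open ProbabilityTheory in
lemma integral_pow_gammaMeasure {θ r : ℝ} (hθ : 0 < θ) (hr : 0 < r) (k : ℕ) :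
    ∫ x, x ^ k ∂(gammaMeasure θ r) = Real.Gamma (θ + k) / (Real.Gamma θ * r ^ k) := by
  have h1 := Real.Gamma_pos_of_pos hθ
  have hk : 0 < θ + k := by positivity
  have h2 := Real.Gamma_pos_of_pos hk
  rw [integral_eq_lintegral_of_nonneg_ae _ (by fun_prop), lintegral_pow_gammaMeasure hθ hr,
    ENNReal.toReal_ofReal (by positivity)]
  filter_upwards [ae_nonneg_gammaMeasure θ r] with x hx
  exact pow_nonneg hx k

open ProbabilityTheory in
lemma integral_pow_succ_gammaMeasure {θ r : ℝ} (hθ : 0 < θ) (hr : 0 < r) (k : ℕ) :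
    r * ∫ x, x ^ (k + 1) ∂(gammaMeasure θ r) = (θ + k) * ∫ x, x ^ k ∂(gammaMeasure θ r) := by
  have h1 := (Real.Gamma_pos_of_pos hθ).ne'
  have hk : θ + k ≠ 0 := by positivity
  rw [integral_pow_gammaMeasure hθ hr, integral_pow_gammaMeasure hθ hr]
  push_cast
  rw [← add_assoc, Real.Gamma_add_one hk, pow_succ]
  field_simp

lemma isProbabilityMeasure_gammaPi {θ r : ℝ} (hθ : 0 < θ) (hr : 0 < r) (n : ℕ) :
    IsProbabilityMeasure (gammaPi θ r n) := by
  have := ProbabilityTheory.isProbabilityMeasure_gammaMeasure hθ hr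
  unfold gammaPi
  infer_instance

lemma integrable_monomial_gammaPi {θ r : ℝ} (hθ : 0 < θ) (hr : 0 < r) {n : ℕ} (c : Fin n → ℕ) :
    Integrable (fun g => ∏ i, g i ^ c i) (gammaPi θ r n) := by
  have := ProbabilityTheory.isProbabilityMeasure_gammaMeasure hθ hr
  exact Integrable.fintype_prod (f := fun i x => x ^ c i) fun i =>
    integrable_pow_gammaMeasure hθ hr (c i)

lemma integrable_eval_gammaPi {θ r : ℝ} (hθ : 0 < θ) (hr : 0 < r) {n : ℕ}
    (P : MvPolynomial (Fin n) ℝ) : Integrable (fun g => P.eval g) (gammaPi θ r n) := by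
  induction P using MvPolynomial.induction_on' with
  | monomial u a =>
    simp only [MvPolynomial.eval_monomial, Finsupp.prod_fintype _ _ (fun _ => pow_zero _)]
    exact (integrable_monomial_gammaPi hθ hr u).const_mul a
  | add p q hp hq =>
    simp only [map_add]
    exact hp.add hq

lemma gammaPi_stein {θ r : ℝ} (hθ : 0 < θ) (hr : 0 < r) {n : ℕ} (i : Fin n)
    (P : MvPolynomial (Fin n) ℝ) :
    r * ∫ g, (MvPolynomial.X i * P).eval g ∂(gammaPi θ r n) =
      θ * (∫ g, P.eval g ∂(gammaPi θ r n)) +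
        ∫ g, (MvPolynomial.X i * MvPolynomial.pderiv i P).eval g ∂(gammaPi θ r n) := by
  have := ProbabilityTheory.isProbabilityMeasure_gammaMeasure hθ hr
  have hI := fun P => integrable_eval_gammaPi hθ hr (n := n) P
  induction P using MvPolynomial.induction_on' with
  | monomial u a =>
    have key : ∀ c : Fin n →₀ ℕ, ∀ b : ℝ,
        ∫ g, (MvPolynomial.monomial c b).eval g ∂(gammaPi θ r n) =
        b * ∏ j, ∫ x, x ^ c j ∂(ProbabilityTheory.gammaMeasure θ r) := by
      intro c b
      simp only [MvPolynomial.eval_monomial, Finsupp.prod_fintype _ _ (fun _ => pow_zero _),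
        integral_const_mul, gammaPi]
      rw [integral_fintype_prod_eq_prod (fun j x => x ^ c j)]
    have hX : MvPolynomial.X i * MvPolynomial.pderiv i (MvPolynomial.monomial u a) =
        MvPolynomial.monomial u (a * u i) := by
      rw [MvPolynomial.X_mul_pderiv_monomial, ← map_nsmul, nsmul_eq_mul, mul_comm]
    rw [hX, MvPolynomial.X, MvPolynomial.monomial_mul, key, key, key,
      ← Finset.mul_prod_erase _ _ (Finset.mem_univ i), ← Finset.mul_prod_erase _ _ (Finset.mem_univ i)]
    have h2 : ∏ j ∈ Finset.univ.erase i, ∫ x, x ^ (Finsupp.single i 1 + u : Fin n →₀ ℕ) j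
          ∂(ProbabilityTheory.gammaMeasure θ r) =
        ∏ j ∈ Finset.univ.erase i, ∫ x, x ^ u j ∂(ProbabilityTheory.gammaMeasure θ r) := by
      refine Finset.prod_congr rfl fun j hj => ?_
      simp [Finsupp.single_apply, (Finset.ne_of_mem_erase hj).symm]
    rw [h2]
    have h3 : (Finsupp.single i 1 + u : Fin n →₀ ℕ) i = u i + 1 := by simp [add_comm]
    rw [h3]
    have := integral_pow_succ_gammaMeasure hθ hr (u i)
    linear_combination
      a * (∏ j ∈ Finset.univ.erase i, ∫ x, x ^ u j ∂(ProbabilityTheory.gammaMeasure θ r)) * this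
  | add p q hp hq =>
    simp only [mul_add, map_add]
    rw [integral_add (hI _) (hI _), integral_add (hI _) (hI _), integral_add (hI _) (hI _)]
    linear_combination hp + hq

/-- The polynomial `∑ x_i ^ j X_i`. -/
def wtSumPoly {n : ℕ} (x : Fin n → ℝ) (j : ℕ) : MvPolynomial (Fin n) ℝ :=
  ∑ i, MvPolynomial.C (x i ^ j) * MvPolynomial.X i

lemma eval_wtSumPoly_prod {n : ℕ} (x g : Fin n → ℝ) (J : List ℕ) :
    ((J.map (wtSumPoly x)).prod).eval g = (J.map fun j => ∑ i, x i ^ j * g i).prod := by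
  induction J with
  | nil => simp
  | cons j J ih => simp [ih, wtSumPoly]

lemma gammaMoment_eq (θ r : ℝ) {n : ℕ} (J : List ℕ) (x : Fin n → ℝ) :
    gammaMoment θ r J x = ∫ g, ((J.map (wtSumPoly x)).prod).eval g ∂(gammaPi θ r n) := by
  simp only [gammaMoment, eval_wtSumPoly_prod]

lemma integrable_gammaMoment {θ r : ℝ} (hθ : 0 < θ) (hr : 0 < r) {n : ℕ} (J : List ℕ)
    (x : Fin n → ℝ) :
    Integrable (fun g => (J.map fun j => ∑ i, x i ^ j * g i).prod) (gammaPi θ r n) := by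
  simp only [← eval_wtSumPoly_prod]
  exact integrable_eval_gammaPi hθ hr _

lemma sum_pderiv_wtSumPoly_prod {n : ℕ} (x : Fin n → ℝ) (j : ℕ) (J : List ℕ) :
    ∑ i, MvPolynomial.C (x i ^ j) * (MvPolynomial.X i *
      MvPolynomial.pderiv i ((J.map (wtSumPoly x)).prod)) =
    ((bumpList j J).map fun K => (K.map (wtSumPoly x)).prod).sum := by
  induction J with
  | nil => simp [bumpList]
  | cons l J ih =>
    have h1 : ∀ i, MvPolynomial.pderiv i (wtSumPoly x l) = MvPolynomial.C (x i ^ l) := by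
      intro i
      simp only [wtSumPoly, map_sum, MvPolynomial.pderiv_C_mul, MvPolynomial.pderiv_X,
        Pi.single_apply]
      simp
    simp only [List.map_cons, List.prod_cons, Derivation.leibniz, smul_eq_mul, h1, bumpList,
      List.sum_cons, List.map_map, Function.comp_def]
    rw [List.sum_map_mul_left, ← ih, Finset.mul_sum, show wtSumPoly x (l + j) = ∑ i,
        MvPolynomial.C (x i ^ (l + j)) * MvPolynomial.X i from rfl, Finset.sum_mul,
      ← Finset.sum_add_distrib]
    refine Finset.sum_congr rfl fun i _ => ?_
    simp only [pow_add, map_mul]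
    ring

lemma gammaMoment_nil {θ r : ℝ} (hθ : 0 < θ) (hr : 0 < r) {n : ℕ} (x : Fin n → ℝ) :
    gammaMoment θ r [] x = 1 := by
  have := isProbabilityMeasure_gammaPi hθ hr n
  simp [gammaMoment]

lemma gammaMoment_cons {θ r : ℝ} (hθ : 0 < θ) (hr : 0 < r) {n : ℕ} (j : ℕ) (J : List ℕ)
    (x : Fin n → ℝ) :
    r * gammaMoment θ r (j :: J) x = θ * powerSum j x * gammaMoment θ r J x +
      ((bumpList j J).map fun K => gammaMoment θ r K x).sum := by
  have hI := fun P => integrable_eval_gammaPi hθ hr (n := n) P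
  have hsum : ∀ s : List (MvPolynomial (Fin n) ℝ),
      ∫ g, (s.sum).eval g ∂(gammaPi θ r n) = (s.map fun P => ∫ g, P.eval g ∂(gammaPi θ r n)).sum := by
    intro s
    induction s with
    | nil => simp
    | cons P s ih =>
      simp only [List.sum_cons, map_add, List.map_cons]
      rw [integral_add (hI _) (hI _), ih]
  have hb := hsum ((bumpList j J).map fun K => (K.map (wtSumPoly x)).prod)
  rw [← sum_pderiv_wtSumPoly_prod, List.map_map] at hb
  simp only [Function.comp_def, ← gammaMoment_eq] at hb
  rw [← hb, gammaMoment_eq, gammaMoment_eq]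
  simp only [List.map_cons, List.prod_cons, wtSumPoly, Finset.sum_mul, map_sum, mul_assoc]
  rw [integral_finset_sum _ (fun i _ => hI _), integral_finset_sum _ (fun i _ => hI _),
    powerSum, Finset.mul_sum, Finset.sum_mul, Finset.mul_sum, ← Finset.sum_add_distrib]
  refine Finset.sum_congr rfl fun i _ => ?_
  have h := gammaPi_stein hθ hr i ((J.map (wtSumPoly x)).prod)
  simp only [map_mul, MvPolynomial.eval_C, integral_const_mul] at h ⊢
  linear_combination x i ^ j * h

lemma SymFam.list_sum {D E : ℤ} {α : Type*} (s : List α) {F : α → ∀ n, (Fin n → ℝ) → ℝ}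
    (h : ∀ i ∈ s, SymFam D E (F i)) : SymFam D E (fun n x => (s.map fun i => F i n x).sum) := by
  induction s with
  | nil => simpa using SymFam.zero
  | cons a s ih =>
    simp only [List.map_cons, List.sum_cons]
    exact (h a (by simp)).add (ih fun i hi => h i (by simp [hi]))

lemma symFam_gammaMoment_of {θ r : ℝ} (hθ : 0 < θ) (hr : 0 < r) {P : ℕ → Prop}
    (hP : ∀ i j, P i → P j → P (i + j)) (t : ℕ)
    (ht : ∀ j : ℕ, P j → SymFam j (j + t) (fun _ x => powerSum j x)) (J : List ℕ)
    (hJ : ∀ j ∈ J, P j) :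
    SymFam (J.sum : ℕ) ((J.sum + t * J.length : ℕ) : ℤ) (fun _ x => gammaMoment θ r J x) := by
  induction hl : J.length generalizing J with
  | zero =>
    obtain rfl := List.length_eq_zero_iff.1 hl
    simp only [gammaMoment_nil hθ hr]
    exact SymFam.const (C := 1) (by simp)
  | succ l ih =>
    obtain ⟨j, J, rfl⟩ := List.exists_cons_of_length_eq_add_one hl
    simp only [List.length_cons, add_left_inj, List.mem_cons, forall_eq_or_imp] at hl hJ
    have h1 := ((ht j hJ.1).smul θ).mul (ih J hJ.2 hl)
    have h2 : SymFam ((j :: J).sum : ℕ) (((j :: J).sum + t * (l + 1) : ℕ) : ℤ) (fun _ x =>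
        ((bumpList j J).map fun K => gammaMoment θ r K x).sum) := by
      refine SymFam.list_sum _ fun K hK => ?_
      have h3 := ih K (forall_of_mem_bumpList hP hJ.1 hJ.2 hK)
        ((length_of_mem_bumpList hK).trans hl)
      rw [sum_of_mem_bumpList hK] at h3
      refine h3.weaken (by simp) ?_
      simp only [List.sum_cons]
      push_cast
      nlinarith
    have h4 := ((h1.weaken (D' := ((j :: J).sum : ℕ)) (E' := (((j :: J).sum + t * (l + 1) : ℕ) : ℤ))
      (by simp) (by simp only [List.sum_cons]; push_cast; nlinarith)).add h2).smul r⁻¹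
    refine h4.congr fun n _ x => ?_
    rw [← gammaMoment_cons hθ hr, inv_mul_cancel_left₀ hr.ne']

lemma symFam_gammaMoment {θ r : ℝ} (hθ : 0 < θ) (hr : 0 < r) (J : List ℕ) :
    SymFam (J.sum : ℕ) ((J.sum + J.length : ℕ) : ℤ) (fun _ x => gammaMoment θ r J x) := by
  simpa using! symFam_gammaMoment_of hθ hr (P := fun _ => True) (by simp) 1
    (fun j _ => SymFam.powerSum j) J (by simp)

lemma symFam_gammaMoment_pos {θ r : ℝ} (hθ : 0 < θ) (hr : 0 < r) (J : List ℕ)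
    (hJ : ∀ j ∈ J, 0 < j) :
    SymFam (J.sum : ℕ) (J.sum : ℕ) (fun _ x => gammaMoment θ r J x) := by
  simpa using! symFam_gammaMoment_of hθ hr (P := fun j => 0 < j) (by intros; omega) 0
    (fun j hj => by simpa using SymFam.powerSum_pos hj) J hJ

/-- The conditional expectation, given the level `x` of size `n`, of `∏_{j ∈ J} m_j ∏_{k ∈ κ} s_k`
over the level below, where `m_j` are the moments of the Dirichlet weights. -/
def dixonMoment (θ : ℝ) {n : ℕ} : List ℕ → List ℕ → (Fin n → ℝ) → ℝ
  | J, [], x => gammaMoment θ 1 J x / ∏ i ∈ Finset.range J.length, (n * θ + i)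
  | J, k :: κ, x => sgnEsymm k x * dixonMoment θ J κ x +
      ∑ j ∈ Finset.range k, sgnEsymm (k - 1 - j) x * dixonMoment θ ((j + 1) :: J) κ x

lemma symFam_dixonMoment {θ : ℝ} (hθ : 0 < θ) (J κ : List ℕ) (hJ : ∀ j ∈ J, 0 < j) :
    SymFam (J.sum + κ.sum : ℕ) (J.sum + κ.sum - J.length : ℤ)
      (fun _ x => dixonMoment θ J κ x) := by
  induction κ generalizing J with
  | nil =>
    have h1 := symFam_gammaMoment_pos hθ one_pos J hJ
    have h2 : SymFam 0 (-(J.length : ℤ))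
        (fun n _ => (∏ i ∈ Finset.range J.length, ((n : ℝ) * θ + i))⁻¹) := by
      refine SymFam.const (C := (θ ^ J.length)⁻¹) fun n hn => ?_
      have hn' : (0 : ℝ) < n := by exact_mod_cast hn
      rw [abs_of_nonneg (by positivity), zpow_neg, zpow_natCast, ← mul_inv, ← mul_pow]
      gcongr
      calc (θ * n : ℝ) ^ J.length = ∏ i ∈ Finset.range J.length, (θ * n) := by simp
        _ ≤ _ := Finset.prod_le_prod (fun i _ => by positivity) fun i _ => by
          have : (0 : ℝ) ≤ i := by positivity
          linarith
    refine ((h1.mul h2).weaken (by simp) (by simp)).congr fun n _ x => ?_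
    simp [dixonMoment, div_eq_mul_inv]
  | cons k κ ih =>
    simp only [dixonMoment]
    refine SymFam.add ?_ (SymFam.sum _ fun j hj => ?_)
    · exact ((SymFam.sgnEsymm k).mul (ih J hJ)).weaken (by simp; omega) (by simp; omega)
    · have := Finset.mem_range.1 hj
      refine ((SymFam.sgnEsymm (k - 1 - j)).mul (ih ((j + 1) :: J) (by simpa using hJ))).weaken ?_ ?_
      · simp only [List.sum_cons]; push_cast; omega
      · simp only [List.sum_cons, List.length_cons]; push_cast; omega

lemma symFam_dixonMoment_singleton {θ : ℝ} (hθ : 0 < θ) {j : ℕ} (hj : 0 < j) (κ : List ℕ) :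
    SymFam (j + κ.sum : ℕ) (j + κ.sum - 2 : ℤ)
      (fun n x => dixonMoment θ [j] κ x - powerSum j x * sgnProd κ x / n) := by
  induction κ with
  | nil =>
    refine SymFam.zero.congr fun n hn x => ?_
    have hn' : (n : ℝ) ≠ 0 := by positivity
    have h := gammaMoment_cons hθ one_pos j [] x
    simp only [one_mul, bumpList, gammaMoment_nil hθ one_pos] at h
    simp only [dixonMoment, h]
    simp
    field_simp
    simp
  | cons k κ ih =>
    have h1 := (SymFam.sgnEsymm k).mul ih
    have h2 : SymFam (j + (k :: κ).sum : ℕ) (j + (k :: κ).sum - 2 : ℤ)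
        (fun _ x => ∑ i ∈ Finset.range k,
          sgnEsymm (k - 1 - i) x * dixonMoment θ ((i + 1) :: [j]) κ x) := by
      refine SymFam.sum _ fun i hi => ?_
      have := Finset.mem_range.1 hi
      refine ((SymFam.sgnEsymm (k - 1 - i)).mul
        (symFam_dixonMoment hθ [i + 1, j] κ (by simpa using hj))).weaken ?_ ?_
      · simp only [List.sum_cons, List.sum_nil]; push_cast; omega
      · simp only [List.sum_cons, List.length_cons, List.sum_nil, List.length_nil]; push_cast; omega
    refine ((h1.weaken (by simp; omega) (by simp; omega)).add h2).congr fun n _ x => ?_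
    simp only [dixonMoment, sgnProd_cons]
    ring

lemma symFam_dixonMoment_nil {θ : ℝ} (hθ : 0 < θ) (κ : List ℕ) :
    SymFam (κ.sum : ℕ) (κ.sum - 2 : ℤ)
      (fun n x => dixonMoment θ [] κ x - (1 - κ.sum / n) * sgnProd κ x) := by
  induction κ with
  | nil =>
    refine SymFam.zero.congr fun n hn x => ?_
    simp [dixonMoment, gammaMoment_nil hθ one_pos]
  | cons k κ ih =>
    have h1 := (SymFam.sgnEsymm k).mul ih
    have h2 : SymFam ((k :: κ).sum : ℕ) ((k :: κ).sum - 2 : ℤ)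
        (fun n x => ∑ i ∈ Finset.range k, sgnEsymm (k - 1 - i) x *
          (dixonMoment θ [i + 1] κ x - powerSum (i + 1) x * sgnProd κ x / n)) := by
      refine SymFam.sum _ fun i hi => ?_
      have := Finset.mem_range.1 hi
      refine ((SymFam.sgnEsymm (k - 1 - i)).mul
        (symFam_dixonMoment_singleton hθ i.succ_pos κ)).weaken ?_ ?_
      · simp only [List.sum_cons]; push_cast; omega
      · simp only [List.sum_cons]; push_cast; omega
    refine ((h1.weaken (by simp) (by simp only [List.sum_cons]; push_cast; omega)).add h2).congr
      fun n hn x => ?_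
    have hn' : (n : ℝ) ≠ 0 := by positivity
    have hN : (k : ℝ) * sgnEsymm k x =
        -∑ i ∈ Finset.range k, sgnEsymm (k - 1 - i) x * powerSum (i + 1) x := by
      rcases k with _ | k
      · simp
      · have := sgnEsymm_newton k x
        push_cast
        rw [this]
        simp [mul_comm]
    simp only [dixonMoment, sgnProd_cons, mul_sub, Finset.sum_sub_distrib, List.sum_cons]
    have h3 : ∑ i ∈ Finset.range k, sgnEsymm (k - 1 - i) x *
        (powerSum (i + 1) x * sgnProd κ x / n) = -(k * sgnEsymm k x) * sgnProd κ x / n := by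
      rw [hN, neg_neg, Finset.sum_mul, Finset.sum_div]
      exact Finset.sum_congr rfl fun i _ => by ring
    rw [h3]
    push_cast
    ring

/-- The conditional expectation, given the level `x` of size `n` of the Gaussian beta corners
process, of `g ^ a ∏_{j ∈ J} (∑ q_i x_i ^ j) ∏_{k ∈ κ} s_k` over the level above. -/
def cornerMoment (θ : ℝ) (γ : ℕ → ℝ) {n : ℕ} : ℕ → List ℕ → List ℕ → (Fin n → ℝ) → ℝ
  | a, J, [], x => γ a * gammaMoment θ θ J x
  | a, J, k :: κ, x => sgnEsymm k x * cornerMoment θ γ a J κ x -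
      (if 1 ≤ k then sgnEsymm (k - 1) x * cornerMoment θ γ (a + 1) J κ x else 0) -
      ∑ j ∈ Finset.range (k - 1), sgnEsymm (k - 2 - j) x * cornerMoment θ γ a (j :: J) κ x

/-- Leading correction in the one-step recursion for the Gaussian beta ensemble. -/
def cornerMain {n : ℕ} : List ℕ → (Fin n → ℝ) → ℝ
  | [], _ => 0
  | k :: κ, x => sgnEsymm k x * cornerMain κ x +
      if 2 ≤ k then sgnEsymm (k - 2) x * sgnProd κ x else 0

lemma SymFam.ite {D E : ℤ} {p : Prop} [Decidable p] {F : ∀ n, (Fin n → ℝ) → ℝ}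
    (h : p → SymFam D E F) : SymFam D E (fun n x => if p then F n x else 0) := by
  by_cases hp : p
  · simpa [hp] using h hp
  · simpa [hp] using SymFam.zero

lemma symFam_cornerMoment {θ : ℝ} (hθ : 0 < θ) (γ : ℕ → ℝ) (a : ℕ) (J κ : List ℕ) :
    SymFam (κ.sum + J.sum : ℕ) (κ.sum + J.sum + J.length : ℤ)
      (fun _ x => cornerMoment θ γ a J κ x) := by
  induction κ generalizing a J with
  | nil =>
    exact ((symFam_gammaMoment hθ hθ J).smul (γ a)).weaken (by simp) (by simp)
  | cons k κ ih =>
    simp only [cornerMoment]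
    refine SymFam.sub (SymFam.sub ?_ (SymFam.ite fun hk => ?_)) (SymFam.sum _ fun j hj => ?_)
    · exact ((SymFam.sgnEsymm k).mul (ih a J)).weaken (by simp; omega) (by simp; omega)
    · exact ((SymFam.sgnEsymm (k - 1)).mul (ih (a + 1) J)).weaken (by simp; omega) (by simp; omega)
    · have := Finset.mem_range.1 hj
      refine ((SymFam.sgnEsymm (k - 2 - j)).mul (ih a (j :: J))).weaken ?_ ?_
      · simp only [List.sum_cons]; push_cast; omega
      · simp only [List.sum_cons, List.length_cons]; push_cast; omega

lemma symFam_cornerMoment_one {θ : ℝ} (hθ : 0 < θ) {γ : ℕ → ℝ} (hγ : γ 1 = 0) (κ : List ℕ) :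
    SymFam (κ.sum - 1 : ℤ) (κ.sum - 1 : ℤ) (fun _ x => cornerMoment θ γ 1 [] κ x) := by
  induction κ with
  | nil => simpa [cornerMoment, hγ] using SymFam.zero
  | cons k κ ih =>
    simp only [cornerMoment]
    refine SymFam.sub (SymFam.sub ?_ (SymFam.ite fun hk => ?_)) (SymFam.sum _ fun j hj => ?_)
    · exact ((SymFam.sgnEsymm k).mul ih).weaken (by simp) (by simp)
    · exact ((SymFam.sgnEsymm (k - 1)).mul (symFam_cornerMoment hθ γ 2 [] κ)).weaken
        (by simp; omega) (by simp; omega)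
    · have := Finset.mem_range.1 hj
      refine ((SymFam.sgnEsymm (k - 2 - j)).mul (symFam_cornerMoment hθ γ 1 [j] κ)).weaken ?_ ?_
      · simp only [List.sum_cons, List.sum_nil]; push_cast; omega
      · simp only [List.sum_cons, List.length_cons, List.sum_nil, List.length_nil]; push_cast; omega

lemma symFam_cornerMoment_singleton {θ : ℝ} (hθ : 0 < θ) {γ : ℕ → ℝ} (hγ : γ 0 = 1) (j : ℕ)
    (κ : List ℕ) :
    SymFam (κ.sum + j - 1 : ℤ) (κ.sum + j : ℤ)
      (fun _ x => cornerMoment θ γ 0 [j] κ x - powerSum j x * sgnProd κ x) := by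
  induction κ with
  | nil =>
    refine SymFam.zero.congr fun n hn x => ?_
    have h := gammaMoment_cons hθ hθ j [] x
    simp only [bumpList, gammaMoment_nil hθ hθ, List.map_nil, List.sum_nil, add_zero, mul_one] at h
    rw [cornerMoment, hγ, mul_left_cancel₀ hθ.ne' h]
    simp
  | cons k κ ih =>
    have h1 : SymFam ((k :: κ).sum + j - 1 : ℤ) ((k :: κ).sum + j : ℤ) (fun _ x =>
      (sgnEsymm k x * (cornerMoment θ γ 0 [j] κ x - powerSum j x * sgnProd κ x) -
      (if 1 ≤ k then sgnEsymm (k - 1) x * cornerMoment θ γ 1 [j] κ x else 0)) -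
      ∑ i ∈ Finset.range (k - 1), sgnEsymm (k - 2 - i) x * cornerMoment θ γ 0 [i, j] κ x) := by
      refine SymFam.sub (SymFam.sub ?_ (SymFam.ite fun hk => ?_)) (SymFam.sum _ fun i hi => ?_)
      · exact ((SymFam.sgnEsymm k).mul ih).weaken (by simp; omega) (by simp; omega)
      · exact ((SymFam.sgnEsymm (k - 1)).mul (symFam_cornerMoment hθ γ 1 [j] κ)).weaken
          (by simp; omega) (by simp; omega)
      · have := Finset.mem_range.1 hi
        refine ((SymFam.sgnEsymm (k - 2 - i)).mul (symFam_cornerMoment hθ γ 0 [i, j] κ)).weaken ?_ ?_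
        · simp only [List.sum_cons, List.sum_nil]; push_cast; omega
        · simp only [List.sum_cons, List.length_cons, List.sum_nil, List.length_nil]; push_cast; omega
    refine h1.congr fun n _ x => ?_
    simp only [cornerMoment, sgnProd_cons]
    ring

lemma symFam_cornerMoment_nil {θ : ℝ} (hθ : 0 < θ) {γ : ℕ → ℝ} (hγ : γ 0 = 1) (hγ1 : γ 1 = 0)
    (κ : List ℕ) :
    SymFam (κ.sum - 2 : ℤ) (κ.sum - 2 : ℤ)
      (fun n x => cornerMoment θ γ 0 [] κ x - sgnProd κ x + n * cornerMain κ x) := by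
  induction κ with
  | nil =>
    refine SymFam.zero.congr fun n hn x => ?_
    simp [cornerMoment, hγ, gammaMoment_nil hθ hθ, cornerMain]
  | cons k κ ih =>
    have h1 : SymFam ((k :: κ).sum - 2 : ℤ) ((k :: κ).sum - 2 : ℤ) (fun n x =>
        (sgnEsymm k x * (cornerMoment θ γ 0 [] κ x - sgnProd κ x + n * cornerMain κ x) -
        (if 1 ≤ k then sgnEsymm (k - 1) x * cornerMoment θ γ 1 [] κ x else 0)) -
        (if 2 ≤ k then sgnEsymm (k - 2) x *
          (cornerMoment θ γ 0 [0] κ x - powerSum 0 x * sgnProd κ x) else 0) -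
        ∑ i ∈ Finset.range (k - 2), sgnEsymm (k - 2 - (i + 1)) x *
          cornerMoment θ γ 0 [i + 1] κ x) := by
      refine SymFam.sub (SymFam.sub (SymFam.sub ?_ (SymFam.ite fun hk => ?_))
        (SymFam.ite fun hk => ?_)) (SymFam.sum _ fun i hi => ?_)
      · exact ((SymFam.sgnEsymm k).mul ih).weaken (by simp; omega) (by simp; omega)
      · exact ((SymFam.sgnEsymm (k - 1)).mul (symFam_cornerMoment_one hθ hγ1 κ)).weaken
          (by simp; omega) (by simp; omega)
      · exact ((SymFam.sgnEsymm (k - 2)).mul (symFam_cornerMoment_singleton hθ hγ 0 κ)).weaken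
          (by simp; omega) (by simp; omega)
      · have := Finset.mem_range.1 hi
        have h2 : SymFam (κ.sum + (i + 1 : ℕ) : ℤ) (κ.sum + (i + 1 : ℕ) : ℤ)
            (fun _ x => cornerMoment θ γ 0 [i + 1] κ x) := by
          refine (((symFam_cornerMoment_singleton hθ hγ (i + 1) κ).weaken (by omega) le_rfl).add
            (((SymFam.powerSum_pos i.succ_pos).mul (SymFam.sgnProd κ)).weaken
              (by push_cast; omega) (by push_cast; omega))).congr fun n _ x => ?_
          ring
        refine ((SymFam.sgnEsymm (k - 2 - (i + 1))).mul h2).weaken ?_ ?_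
        · simp only [List.sum_cons]; push_cast; omega
        · simp only [List.sum_cons]; push_cast; omega
    refine h1.congr fun n _ x => ?_
    simp only [cornerMoment, sgnProd_cons, cornerMain]
    have hp : powerSum 0 x = (n : ℝ) := by simp [powerSum]
    by_cases hk : 2 ≤ k
    · obtain ⟨k, rfl⟩ : ∃ l, k = l + 2 := ⟨k - 2, by omega⟩
      simp only [hk, if_true, hp, show k + 2 - 1 = k + 1 from rfl, Finset.sum_range_succ',
        Nat.add_sub_cancel, Nat.sub_zero]
      ring
    · simp only [hk, if_false, show k - 1 = 0 by omega, show k - 2 = 0 by omega]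
      simp
      ring

/-- The product of all pairwise distances of the entries of `x`. -/
def absVdm {n : ℕ} (x : Fin n → ℝ) : ℝ := ∏ i, ∏ j, if i < j then |x i - x j| else 1

/-- The product of all distances between entries of `v` and of `u`. -/
def crossProd {n m : ℕ} (v : Fin n → ℝ) (u : Fin m → ℝ) : ℝ := ∏ i, ∏ j, |v i - u j|

/-- The barycentric weights of the lower level `u` with respect to the upper level `v`. -/
def upperWt {n : ℕ} (v : Fin (n + 1) → ℝ) (u : Fin n → ℝ) (i : Fin (n + 1)) : ℝ :=
  (∏ j, (v i - u j)) / ∏ j ∈ Finset.univ.erase i, (v i - v j)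

/-- The residues of the upper level `v` with respect to the lower level `u`. -/
def lowerWt {n : ℕ} (u : Fin n → ℝ) (v : Fin (n + 1) → ℝ) (i : Fin n) : ℝ :=
  -(∏ j, (u i - v j)) / ∏ j ∈ Finset.univ.erase i, (u i - u j)

lemma Interlaces.strictAnti_upper {n : ℕ} {u : Fin n → ℝ} {v : Fin (n + 1) → ℝ}
    (h : Interlaces u v) : StrictAnti v :=
  Fin.strictAnti_iff_succ_lt.2 fun i => (h i).2.trans (h i).1

lemma Interlaces.strictAnti_lower {n : ℕ} {u : Fin n → ℝ} {v : Fin (n + 1) → ℝ}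
    (h : Interlaces u v) : StrictAnti u := by
  intro i j hij
  calc u j < v j.castSucc := (h j).1
    _ ≤ v i.succ := h.strictAnti_upper.antitone (by
        rw [Fin.le_def, Fin.val_succ, Fin.val_castSucc]; exact hij)
    _ < u i := (h i).2

lemma Interlaces.lt_of_le {n : ℕ} {u : Fin n → ℝ} {v : Fin (n + 1) → ℝ}
    (h : Interlaces u v) {i : Fin (n + 1)} {j : Fin n} (hij : i.1 ≤ j.1) : u j < v i :=
  (h j).1.trans_le (h.strictAnti_upper.antitone (by rw [Fin.le_def]; simpa using hij))

lemma Interlaces.lt_of_lt {n : ℕ} {u : Fin n → ℝ} {v : Fin (n + 1) → ℝ}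
    (h : Interlaces u v) {i : Fin (n + 1)} {j : Fin n} (hij : j.1 < i.1) : v i < u j :=
  (h.strictAnti_upper.antitone (by rw [Fin.le_def]; simpa using hij)).trans_lt (h j).2

lemma Interlaces.ne {n : ℕ} {u : Fin n → ℝ} {v : Fin (n + 1) → ℝ}
    (h : Interlaces u v) (i : Fin (n + 1)) (j : Fin n) : v i ≠ u j := by
  rcases le_or_gt i.1 j.1 with hij | hij
  exacts [(h.lt_of_le hij).ne', (h.lt_of_lt hij).ne]

lemma prod_mul_neg_one_pow_pos {ι : Type*} (s : Finset ι) (d : ι → ℝ) (p : ι → Prop)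
    [DecidablePred p] (h1 : ∀ j ∈ s, p j → d j < 0) (h2 : ∀ j ∈ s, ¬p j → 0 < d j) :
    0 < (-1) ^ (s.filter p).card * ∏ j ∈ s, d j := by
  rw [← Finset.prod_filter_mul_prod_filter_not s p, ← Finset.prod_const, ← mul_assoc,
    ← Finset.prod_mul_distrib]
  refine mul_pos (Finset.prod_pos fun j hj => ?_) (Finset.prod_pos fun j hj => ?_)
  · have := Finset.mem_filter.1 hj
    linarith [h1 j this.1 this.2]
  · have := Finset.mem_filter.1 hj
    exact h2 j this.1 this.2

lemma neg_one_pow_mul_prod_erase_pos {n : ℕ} {v : Fin n → ℝ} (hv : StrictAnti v) (i : Fin n) :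
    0 < (-1) ^ i.1 * ∏ j ∈ Finset.univ.erase i, (v i - v j) := by
  have h := prod_mul_neg_one_pow_pos (Finset.univ.erase i) (fun j => v i - v j) (fun j => j < i)
    (fun j _ hj => by linarith [hv hj])
    (fun j hj hj' => by
      have := hv (lt_of_le_of_ne (not_lt.1 hj') (Finset.ne_of_mem_erase hj).symm)
      linarith)
  rwa [show (Finset.univ.erase i).filter (fun j => j < i) = Finset.Iio i by
    ext j; simp +contextual [ne_of_lt], Fin.card_Iio] at h

lemma Interlaces.neg_one_pow_mul_prod_upper_pos {n : ℕ} {u : Fin n → ℝ} {v : Fin (n + 1) → ℝ}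
    (h : Interlaces u v) (i : Fin (n + 1)) : 0 < (-1) ^ i.1 * ∏ j, (v i - u j) := by
  have h := prod_mul_neg_one_pow_pos Finset.univ (fun j => v i - u j) (fun j => j.1 < i.1)
    (fun j _ hj => by linarith [h.lt_of_lt hj])
    (fun j _ hj' => by linarith [h.lt_of_le (not_lt.1 hj')])
  rwa [Fin.card_filter_val_lt, min_eq_right (by omega)] at h

lemma Interlaces.neg_one_pow_mul_prod_lower_pos {n : ℕ} {u : Fin n → ℝ} {v : Fin (n + 1) → ℝ}
    (h : Interlaces u v) (i : Fin n) : 0 < (-1) ^ (i.1 + 1) * ∏ j, (u i - v j) := by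
  have h := prod_mul_neg_one_pow_pos Finset.univ (fun j => u i - v j) (fun j => j.1 < i.1 + 1)
    (fun j _ hj => by linarith [h.lt_of_le (Nat.lt_succ_iff.1 hj)])
    (fun j _ hj' => by linarith [h.lt_of_lt (not_lt.1 hj')])
  rwa [Fin.card_filter_val_lt, min_eq_right (by omega)] at h

lemma div_pos_of_mul_same {s a b : ℝ} (ha : 0 < s * a) (hb : 0 < s * b) : 0 < a / b := by
  have hs : s ≠ 0 := by rintro rfl; simp at ha
  rw [← mul_div_mul_left a b hs]
  exact div_pos ha hb

lemma Interlaces.upperWt_pos {n : ℕ} {u : Fin n → ℝ} {v : Fin (n + 1) → ℝ}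
    (h : Interlaces u v) (i : Fin (n + 1)) : 0 < upperWt v u i :=
  div_pos_of_mul_same (h.neg_one_pow_mul_prod_upper_pos i)
    (neg_one_pow_mul_prod_erase_pos h.strictAnti_upper i)

lemma Interlaces.lowerWt_pos {n : ℕ} {u : Fin n → ℝ} {v : Fin (n + 1) → ℝ}
    (h : Interlaces u v) (i : Fin n) : 0 < lowerWt u v i := by
  refine div_pos_of_mul_same (s := (-1) ^ i.1) ?_
    (neg_one_pow_mul_prod_erase_pos h.strictAnti_lower i)
  have := h.neg_one_pow_mul_prod_lower_pos i
  rw [pow_succ] at this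
  linarith

lemma prod_erase_ne_zero {n : ℕ} {v : Fin n → ℝ} (hv : Function.Injective v) (i : Fin n) :
    ∏ j ∈ Finset.univ.erase i, (v i - v j) ≠ 0 :=
  Finset.prod_ne_zero_iff.2 fun j hj => sub_ne_zero.2 fun h =>
    Finset.ne_of_mem_erase hj (hv h).symm

open Polynomial in
lemma eq_sum_nodal_erase {n : ℕ} {v : Fin n → ℝ} (hv : Function.Injective v) {P : ℝ[X]}
    (hP : P.degree < n) :
    P = ∑ i, C (P.eval (v i) / ∏ j ∈ Finset.univ.erase i, (v i - v j)) *
      Lagrange.nodal (Finset.univ.erase i) v := by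
  refine Polynomial.eq_of_degrees_lt_of_eval_index_eq Finset.univ hv.injOn (by simpa using hP) ?_ ?_
  · rcases n with _ | n
    · simp
    refine lt_of_le_of_lt (degree_sum_le _ _) ?_
    rw [Finset.sup_lt_iff (by simp)]
    intro i _
    rw [← smul_eq_C_mul]
    refine lt_of_le_of_lt (degree_smul_le _ _) ?_
    rw [Lagrange.degree_nodal, Finset.card_erase_of_mem (Finset.mem_univ i)]
    simp only [Finset.card_univ, Fintype.card_fin]
    exact_mod_cast Nat.lt_succ_self n
  · intro i _
    rw [eval_finsetSum, Finset.sum_eq_single i]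
    · rw [eval_mul, eval_C, Lagrange.eval_nodal, div_mul_cancel₀ _ (prod_erase_ne_zero hv i)]
    · intro j _ hj
      rw [eval_mul, Lagrange.eval_nodal_at_node (Finset.mem_erase.2 ⟨hj.symm, Finset.mem_univ _⟩),
        mul_zero]
    · simp

open Polynomial in
lemma nodal_lower_eq {n : ℕ} {v : Fin (n + 1) → ℝ} (hv : Function.Injective v) (u : Fin n → ℝ) :
    Lagrange.nodal Finset.univ u =
      ∑ i, C (upperWt v u i) * Lagrange.nodal (Finset.univ.erase i) v := by
  have := eq_sum_nodal_erase hv (P := Lagrange.nodal Finset.univ u)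
    (by rw [Lagrange.degree_nodal]; simp; exact_mod_cast Nat.lt_succ_self n)
  simpa only [Lagrange.eval_nodal, upperWt] using this

open Polynomial in
lemma nodal_upper_eq {n : ℕ} {u : Fin n → ℝ} (hu : Function.Injective u) (v : Fin (n + 1) → ℝ) :
    Lagrange.nodal Finset.univ v =
      (X - C (∑ i, v i - ∑ i, u i)) * Lagrange.nodal Finset.univ u -
      ∑ i, C (lowerWt u v i) * Lagrange.nodal (Finset.univ.erase i) u := by
  have hdeg : (Lagrange.nodal Finset.univ v -
      (X - C (∑ i, v i - ∑ i, u i)) * Lagrange.nodal Finset.univ u).degree < (n : WithBot ℕ) := by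
    rw [degree_lt_iff_coeff_zero]
    have h1 : (Lagrange.nodal Finset.univ v).natDegree = n + 1 := by
      simp [Lagrange.natDegree_nodal]
    have h2 : (Lagrange.nodal Finset.univ u).natDegree = n := by simp [Lagrange.natDegree_nodal]
    have m1 : (Lagrange.nodal Finset.univ v).Monic := Lagrange.nodal_monic
    have m2 : (Lagrange.nodal Finset.univ u).Monic := Lagrange.nodal_monic
    have h3 : ((X - C (∑ i, v i - ∑ i, u i)) * Lagrange.nodal Finset.univ u).natDegree = n + 1 := by
      rw [(monic_X_sub_C _).natDegree_mul m2, natDegree_X_sub_C, h2, add_comm]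
    have m3 := (monic_X_sub_C (∑ i, v i - ∑ i, u i)).mul m2
    intro k hk
    rw [coeff_sub]
    rcases Nat.lt_trichotomy k (n + 1) with h | h | h
    · obtain rfl : k = n := by omega
      have e1 : (Lagrange.nodal Finset.univ v).coeff k = -∑ i, v i := by
        rw [← prod_X_sub_C_nextCoeff, nextCoeff, ← Lagrange.nodal, h1]
        simp
      have e2 : ((X - C (∑ i, v i - ∑ i, u i)) * Lagrange.nodal Finset.univ u).nextCoeff =
          -(∑ i, v i - ∑ i, u i) + -∑ i, u i := by
        rw [(monic_X_sub_C _).nextCoeff_mul m2, nextCoeff_X_sub_C, Lagrange.nodal,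
          prod_X_sub_C_nextCoeff]
      rw [nextCoeff, h3] at e2
      simp only [Nat.add_eq_zero_iff, one_ne_zero, and_false, if_false, Nat.add_sub_cancel] at e2
      rw [e1, e2]; ring
    · rw [h]
      have := m1.coeff_natDegree
      rw [h1] at this
      have h' := m3.coeff_natDegree
      rw [h3] at h'
      rw [this, h', sub_self]
    · rw [coeff_eq_zero_of_natDegree_lt (by omega), coeff_eq_zero_of_natDegree_lt (by omega),
        sub_self]
  have h := eq_sum_nodal_erase hu hdeg
  have e : ∀ i, (Lagrange.nodal Finset.univ v -
      (X - C (∑ i, v i - ∑ i, u i)) * Lagrange.nodal Finset.univ u).eval (u i) /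
      ∏ j ∈ Finset.univ.erase i, (u i - u j) = -lowerWt u v i := by
    intro i
    rw [eval_sub, eval_mul, Lagrange.eval_nodal_at_node (Finset.mem_univ i), mul_zero, sub_zero,
      Lagrange.eval_nodal, lowerWt, neg_div, neg_neg]
  simp only [e, C_neg, neg_mul, Finset.sum_neg_distrib] at h
  rw [sub_eq_iff_eq_add] at h
  rw [h]; ring

open Polynomial in
lemma eval_genPoly {ι : Type*} (s : Finset ι) (x : ι → ℝ) {t : ℝ} (ht : t ≠ 0) :
    (genPoly s x).eval t = t ^ s.card * (Lagrange.nodal s x).eval t⁻¹ := by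
  rw [genPoly, eval_prod, Lagrange.eval_nodal, ← Finset.prod_const, ← Finset.prod_mul_distrib]
  refine Finset.prod_congr rfl fun i _ => ?_
  simp
  field_simp

open Polynomial in
lemma eq_of_eval_eq_of_ne_zero {P Q : ℝ[X]} (h : ∀ t ≠ 0, P.eval t = Q.eval t) : P = Q := by
  refine Polynomial.eq_of_infinite_eval_eq P Q (Set.Infinite.mono (s := {0}ᶜ) ?_ ?_)
  · intro t ht; exact h t ht
  · exact (Set.finite_singleton (0 : ℝ)).infinite_compl

open Polynomial in
lemma genPoly_lower_eq {n : ℕ} {v : Fin (n + 1) → ℝ} (hv : Function.Injective v) (u : Fin n → ℝ) :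
    genPoly Finset.univ u = ∑ i, C (upperWt v u i) * genPoly (Finset.univ.erase i) v := by
  refine eq_of_eval_eq_of_ne_zero fun t ht => ?_
  rw [eval_genPoly _ _ ht, nodal_lower_eq hv, eval_finsetSum, eval_finsetSum, Finset.mul_sum]
  refine Finset.sum_congr rfl fun i _ => ?_
  rw [eval_mul, eval_mul, eval_genPoly _ _ ht, Finset.card_erase_of_mem (Finset.mem_univ i)]
  simp
  ring

open Polynomial in
lemma genPoly_upper_eq {n : ℕ} {u : Fin n → ℝ} (hu : Function.Injective u) (v : Fin (n + 1) → ℝ) :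
    genPoly Finset.univ v = (1 - C (∑ i, v i - ∑ i, u i) * X) * genPoly Finset.univ u -
      X ^ 2 * ∑ i, C (lowerWt u v i) * genPoly (Finset.univ.erase i) u := by
  refine eq_of_eval_eq_of_ne_zero fun t ht => ?_
  rw [eval_genPoly _ _ ht, nodal_upper_eq hu]
  simp only [eval_sub, eval_mul, eval_finsetSum, eval_pow, eval_X, eval_C, eval_one,
    eval_genPoly _ _ ht, mul_sub, Finset.mul_sum]
  congr 1
  · simp [pow_succ]; field_simp
  · refine Finset.sum_congr rfl fun i _ => ?_
    have : 0 < n := i.pos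
    rw [Finset.card_erase_of_mem (Finset.mem_univ i)]
    obtain ⟨k, rfl⟩ : ∃ k, n = k + 1 := ⟨n - 1, by omega⟩
    simp
    ring

lemma sgnEsymm_lower {n : ℕ} {v : Fin (n + 1) → ℝ} (hv : Function.Injective v) (u : Fin n → ℝ)
    (k : ℕ) : sgnEsymm k u = ∑ j ∈ Finset.range (k + 1),
      (∑ i, v i ^ j * upperWt v u i) * sgnEsymm (k - j) v := by
  rw [sgnEsymm, genPoly_lower_eq hv, Polynomial.finsetSum_coeff]
  simp only [Polynomial.coeff_C_mul, genPoly_coeff_erase _ _ (Finset.mem_univ _), Finset.mul_sum,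
    Finset.sum_mul]
  rw [Finset.sum_comm]
  refine Finset.sum_congr rfl fun j _ => Finset.sum_congr rfl fun i _ => ?_
  rw [sgnEsymm]; ring

lemma sum_upperWt {n : ℕ} {v : Fin (n + 1) → ℝ} (hv : Function.Injective v) (u : Fin n → ℝ) :
    ∑ i, upperWt v u i = 1 := by
  have := sgnEsymm_lower hv u 0
  simpa using this.symm

lemma sgnEsymm_upper {n : ℕ} {u : Fin n → ℝ} (hu : Function.Injective u) (v : Fin (n + 1) → ℝ)
    (k : ℕ) : sgnEsymm k v = sgnEsymm k u -
      (if 1 ≤ k then (∑ i, v i - ∑ i, u i) * sgnEsymm (k - 1) u else 0) -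
      ∑ j ∈ Finset.range (k - 1), (∑ i, u i ^ j * lowerWt u v i) * sgnEsymm (k - 2 - j) u := by
  rw [sgnEsymm, genPoly_upper_eq hu, sub_mul, one_mul, mul_assoc, Polynomial.coeff_sub,
    Polynomial.coeff_sub, Polynomial.coeff_C_mul, ← sgnEsymm]
  rcases k with _ | _ | k
  · simp [Polynomial.mul_coeff_zero]
  · simp [Polynomial.coeff_X_mul, Polynomial.coeff_X_pow_mul', sgnEsymm]
  · rw [Polynomial.coeff_X_mul, Polynomial.coeff_X_pow_mul, Polynomial.finsetSum_coeff]
    simp only [Polynomial.coeff_C_mul, genPoly_coeff_erase _ _ (Finset.mem_univ _), Finset.mul_sum,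
      Finset.sum_mul]
    rw [Finset.sum_comm]
    simp only [le_add_iff_nonneg_left, zero_le, if_true, 
      show k + 1 + 1 - 1 = k + 1 from rfl, show k + 1 + 1 - 2 = k from rfl]
    congr 1
    refine Finset.sum_congr rfl fun j _ => Finset.sum_congr rfl fun i _ => ?_
    rw [sgnEsymm]
    ring

lemma sum_sq_upper {n : ℕ} {u : Fin n → ℝ} (hu : Function.Injective u) (v : Fin (n + 1) → ℝ) :
    ∑ i, v i ^ 2 = ∑ i, u i ^ 2 + (∑ i, v i - ∑ i, u i) ^ 2 + 2 * ∑ i, lowerWt u v i := by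
  have hN : ∀ {m : ℕ} (x : Fin m → ℝ), sgnEsymm 1 x = -∑ i, x i ∧
      2 * sgnEsymm 2 x = (∑ i, x i) ^ 2 - ∑ i, x i ^ 2 := by
    intro m x
    have h1 := sgnEsymm_newton 0 x
    have h2 := sgnEsymm_newton 1 x
    simp [Finset.sum_range_succ, powerSum] at h1 h2
    refine ⟨h1, ?_⟩
    rw [h1] at h2
    linarith
  have h := sgnEsymm_upper hu v 2
  simp at h
  have e1 := (hN v).2
  have e2 := (hN u).2
  rw [(hN u).1] at h
  linear_combination e1 - e2 - 2 * h

lemma absVdm_eq_abs_det {n : ℕ} (x : Fin n → ℝ) : absVdm x = |(Matrix.vandermonde x).det| := by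
  rw [Matrix.det_vandermonde, Finset.abs_prod, absVdm]
  refine Finset.prod_congr rfl fun i _ => ?_
  rw [Finset.abs_prod, Finset.prod_ite, Finset.prod_const_one, mul_one]
  refine Finset.prod_congr (by ext; simp) fun j _ => abs_sub_comm _ _

lemma absVdm_pos {n : ℕ} {x : Fin n → ℝ} (hx : Function.Injective x) : 0 < absVdm x := by
  rw [absVdm_eq_abs_det]
  exact abs_pos.2 (Matrix.det_vandermonde_ne_zero_iff.2 hx)

lemma absVdm_nonneg {n : ℕ} (x : Fin n → ℝ) : 0 ≤ absVdm x := by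
  rw [absVdm_eq_abs_det]; exact abs_nonneg _

lemma prod_prod_erase {n : ℕ} (x : Fin n → ℝ) :
    ∏ i, |∏ j ∈ Finset.univ.erase i, (x i - x j)| = absVdm x ^ 2 := by
  have h : ∀ i, |∏ j ∈ Finset.univ.erase i, (x i - x j)| =
      (∏ j, if i < j then |x i - x j| else 1) * ∏ j, if j < i then |x j - x i| else 1 := by
    intro i
    rw [Finset.abs_prod, ← Finset.prod_mul_distrib,
      ← Finset.prod_erase_mul (a := i) _ _ (Finset.mem_univ i)]
    simp only [lt_irrefl, if_false, mul_one]
    refine Finset.prod_congr rfl fun j hj => ?_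
    rcases lt_or_gt_of_ne (Finset.ne_of_mem_erase hj) with h | h
    · simp [h, h.not_gt, abs_sub_comm]
    · simp [h, h.not_gt]
  simp only [h, Finset.prod_mul_distrib]
  rw [Finset.prod_comm (f := fun i j => if j < i then |x j - x i| else 1), ← absVdm, sq]

lemma prod_upperWt_eq {n : ℕ} (v : Fin (n + 1) → ℝ) (u : Fin n → ℝ) :
    |∏ i, upperWt v u i| = crossProd v u / absVdm v ^ 2 := by
  simp only [upperWt, Finset.abs_prod, abs_div, Finset.prod_div_distrib, crossProd,
    ← prod_prod_erase]

lemma prod_lowerWt_eq {n : ℕ} (u : Fin n → ℝ) (v : Fin (n + 1) → ℝ) :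
    |∏ i, lowerWt u v i| = crossProd v u / absVdm u ^ 2 := by
  simp only [lowerWt, Finset.abs_prod, abs_div, abs_neg, Finset.prod_div_distrib, crossProd,
    ← prod_prod_erase]
  rw [Finset.prod_comm]
  simp only [abs_sub_comm]

/-- The bordered Cauchy matrix. -/
def borderedCauchy {n : ℕ} (v : Fin (n + 1) → ℝ) (u : Fin n → ℝ) :
    Matrix (Fin (n + 1)) (Fin (n + 1)) ℝ :=
  Matrix.of fun i => Fin.cons 1 fun j => (v i - u j)⁻¹

/-- The nodal polynomial of `u` together with its cofactors. -/
def nodalFamily {n : ℕ} (u : Fin n → ℝ) : Fin (n + 1) → Polynomial ℝ :=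
  Fin.cons (Lagrange.nodal Finset.univ u) fun j => Lagrange.nodal (Finset.univ.erase j) u

lemma natDegree_nodalFamily {n : ℕ} (u : Fin n → ℝ) (k : Fin (n + 1)) :
    (nodalFamily u k).natDegree < n + 1 := by
  induction k using Fin.cases with
  | zero => simp [nodalFamily, Lagrange.natDegree_nodal]
  | succ j =>
    simp only [nodalFamily, Fin.cons_succ, Lagrange.natDegree_nodal]
    exact lt_of_le_of_lt (Finset.card_le_card (Finset.erase_subset _ _)) (by simp)

lemma vandermonde_mul_coeff {n : ℕ} (x : Fin (n + 1) → ℝ) (u : Fin n → ℝ) :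
    (Matrix.of fun i k => (nodalFamily u k).eval (x i)) =
      Matrix.vandermonde x * Matrix.of fun l k : Fin (n + 1) => (nodalFamily u k).coeff l := by
  ext i k
  rw [Matrix.mul_apply, Matrix.of_apply, Polynomial.eval_eq_sum_range' (natDegree_nodalFamily u k),
    ← Fin.sum_univ_eq_sum_range (fun l => (nodalFamily u k).coeff l * x i ^ l) (n + 1)]
  refine Finset.sum_congr rfl fun l _ => ?_
  rw [Matrix.vandermonde_apply, Matrix.of_apply, mul_comm]

lemma abs_det_coeff_nodalFamily {n : ℕ} {u : Fin n → ℝ} (hu : Function.Injective u) :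
    |(Matrix.of fun l k : Fin (n + 1) => (nodalFamily u k).coeff l).det| = absVdm u := by
  obtain ⟨t, ht⟩ := Set.Infinite.nonempty (Set.finite_range u).infinite_compl
  have ht' : ∀ j, t - u j ≠ 0 := fun j => sub_ne_zero.2 fun h => ht ⟨j, h.symm⟩
  have h := congrArg (fun M => |Matrix.det M|) (vandermonde_mul_coeff (Fin.cons t u) u)
  simp only [Matrix.det_mul, abs_mul] at h
  have hV : |(Matrix.vandermonde (Fin.cons t u : Fin (n + 1) → ℝ)).det| =
      (∏ j, |t - u j|) * absVdm u := by
    rw [← absVdm_eq_abs_det, absVdm, Fin.prod_univ_succ]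
    congr 1
    · rw [Fin.prod_univ_succ]; simp
    · refine Finset.prod_congr rfl fun i _ => ?_
      rw [Fin.prod_univ_succ]; simp
  have hL : |(Matrix.of fun i k => (nodalFamily u k).eval
      ((Fin.cons t u : Fin (n + 1) → ℝ) i)).det| = (∏ j, |t - u j|) * absVdm u ^ 2 := by
    rw [Matrix.det_succ_column_zero, Fin.sum_univ_succ]
    have h0 : ∀ i : Fin n, (nodalFamily u 0).eval (u i) = 0 := fun i => by
      simp only [nodalFamily, Fin.cons_zero]
      exact Lagrange.eval_nodal_at_node (Finset.mem_univ i)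
    simp only [Matrix.of_apply, Fin.cons_succ, h0, mul_zero, zero_mul, Finset.sum_const_zero,
      add_zero, Fin.cons_zero, Fin.val_zero, pow_zero, one_mul, abs_mul]
    congr 1
    · simp [nodalFamily, Lagrange.eval_nodal, Finset.abs_prod]
    · rw [← prod_prod_erase, ← Finset.abs_prod, ← Matrix.det_diagonal]
      congr 2
      ext i j
      simp only [Matrix.submatrix_apply, Matrix.of_apply, nodalFamily, Fin.zero_succAbove,
        Fin.cons_succ, Matrix.diagonal_apply]
      split_ifs with hij
      · subst hij; rw [Lagrange.eval_nodal]
      · exact Lagrange.eval_nodal_at_node (Finset.mem_erase.2 ⟨hij, Finset.mem_univ _⟩)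
  rw [hL, hV] at h
  have h1 : (0 : ℝ) < ∏ j, |t - u j| := Finset.prod_pos fun j _ => abs_pos.2 (ht' j)
  have h2 := absVdm_pos hu
  have h3 : (∏ j, |t - u j|) * absVdm u ≠ 0 := by positivity
  refine mul_left_cancel₀ h3 ?_
  rw [← h]; ring

lemma abs_det_borderedCauchy {n : ℕ} {v : Fin (n + 1) → ℝ} {u : Fin n → ℝ}
    (hu : Function.Injective u) (huv : ∀ i j, v i ≠ u j) :
    |(borderedCauchy v u).det| = absVdm v * absVdm u / crossProd v u := by
  have h := congrArg (fun M => |Matrix.det M|) (vandermonde_mul_coeff v u)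
  simp only [Matrix.det_mul, abs_mul, abs_det_coeff_nodalFamily hu] at h
  rw [← absVdm_eq_abs_det] at h
  have hM : (Matrix.of fun i k => (nodalFamily u k).eval (v i)) =
      Matrix.diagonal (fun i => ∏ j, (v i - u j)) * borderedCauchy v u := by
    ext i k
    rw [Matrix.diagonal_mul, Matrix.of_apply, borderedCauchy, Matrix.of_apply]
    induction k using Fin.cases with
    | zero => simp [nodalFamily, Lagrange.eval_nodal]
    | succ j =>
      simp only [nodalFamily, Fin.cons_succ, Lagrange.eval_nodal]
      rw [← Finset.mul_prod_erase _ _ (Finset.mem_univ j), mul_comm (v i - u j), mul_assoc,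
        mul_inv_cancel₀ (sub_ne_zero.2 (huv i j)), mul_one]
  rw [hM, Matrix.det_mul, Matrix.det_diagonal, abs_mul, Finset.abs_prod] at h
  simp only [Finset.abs_prod] at h
  rw [← h, crossProd, mul_div_cancel_left₀]
  exact Finset.prod_ne_zero_iff.2 fun i _ => Finset.prod_ne_zero_iff.2 fun j _ =>
    abs_ne_zero.2 (sub_ne_zero.2 (huv i j))

lemma eq_of_nodal_eq {n : ℕ} {u u' : Fin n → ℝ} (hu : StrictAnti u) (hu' : StrictAnti u')
    (h : Lagrange.nodal Finset.univ u = Lagrange.nodal Finset.univ u') : u = u' := by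
  refine (hu.range_inj hu').1 ?_
  have key : ∀ {x y : Fin n → ℝ}, Lagrange.nodal Finset.univ x = Lagrange.nodal Finset.univ y →
      Set.range x ⊆ Set.range y := by
    rintro x y h _ ⟨i, rfl⟩
    have h1 := Lagrange.eval_nodal_at_node (v := x) (Finset.mem_univ i)
    rw [h, Lagrange.eval_nodal, Finset.prod_eq_zero_iff] at h1
    obtain ⟨j, _, hj⟩ := h1
    exact ⟨j, (sub_eq_zero.1 hj).symm⟩
  exact (key h).antisymm (key h.symm)

open Polynomial in
/-- A monic polynomial of degree `n` with alternating signs at `n + 1` points splits with roots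
interlacing these points. -/
lemma exists_interlaces_of_alternating {n : ℕ} {P : ℝ[X]} (hP : P.Monic) (hd : P.natDegree = n)
    {t : Fin (n + 1) → ℝ} (ht : StrictAnti t) (hs : ∀ i, 0 < (-1) ^ i.1 * P.eval (t i)) :
    ∃ u : Fin n → ℝ, Interlaces u t ∧ P = Lagrange.nodal Finset.univ u := by
  have hr : ∀ i : Fin n, ∃ x ∈ Set.Ioo (t i.succ) (t i.castSucc), P.eval x = 0 := by
    intro i
    have hlt : t i.succ < t i.castSucc := ht (Fin.castSucc_lt_succ)
    have h1 := hs i.succ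
    have h2 := hs i.castSucc
    simp only [Fin.val_succ, pow_succ, Fin.val_castSucc] at h1 h2
    have hc : ContinuousOn (fun x => (-1) ^ i.1 * P.eval x) (Set.Icc (t i.succ) (t i.castSucc)) :=
      (by fun_prop : Continuous fun x => (-1) ^ i.1 * P.eval x).continuousOn
    obtain ⟨x, hx, hx0⟩ := intermediate_value_Ioo hlt.le hc (show (0 : ℝ) ∈ _ from ⟨by linarith, h2⟩)
    exact ⟨x, hx, (mul_eq_zero.1 hx0).resolve_left (pow_ne_zero _ (by norm_num))⟩
  choose u hu hu0 using hr
  have hI : Interlaces u t := fun i => ⟨(hu i).2, (hu i).1⟩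
  refine ⟨u, hI, ?_⟩
  have hinj := hI.strictAnti_lower.injective
  refine Polynomial.eq_of_degree_sub_lt_of_eval_index_eq Finset.univ hinj.injOn ?_ ?_
  · have hm : (Lagrange.nodal Finset.univ u).Monic := Lagrange.nodal_monic
    have hdeg : P.degree = (Lagrange.nodal Finset.univ u).degree := by
      rw [Lagrange.degree_nodal, degree_eq_natDegree hP.ne_zero, hd]; simp
    refine lt_of_lt_of_eq (degree_sub_lt hdeg hP.ne_zero (by rw [hP, hm])) ?_
    rw [degree_eq_natDegree hP.ne_zero, hd]; simp
  · intro i _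
    rw [hu0, Lagrange.eval_nodal_at_node (Finset.mem_univ i)]

/-- The map sending a total mass `y 0` and a level `Fin.tail y` below `v` to the weights
`y 0 * upperWt v (Fin.tail y)`. -/
def dixonMap {n : ℕ} (v : Fin (n + 1) → ℝ) (y : Fin (n + 1) → ℝ) (i : Fin (n + 1)) : ℝ :=
  y 0 * upperWt v (Fin.tail y) i

/-- The domain of `dixonMap`. -/
def dixonDomain {n : ℕ} (v : Fin (n + 1) → ℝ) : Set (Fin (n + 1) → ℝ) :=
  {y | 0 < y 0 ∧ Interlaces (Fin.tail y) v}

/-- The map recording the increase of the sum and the residues of a level `v` above `u`. -/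
def cornerMap {n : ℕ} (u : Fin n → ℝ) (v : Fin (n + 1) → ℝ) : Fin (n + 1) → ℝ :=
  Fin.cons (∑ i, v i - ∑ i, u i) (lowerWt u v)

lemma sum_dixonMap {n : ℕ} {v : Fin (n + 1) → ℝ} (hv : Function.Injective v)
    (y : Fin (n + 1) → ℝ) : ∑ i, dixonMap v y i = y 0 := by
  simp only [dixonMap, ← Finset.mul_sum, sum_upperWt hv, mul_one]

lemma dixonMap_injOn {n : ℕ} {v : Fin (n + 1) → ℝ} (hv : Function.Injective v) :
    Set.InjOn (dixonMap v) (dixonDomain v) := by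
  intro y hy y' hy' h
  have h0 : y 0 = y' 0 := by rw [← sum_dixonMap hv y, ← sum_dixonMap hv y', h]
  have hw : upperWt v (Fin.tail y) = upperWt v (Fin.tail y') := by
    ext i
    have := congrFun h i
    simp only [dixonMap, ← h0] at this
    exact mul_left_cancel₀ hy.1.ne' this
  have ht : Fin.tail y = Fin.tail y' := by
    refine eq_of_nodal_eq hy.2.strictAnti_lower hy'.2.strictAnti_lower ?_
    rw [nodal_lower_eq hv, nodal_lower_eq hv, hw]
  rw [← Fin.cons_self_tail y, ← Fin.cons_self_tail y', h0, ht]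

open Polynomial in
lemma dixonMap_image {n : ℕ} {v : Fin (n + 1) → ℝ} (hv : StrictAnti v) :
    dixonMap v '' dixonDomain v = {g | ∀ i, 0 < g i} := by
  ext g
  constructor
  · rintro ⟨y, hy, rfl⟩ i
    exact mul_pos hy.1 (hy.2.upperWt_pos i)
  intro hg
  have hs : 0 < ∑ i, g i := Finset.sum_pos (fun i _ => hg i) Finset.univ_nonempty
  set P : ℝ[X] := ∑ i, C (g i / ∑ i, g i) * Lagrange.nodal (Finset.univ.erase i) v with hPdef
  have hnd : ∀ i, (Lagrange.nodal (Finset.univ.erase i) v).natDegree = n := fun i => by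
    simp [Lagrange.natDegree_nodal]
  have hle : P.natDegree ≤ n := by
    refine natDegree_sum_le_of_forall_le _ _ fun i _ => ?_
    exact (natDegree_C_mul_le _ _).trans (hnd i).le
  have hc : P.coeff n = 1 := by
    rw [hPdef, finsetSum_coeff]
    have : ∀ i, (Lagrange.nodal (Finset.univ.erase i) v).coeff n = 1 := fun i => by
      have := (Lagrange.nodal_monic (s := Finset.univ.erase i) (v := v)).coeff_natDegree
      rwa [hnd] at this
    simp only [coeff_C_mul, this, mul_one, ← Finset.sum_div]
    exact div_self hs.ne'
  have hev : ∀ i, P.eval (v i) =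
      g i / (∑ i, g i) * ∏ j ∈ Finset.univ.erase i, (v i - v j) := by
    intro i
    rw [hPdef, eval_finsetSum, Finset.sum_eq_single i]
    · rw [eval_mul, eval_C, Lagrange.eval_nodal]
    · intro j _ hj
      rw [eval_mul, Lagrange.eval_nodal_at_node (Finset.mem_erase.2 ⟨hj.symm, Finset.mem_univ _⟩),
        mul_zero]
    · simp
  obtain ⟨u, hu, hPu⟩ := exists_interlaces_of_alternating
    (monic_of_natDegree_le_of_coeff_eq_one n hle hc)
    (natDegree_eq_of_le_of_coeff_ne_zero hle (by simp [hc])) hv (fun i => by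
      rw [hev, mul_left_comm]
      exact mul_pos (div_pos (hg i) hs) (neg_one_pow_mul_prod_erase_pos hv i))
  refine ⟨Fin.cons (∑ i, g i) u, ⟨by simpa using hs, by simpa using hu⟩, ?_⟩
  ext i
  have h1 := hev i
  rw [hPu, Lagrange.eval_nodal] at h1
  simp only [dixonMap, Fin.cons_zero, Fin.tail_cons, upperWt]
  rw [h1, mul_div_cancel_right₀ _ (prod_erase_ne_zero hv.injective i), mul_div_cancel₀ _ hs.ne']

lemma cornerMap_injOn {n : ℕ} {u : Fin n → ℝ} (hu : Function.Injective u) :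
    Set.InjOn (cornerMap u) {v | Interlaces u v} := by
  intro v hv v' hv' h
  refine eq_of_nodal_eq hv.strictAnti_upper hv'.strictAnti_upper ?_
  obtain ⟨h0, h1⟩ := Fin.cons_injective2 h
  rw [nodal_upper_eq hu, nodal_upper_eq hu, h0, h1]

open Polynomial in
lemma exists_eval_pos_of_monic {P : ℝ[X]} (hP : P.Monic) (hd : 0 < P.natDegree) (c : ℝ) :
    (∃ t, c < t ∧ 0 < P.eval t) ∧ ∃ t, t < -c ∧ 0 < (-1) ^ P.natDegree * P.eval t := by
  constructor
  · have := Polynomial.tendsto_atTop_of_leadingCoeff_nonneg P (natDegree_pos_iff_degree_pos.1 hd)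
      (by simp [hP.leadingCoeff])
    exact ((eventually_gt_atTop c).and (this.eventually_gt_atTop 0)).exists
  · have hX : (-X : ℝ[X]).natDegree = 1 := by simp
    set Q : ℝ[X] := C ((-1) ^ P.natDegree) * P.comp (-X) with hQ
    have hne : ((-1 : ℝ) ^ P.natDegree) ≠ 0 := pow_ne_zero _ (by norm_num)
    have hQd : Q.natDegree = P.natDegree := by
      rw [hQ, natDegree_C_mul hne, natDegree_comp, hX, mul_one]
    have hQl : Q.leadingCoeff = 1 := by
      rw [hQ, leadingCoeff_mul, leadingCoeff_C, leadingCoeff_comp (by simp), hP.leadingCoeff,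
        leadingCoeff_neg, leadingCoeff_X, one_mul, ← mul_pow]
      simp
    have := Polynomial.tendsto_atTop_of_leadingCoeff_nonneg Q
      (natDegree_pos_iff_degree_pos.1 (hQd ▸ hd)) (by simp [hQl])
    obtain ⟨t, h1, h2⟩ := ((eventually_gt_atTop c).and (this.eventually_gt_atTop 0)).exists
    refine ⟨-t, by linarith, ?_⟩
    simpa [hQ] using h2

open Polynomial in
lemma cornerMap_image {n : ℕ} {u : Fin n → ℝ} (hu : StrictAnti u) :
    cornerMap u '' {v | Interlaces u v} = {z | ∀ i : Fin n, 0 < z i.succ} := by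
  ext z
  constructor
  · rintro ⟨v, hv, rfl⟩ i
    simpa [cornerMap] using Interlaces.lowerWt_pos hv i
  intro hz
  set Q := Lagrange.nodal Finset.univ u with hQ
  set S : ℝ[X] := ∑ i : Fin n, C (z i.succ) * Lagrange.nodal (Finset.univ.erase i) u with hS
  have mQ : Q.Monic := Lagrange.nodal_monic
  have dQ : Q.natDegree = n := by simp [hQ, Lagrange.natDegree_nodal]
  have m1 := (monic_X_sub_C (z 0)).mul mQ
  have d1 : ((X - C (z 0)) * Q).natDegree = n + 1 := by
    rw [(monic_X_sub_C _).natDegree_mul mQ, natDegree_X_sub_C, dQ, add_comm]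
  have dS : S.natDegree < n + 1 := by
    refine Nat.lt_succ_of_le (natDegree_sum_le_of_forall_le _ _ fun i _ => ?_)
    refine (natDegree_C_mul_le _ _).trans ?_
    simp [Lagrange.natDegree_nodal]
  set P := (X - C (z 0)) * Q - S with hP
  have dP : P.natDegree = n + 1 := by
    rw [hP, natDegree_sub_eq_left_of_natDegree_lt (by omega), d1]
  have mP : P.Monic := m1.sub_of_left (degree_lt_degree (by omega))
  have hev : ∀ i, P.eval (u i) = -z i.succ * ∏ j ∈ Finset.univ.erase i, (u i - u j) := by
    intro i
    rw [hP, eval_sub, eval_mul, hQ, Lagrange.eval_nodal_at_node (Finset.mem_univ i), mul_zero,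
      zero_sub, hS, eval_finsetSum, Finset.sum_eq_single i]
    · rw [eval_mul, eval_C, Lagrange.eval_nodal, neg_mul]
    · intro j _ hj
      rw [eval_mul, Lagrange.eval_nodal_at_node (Finset.mem_erase.2 ⟨hj.symm, Finset.mem_univ _⟩),
        mul_zero]
    · simp
  obtain ⟨⟨t, ht, htP⟩, ⟨t', ht', htP'⟩⟩ := exists_eval_pos_of_monic mP (by omega) (∑ i, |u i|)
  have hub : ∀ i, |u i| ≤ ∑ i, |u i| := fun i =>
    Finset.single_le_sum (f := fun i => |u i|) (fun i _ => abs_nonneg _) (Finset.mem_univ i)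
  have hnn : 0 ≤ ∑ i, |u i| := Finset.sum_nonneg fun i _ => abs_nonneg _
  set w : Fin (n + 2) → ℝ := Fin.cons t (Fin.snoc u t') with hw
  have hw' : StrictAnti w := by
    rw [Fin.strictAnti_iff_succ_lt]
    intro i
    induction i using Fin.cases with
    | zero =>
      rw [hw, Fin.cons_succ, Fin.castSucc_zero, Fin.cons_zero]
      rcases n with _ | n
      · have : (Fin.snoc u t' : Fin 1 → ℝ) 0 = t' := by
          rw [show (0 : Fin 1) = Fin.last 0 from rfl, Fin.snoc_last]
        rw [this]; linarith
      · rw [show (0 : Fin (n + 2)) = (0 : Fin (n + 1)).castSucc from rfl, Fin.snoc_castSucc]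
        linarith [hub 0, le_abs_self (u 0)]
    | succ i =>
      rw [hw, Fin.cons_succ, ← Fin.succ_castSucc, Fin.cons_succ, Fin.snoc_castSucc]
      rcases n with _ | n
      · exact i.elim0
      induction i using Fin.lastCases with
      | last =>
        rw [Fin.succ_last, Fin.snoc_last]
        linarith [hub (Fin.last n), neg_abs_le (u (Fin.last n))]
      | cast i =>
        rw [Fin.succ_castSucc, Fin.snoc_castSucc]
        exact hu Fin.castSucc_lt_succ
  have hwu : ∀ i : Fin n, w i.castSucc.succ = u i := fun i => by
    rw [hw, Fin.cons_succ, Fin.snoc_castSucc]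
  obtain ⟨v, hv, hPv⟩ := exists_interlaces_of_alternating mP dP hw' (fun i => by
    induction i using Fin.cases with
    | zero => simpa [hw] using htP
    | succ i =>
      induction i using Fin.lastCases with
      | last =>
        rw [dP] at htP'
        rw [hw, Fin.cons_succ, Fin.snoc_last]
        simpa using htP'
      | cast i =>
        rw [hwu, hev]
        have := mul_pos (hz i) (neg_one_pow_mul_prod_erase_pos hu i)
        simp only [Fin.val_succ, Fin.val_castSucc, pow_succ]
        linarith)
  have huv : Interlaces u v := fun i => by
    constructor
    · rw [← hwu i]
      exact (hv i.castSucc).2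
    · rw [← hwu i, Fin.succ_castSucc]
      exact (hv i.succ).1
  refine ⟨v, huv, ?_⟩
  have hlow : ∀ i, lowerWt u v i = z i.succ := fun i => by
    have h1 := hev i
    rw [hPv, Lagrange.eval_nodal] at h1
    rw [lowerWt, h1, neg_mul, neg_neg, mul_div_cancel_right₀ _ (prod_erase_ne_zero hu.injective i)]
  have h2 := nodal_upper_eq hu.injective v
  rw [← hPv, hP] at h2
  simp only [hlow] at h2
  have h3 := mul_right_cancel₀ mQ.ne_zero (sub_left_injective h2)
  have h4 := C_injective (sub_right_injective h3)
  ext i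
  induction i using Fin.cases with
  | zero => simp [cornerMap, h4]
  | succ i => simp [cornerMap, hlow]

/-- The Jacobian matrix of `dixonMap v`. -/
def dixonJac {n : ℕ} (v : Fin (n + 1) → ℝ) (y : Fin (n + 1) → ℝ) :
    Matrix (Fin (n + 1)) (Fin (n + 1)) ℝ :=
  Matrix.diagonal (dixonMap v y) * borderedCauchy v (Fin.tail y) *
    Matrix.diagonal (Fin.cons (y 0)⁻¹ fun _ => -1)

lemma abs_det_dixonJac {n : ℕ} {v y : Fin (n + 1) → ℝ} (hy : y ∈ dixonDomain v) :
    |(dixonJac v y).det| = y 0 ^ n * absVdm (Fin.tail y) / absVdm v := by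
  obtain ⟨h0, h⟩ := hy
  rw [dixonJac, Matrix.det_mul, Matrix.det_mul, Matrix.det_diagonal, Matrix.det_diagonal, abs_mul,
    abs_mul, abs_det_borderedCauchy h.strictAnti_lower.injective h.ne]
  simp only [dixonMap, Finset.prod_mul_distrib, Finset.prod_const, Finset.card_univ,
    Fintype.card_fin, abs_mul, prod_upperWt_eq]
  simp only [Fin.prod_univ_succ, Fin.cons_zero, Fin.cons_succ, Finset.prod_const, abs_mul,
    abs_pow, abs_neg, abs_one, one_pow, mul_one, abs_inv, abs_of_pos h0]
  have h1 := absVdm_pos h.strictAnti_upper.injective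
  have h2 : crossProd v (Fin.tail y) ≠ 0 := Finset.prod_ne_zero_iff.2 fun i _ =>
    Finset.prod_ne_zero_iff.2 fun j _ => abs_ne_zero.2 (sub_ne_zero.2 (h.ne i j))
  field_simp
  ring

lemma hasFDerivAt_dixonMap {n : ℕ} {v y : Fin (n + 1) → ℝ} (hy : y ∈ dixonDomain v) :
    HasFDerivAt (dixonMap v) (Matrix.toLin' (dixonJac v y)).toContinuousLinearMap y := by
  obtain ⟨h0, h⟩ := hy
  rw [hasFDerivAt_pi']
  intro i
  have hp : ∀ k : Fin (n + 1), HasFDerivAt (fun y : Fin (n + 1) → ℝ => y k)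
      (ContinuousLinearMap.proj (R := ℝ) k) y := fun k => hasFDerivAt_apply k y
  have h1 := HasFDerivAt.finsetProd (u := Finset.univ) (x := y)
    (g := fun (j : Fin n) (y : Fin (n + 1) → ℝ) => v i - y j.succ)
    (fun j _ => (hp j.succ).const_sub (v i))
  have h2 := ((hp 0).mul h1).mul_const (∏ j ∈ Finset.univ.erase i, (v i - v j))⁻¹
  have h3 : (fun y => dixonMap v y i) = fun y => (y 0 * ∏ j : Fin n, (v i - y j.succ)) *
      (∏ j ∈ Finset.univ.erase i, (v i - v j))⁻¹ := by
    ext y; simp only [dixonMap, upperWt, Fin.tail]; ring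
  rw [h3]
  refine h2.congr_fderiv ?_
  ext x
  have hsub : ∀ j : Fin n, v i - y j.succ ≠ 0 := fun j => sub_ne_zero.2 (h.ne i j)
  have hpe : ∀ j : Fin n, ∏ k ∈ Finset.univ.erase j, (v i - y k.succ) =
      (∏ k : Fin n, (v i - y k.succ)) * (v i - y j.succ)⁻¹ := fun j => by
    rw [← Finset.mul_prod_erase Finset.univ _ (Finset.mem_univ j)]
    field_simp [hsub j]
  simp [dixonJac, Matrix.mulVec, dotProduct, Matrix.mul_assoc, Matrix.diagonal_mul,
    Matrix.mul_diagonal, Fin.sum_univ_succ, borderedCauchy, hpe, dixonMap, upperWt, Fin.tail]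
  rw [← Finset.sum_neg_distrib, add_comm]
  congr 1
  · field_simp
  · rw [Finset.mul_sum, Finset.mul_sum, ← Finset.sum_neg_distrib]
    refine Finset.sum_congr rfl fun j _ => ?_
    ring

/-- The Jacobian matrix of `cornerMap u`. -/
def cornerJac {n : ℕ} (u : Fin n → ℝ) (v : Fin (n + 1) → ℝ) :
    Matrix (Fin (n + 1)) (Fin (n + 1)) ℝ :=
  Matrix.diagonal (Fin.cons 1 (lowerWt u v)) * (borderedCauchy v u).transpose

lemma abs_det_cornerJac {n : ℕ} {u : Fin n → ℝ} {v : Fin (n + 1) → ℝ} (h : Interlaces u v) :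
    |(cornerJac u v).det| = absVdm v / absVdm u := by
  rw [cornerJac, Matrix.det_mul, Matrix.det_diagonal, Matrix.det_transpose, abs_mul,
    abs_det_borderedCauchy h.strictAnti_lower.injective h.ne, Fin.prod_univ_succ]
  simp only [Fin.cons_zero, Fin.cons_succ, one_mul, prod_lowerWt_eq]
  have h1 := absVdm_pos h.strictAnti_lower.injective
  have h2 : crossProd v u ≠ 0 := Finset.prod_ne_zero_iff.2 fun i _ =>
    Finset.prod_ne_zero_iff.2 fun j _ => abs_ne_zero.2 (sub_ne_zero.2 (h.ne i j))
  field_simp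

lemma hasFDerivAt_cornerMap {n : ℕ} {u : Fin n → ℝ} {v : Fin (n + 1) → ℝ} (h : Interlaces u v) :
    HasFDerivAt (cornerMap u) (Matrix.toLin' (cornerJac u v)).toContinuousLinearMap v := by
  rw [hasFDerivAt_pi']
  intro i
  have hp : ∀ k : Fin (n + 1), HasFDerivAt (fun y : Fin (n + 1) → ℝ => y k)
      (ContinuousLinearMap.proj (R := ℝ) k) v := fun k => hasFDerivAt_apply k v
  induction i using Fin.cases with
  | zero =>
    have h2 := (HasFDerivAt.fun_sum (u := Finset.univ) (fun k _ => hp k)).sub_const (∑ i, u i)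
    simp only [cornerMap, Fin.cons_zero]
    refine h2.congr_fderiv ?_
    ext x
    simp [cornerJac, Matrix.mulVec, dotProduct, Matrix.diagonal_mul, borderedCauchy]
  | succ i =>
    have h1 := HasFDerivAt.finsetProd (u := Finset.univ) (x := v)
      (g := fun (j : Fin (n + 1)) (y : Fin (n + 1) → ℝ) => u i - y j)
      (fun j _ => (hp j).const_sub (u i))
    have h2 := h1.neg.mul_const (∏ j ∈ Finset.univ.erase i, (u i - u j))⁻¹
    simp only [cornerMap, Fin.cons_succ, lowerWt, div_eq_mul_inv]
    refine h2.congr_fderiv ?_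
    ext x
    have hsub : ∀ j, u i - v j ≠ 0 := fun j => sub_ne_zero.2 (h.ne j i).symm
    have hpe : ∀ j, ∏ k ∈ Finset.univ.erase j, (u i - v k) =
        (∏ k, (u i - v k)) * (u i - v j)⁻¹ := fun j => by
      rw [← Finset.mul_prod_erase Finset.univ _ (Finset.mem_univ j)]
      field_simp [hsub j]
    simp [cornerJac, Matrix.mulVec, dotProduct, Matrix.diagonal_mul, borderedCauchy, hpe, lowerWt]
    rw [Finset.mul_sum]
    refine Finset.sum_congr rfl fun j _ => ?_
    rw [← neg_sub (u i) (v j), inv_neg]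
    ring

lemma measurable_finCons {n : ℕ} :
    Measurable fun p : ℝ × (Fin n → ℝ) => (Fin.cons p.1 p.2 : Fin (n + 1) → ℝ) := by
  rw [measurable_pi_iff]
  intro i
  induction i using Fin.cases with
  | zero => simpa using measurable_fst
  | succ i => simp only [Fin.cons_succ]; fun_prop

lemma measurable_finTail {n : ℕ} : Measurable (Fin.tail : (Fin (n + 1) → ℝ) → Fin n → ℝ) :=
  measurable_pi_iff.2 fun i => measurable_pi_apply i.succ

lemma lintegral_pi_cons {n : ℕ} (μ : Fin (n + 1) → Measure ℝ) [∀ i, SigmaFinite (μ i)]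
    {G : (Fin (n + 1) → ℝ) → ℝ≥0∞} (hG : Measurable G) :
    ∫⁻ x, G x ∂(Measure.pi μ) =
      ∫⁻ t, ∫⁻ u, G (Fin.cons t u) ∂(Measure.pi fun i : Fin n => μ i.succ) ∂(μ 0) := by
  have h := (measurePreserving_piFinSuccAbove (α := fun _ : Fin (n + 1) => ℝ) μ 0).symm
  have hm : Measurable fun a => G ((MeasurableEquiv.piFinSuccAbove (fun _ => ℝ) 0).symm a) :=
    hG.comp h.measurable
  rw [← h.lintegral_comp hG, lintegral_prod _ hm.aemeasurable]
  simp only [Fin.zero_succAbove]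
  refine lintegral_congr fun t => lintegral_congr fun u => ?_
  congr 1
  exact (Fin.insertNth_zero' t u)

lemma lintegral_volume_cons {n : ℕ} {G : (Fin (n + 1) → ℝ) → ℝ≥0∞} (hG : Measurable G) :
    ∫⁻ x, G x = ∫⁻ t, ∫⁻ u, G (Fin.cons t u) :=
  lintegral_pi_cons (fun _ => volume) hG

lemma lintegral_fin_prod {n : ℕ} (f : Fin n → ℝ → ℝ≥0∞) (hf : ∀ i, Measurable (f i)) :
    ∫⁻ x : Fin n → ℝ, ∏ i, f i (x i) = ∏ i, ∫⁻ t, f i t := by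
  induction n with
  | zero => simp [volume_pi]
  | succ n ih =>
    have h1 : Measurable fun x : Fin (n + 1) → ℝ => ∏ i, f i (x i) :=
      Finset.measurable_fun_prod _ fun i _ => (hf i).comp (measurable_pi_apply i)
    have h2 : Measurable fun x : Fin n → ℝ => ∏ i : Fin n, f i.succ (x i) :=
      Finset.measurable_fun_prod _ fun i _ => (hf i.succ).comp (measurable_pi_apply i)
    rw [lintegral_volume_cons h1]
    simp only [Fin.prod_univ_succ, Fin.cons_zero, Fin.cons_succ]
    simp_rw [lintegral_const_mul (f 0 _) h2, ih (fun i => f i.succ) fun i => hf i.succ]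
    rw [lintegral_mul_const _ (hf 0)]

lemma pi_withDensity {n : ℕ} (f : Fin n → ℝ → ℝ≥0∞) (hf : ∀ i, Measurable (f i))
    [∀ i, SigmaFinite ((volume : Measure ℝ).withDensity (f i))] :
    Measure.pi (fun i => (volume : Measure ℝ).withDensity (f i)) =
      volume.withDensity fun x : Fin n → ℝ => ∏ i, f i (x i) := by
  refine Measure.pi_eq fun s hs => ?_
  rw [withDensity_apply _ (MeasurableSet.univ_pi hs),
    ← lintegral_indicator (MeasurableSet.univ_pi hs)]
  have h : ∀ x : Fin n → ℝ, (Set.univ.pi s).indicator (fun x => ∏ i, f i (x i)) x =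
      ∏ i, (s i).indicator (f i) (x i) := by
    intro x
    by_cases hx : x ∈ Set.univ.pi s
    · rw [Set.indicator_of_mem hx]
      refine Finset.prod_congr rfl fun i _ => ?_
      rw [Set.indicator_of_mem (hx i trivial)]
    · rw [Set.indicator_of_notMem hx]
      simp only [Set.mem_univ_pi, not_forall] at hx
      obtain ⟨i, hi⟩ := hx
      exact (Finset.prod_eq_zero (Finset.mem_univ i) (Set.indicator_of_notMem hi _)).symm
  simp_rw [h]
  rw [lintegral_fin_prod _ fun i => (hf i).indicator (hs i)]
  refine Finset.prod_congr rfl fun i _ => ?_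
  rw [withDensity_apply _ (hs i), lintegral_indicator (hs i)]

open ProbabilityTheory in
lemma gammaPi_eq_withDensity {θ r : ℝ} (hθ : 0 < θ) (hr : 0 < r) (n : ℕ) :
    gammaPi θ r n = volume.withDensity fun x => ∏ i, gammaPDF θ r (x i) := by
  have h : ∀ _ : Fin n, IsProbabilityMeasure ((volume : Measure ℝ).withDensity (gammaPDF θ r)) :=
    fun _ => isProbabilityMeasure_gammaMeasure hθ hr
  exact pi_withDensity (fun _ => gammaPDF θ r) fun _ => measurable_gammaPDF θ r

open ProbabilityTheory in
lemma lintegral_gammaPi {θ r : ℝ} (hθ : 0 < θ) (hr : 0 < r) {n : ℕ} {G : (Fin n → ℝ) → ℝ≥0∞}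
    (hG : Measurable G) :
    ∫⁻ g, G g ∂(gammaPi θ r n) =
      ∫⁻ g in {g | ∀ i, 0 < g i}, (∏ i, gammaPDF θ r (g i)) * G g := by
  have hm : Measurable fun x : Fin n → ℝ => ∏ i, gammaPDF θ r (x i) :=
    Finset.measurable_fun_prod _ fun i _ => (measurable_gammaPDF θ r).comp (measurable_pi_apply i)
  rw [gammaPi_eq_withDensity hθ hr, lintegral_withDensity_eq_lintegral_mul _ hm hG]
  have hS : MeasurableSet {g : Fin n → ℝ | ∀ i, 0 < g i} := by
    simp only [Set.ofPred_forall]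
    exact MeasurableSet.iInter fun i => measurableSet_lt measurable_const (measurable_pi_apply i)
  rw [← lintegral_indicator hS]
  refine lintegral_congr_ae ?_
  have h0 : ∀ᵐ g : Fin n → ℝ, ∀ i, g i ≠ 0 := ae_all_iff.2 fun i =>
    Measure.ae_eval_ne (μ := fun _ : Fin n => (volume : Measure ℝ)) i 0
  filter_upwards [h0] with g hg
  by_cases hgS : g ∈ {g : Fin n → ℝ | ∀ i, 0 < g i}
  · rw [Set.indicator_of_mem hgS]; rfl
  · rw [Set.indicator_of_notMem hgS]
    simp only [Set.mem_setOf_eq, not_forall, not_lt] at hgS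
    obtain ⟨i, hi⟩ := hgS
    rw [Pi.mul_apply, Finset.prod_eq_zero (Finset.mem_univ i), zero_mul]
    exact gammaPDF_of_neg (lt_of_le_of_ne hi (hg i))

lemma measurable_absVdm {n : ℕ} : Measurable (absVdm : (Fin n → ℝ) → ℝ) := by
  unfold absVdm
  refine Finset.measurable_fun_prod _ fun i _ => Finset.measurable_fun_prod _ fun j _ => ?_
  split_ifs <;> fun_prop

lemma measurable_crossProd {n m : ℕ} :
    Measurable fun p : (Fin n → ℝ) × (Fin m → ℝ) => crossProd p.1 p.2 := by
  unfold crossProd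
  fun_prop

lemma measurable_upperWt {n : ℕ} (i : Fin (n + 1)) :
    Measurable fun p : (Fin (n + 1) → ℝ) × (Fin n → ℝ) => upperWt p.1 p.2 i := by
  unfold upperWt
  fun_prop

lemma measurable_lowerWt {n : ℕ} (i : Fin n) :
    Measurable fun p : (Fin n → ℝ) × (Fin (n + 1) → ℝ) => lowerWt p.1 p.2 i := by
  unfold lowerWt
  fun_prop

lemma measurableSet_interlaces {n : ℕ} :
    MeasurableSet {p : (Fin (n + 1) → ℝ) × (Fin n → ℝ) | Interlaces p.2 p.1} := by
  simp only [Interlaces, Set.ofPred_forall, Set.ofPred_and]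
  refine MeasurableSet.iInter fun i => MeasurableSet.inter ?_ ?_
  · exact measurableSet_lt (by fun_prop) (by fun_prop)
  · exact measurableSet_lt (by fun_prop) (by fun_prop)

open Classical in
/-- The density of the Dixon–Anderson transition from level `n + 1` to level `n`. -/
def dixonDens (θ : ℝ) {n : ℕ} (v : Fin (n + 1) → ℝ) (u : Fin n → ℝ) : ℝ :=
  if Interlaces u v then
    Real.Gamma ((n + 1 : ℕ) * θ) / Real.Gamma θ ^ (n + 1) * absVdm v ^ (1 - 2 * θ) * absVdm u *
      crossProd v u ^ (θ - 1)
  else 0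

lemma measurable_dixonDens (θ : ℝ) (n : ℕ) :
    Measurable (Function.uncurry fun (v : Fin (n + 1) → ℝ) u => dixonDens θ v u) := by
  unfold dixonDens Function.uncurry
  refine Measurable.ite measurableSet_interlaces ?_ measurable_const
  exact (((measurable_absVdm.comp measurable_fst).pow_const _).const_mul _ |>.mul
    (measurable_absVdm.comp measurable_snd)).mul (measurable_crossProd.pow_const _)

lemma measurable_dixonDens_right (θ : ℝ) {n : ℕ} (v : Fin (n + 1) → ℝ) :
    Measurable fun u => dixonDens θ v u :=
  (measurable_dixonDens θ n).comp measurable_prodMk_left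

lemma crossProd_nonneg {n m : ℕ} (v : Fin n → ℝ) (u : Fin m → ℝ) : 0 ≤ crossProd v u :=
  Finset.prod_nonneg fun _ _ => Finset.prod_nonneg fun _ _ => abs_nonneg _

lemma Interlaces.crossProd_pos {n : ℕ} {u : Fin n → ℝ} {v : Fin (n + 1) → ℝ}
    (h : Interlaces u v) : 0 < crossProd v u :=
  Finset.prod_pos fun i _ => Finset.prod_pos fun j _ => abs_pos.2 (sub_ne_zero.2 (h.ne i j))

lemma dixonDens_nonneg {θ : ℝ} (hθ : 0 < θ) {n : ℕ} (v : Fin (n + 1) → ℝ) (u : Fin n → ℝ) :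
    0 ≤ dixonDens θ v u := by
  unfold dixonDens
  have h1 := (Real.Gamma_pos_of_pos hθ).le
  have h2 : 0 ≤ Real.Gamma ((n + 1 : ℕ) * θ) := (Real.Gamma_pos_of_pos (by positivity)).le
  split_ifs
  · exact mul_nonneg (mul_nonneg (mul_nonneg (by positivity)
      (Real.rpow_nonneg (absVdm_nonneg v) _)) (absVdm_nonneg u))
      (Real.rpow_nonneg (crossProd_nonneg v u) _)
  · exact le_rfl

/-- The Dixon–Anderson transition kernel. -/
def dixonKernel (θ : ℝ) (n : ℕ) : ProbabilityTheory.Kernel (Fin (n + 1) → ℝ) (Fin n → ℝ) :=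
  ProbabilityTheory.Kernel.withDensity (ProbabilityTheory.Kernel.const _ volume)
    fun v u => ENNReal.ofReal (dixonDens θ v u)

instance (θ : ℝ) (n : ℕ) : ProbabilityTheory.IsSFiniteKernel (dixonKernel θ n) :=
  ProbabilityTheory.Kernel.IsSFiniteKernel.withDensity _ fun _ _ => ENNReal.ofReal_ne_top

lemma dixonKernel_apply (θ : ℝ) {n : ℕ} (v : Fin (n + 1) → ℝ) :
    dixonKernel θ n v = volume.withDensity fun u => ENNReal.ofReal (dixonDens θ v u) := by
  rw [dixonKernel, ProbabilityTheory.Kernel.withDensity_apply _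
    (measurable_dixonDens θ n).ennreal_ofReal, ProbabilityTheory.Kernel.const_apply]

lemma lintegral_dixonKernel (θ : ℝ) {n : ℕ} (v : Fin (n + 1) → ℝ) {G : (Fin n → ℝ) → ℝ≥0∞}
    (hG : Measurable G) :
    ∫⁻ u, G u ∂(dixonKernel θ n v) = ∫⁻ u, ENNReal.ofReal (dixonDens θ v u) * G u := by
  rw [dixonKernel_apply, lintegral_withDensity_eq_lintegral_mul _
    (measurable_dixonDens_right θ v).ennreal_ofReal hG]
  rfl

lemma ae_interlaces_dixonKernel (θ : ℝ) {n : ℕ} (v : Fin (n + 1) → ℝ) :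
    ∀ᵐ u ∂(dixonKernel θ n v), Interlaces u v := by
  rw [dixonKernel_apply, ae_withDensity_iff
    (measurable_dixonDens_right θ v).ennreal_ofReal]
  refine Eventually.of_forall fun u hu => ?_
  by_contra h
  simp [dixonDens, h] at hu

open ProbabilityTheory in
lemma abs_det_dixonJac_mul_gammaPDF {θ : ℝ} (hθ : 0 < θ) {n : ℕ} {v y : Fin (n + 1) → ℝ}
    (hy : y ∈ dixonDomain v) :
    ENNReal.ofReal |(dixonJac v y).det| * ∏ i, gammaPDF θ 1 (dixonMap v y i) =
      gammaPDF ((n + 1 : ℕ) * θ) 1 (y 0) * ENNReal.ofReal (dixonDens θ v (Fin.tail y)) := by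
  obtain ⟨h0, h⟩ := id hy
  have hG := Real.Gamma_pos_of_pos hθ
  have hG' : 0 < Real.Gamma ((n + 1 : ℕ) * θ) := Real.Gamma_pos_of_pos (by positivity)
  have hw : ∀ i, 0 < upperWt v (Fin.tail y) i := h.upperWt_pos
  have hd : ∀ i, 0 < dixonMap v y i := fun i => mul_pos h0 (hw i)
  have hv := absVdm_pos h.strictAnti_upper.injective
  have hu := absVdm_pos h.strictAnti_lower.injective
  have hc := h.crossProd_pos
  simp only [gammaPDF_of_nonneg (hd _).le, gammaPDF_of_nonneg h0.le]
  rw [← ENNReal.ofReal_prod_of_nonneg (fun i _ => by have := hd i; positivity),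
    ← ENNReal.ofReal_mul (abs_nonneg _), ← ENNReal.ofReal_mul (by positivity)]
  congr 1
  rw [abs_det_dixonJac hy, Finset.prod_mul_distrib, Finset.prod_mul_distrib, ← Real.exp_sum,
    Finset.sum_neg_distrib]
  simp only [one_mul, sum_dixonMap h.strictAnti_upper.injective]
  have h1 : ∏ i, dixonMap v y i ^ (θ - 1) =
      (y 0 ^ (θ - 1)) ^ (n + 1) * (crossProd v (Fin.tail y) / absVdm v ^ 2) ^ (θ - 1) := by
    rw [← prod_upperWt_eq, abs_of_pos (Finset.prod_pos fun i _ => hw i),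
      ← Real.finsetProd_rpow _ _ (fun i _ => (hw i).le)]
    simp only [dixonMap, Real.mul_rpow h0.le (hw _).le, Finset.prod_mul_distrib, Finset.prod_const,
      Finset.card_univ, Fintype.card_fin]
  rw [h1, dixonDens, if_pos h, Real.div_rpow hc.le (by positivity), Finset.prod_const,
    Finset.card_univ, Fintype.card_fin, Real.one_rpow, Real.one_rpow, div_pow, one_pow]
  have h2 : y 0 ^ (((n + 1 : ℕ) : ℝ) * θ - 1) = y 0 ^ n * (y 0 ^ (θ - 1)) ^ (n + 1) := by
    rw [← Real.rpow_natCast, ← Real.rpow_natCast, ← Real.rpow_mul h0.le, ← Real.rpow_add h0]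
    congr 1; push_cast; ring
  have h3 : absVdm v ^ (1 - 2 * θ) = (absVdm v)⁻¹ * ((absVdm v ^ 2) ^ (θ - 1))⁻¹ := by
    rw [← Real.rpow_natCast, ← Real.rpow_mul hv.le, ← Real.rpow_neg hv.le, ← Real.rpow_neg_one,
      ← Real.rpow_add hv]
    congr 1; push_cast; ring
  rw [h2, h3]
  field_simp

lemma measurableSet_dixonDomain {n : ℕ} (v : Fin (n + 1) → ℝ) : MeasurableSet (dixonDomain v) :=
  (measurableSet_lt measurable_const (measurable_pi_apply 0)).inter
    (((measurable_const (a := v)).prodMk measurable_finTail) measurableSet_interlaces)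

lemma measurable_dixonMap {n : ℕ} (v : Fin (n + 1) → ℝ) : Measurable (dixonMap v) :=
  measurable_pi_iff.2 fun i => (measurable_pi_apply 0).mul
    ((measurable_upperWt i).comp ((measurable_const (a := v)).prodMk measurable_finTail))

/-- Independent gamma variables factor as an independent gamma total mass and the weights of a
Dixon–Anderson distributed level. -/
lemma lintegral_gammaPi_eq_dixonKernel {θ : ℝ} (hθ : 0 < θ) {n : ℕ} {v : Fin (n + 1) → ℝ}
    (hv : StrictAnti v) {G : (Fin (n + 1) → ℝ) → ℝ≥0∞} (hG : Measurable G) :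
    ∫⁻ g, G g ∂(gammaPi θ 1 (n + 1)) =
      ∫⁻ s, ∫⁻ u, G (fun i => s * upperWt v u i) ∂(dixonKernel θ n v)
        ∂(ProbabilityTheory.gammaMeasure ((n + 1 : ℕ) * θ) 1) := by
  have hGd := hG.comp (measurable_dixonMap v)
  have hcons : ∀ (s : ℝ) (u : Fin n → ℝ), dixonMap v (Fin.cons s u) =
      fun i => s * upperWt v u i := fun s u => by ext i; simp [dixonMap]
  have hGs : Measurable fun p : ℝ × (Fin n → ℝ) => G (fun i => p.1 * upperWt v p.2 i) := by
    simpa only [hcons, Function.comp_def] using hGd.comp measurable_finCons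
  have hm : Measurable fun y : Fin (n + 1) → ℝ =>
      ProbabilityTheory.gammaPDF ((n + 1 : ℕ) * θ) 1 (y 0) *
        (ENNReal.ofReal (dixonDens θ v (Fin.tail y)) * G (dixonMap v y)) :=
    ((measurable_gammaPDF _ _).comp (measurable_pi_apply 0)).mul
      (((measurable_dixonDens_right θ v).comp measurable_finTail).ennreal_ofReal.mul hGd)
  rw [lintegral_gammaPi hθ one_pos hG, ← dixonMap_image hv,
    lintegral_image_eq_lintegral_abs_det_fderiv_mul volume (measurableSet_dixonDomain v)
      (fun y hy => (hasFDerivAt_dixonMap hy).hasFDerivWithinAt) (dixonMap_injOn hv.injective)]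
  rw [ProbabilityTheory.gammaMeasure, lintegral_withDensity_eq_lintegral_mul _
    (measurable_gammaPDF _ _) hGs.lintegral_prod_right']
  have hfib : ∀ s : ℝ, s ≠ 0 → ∫⁻ u, (dixonDomain v).indicator (fun y =>
      ProbabilityTheory.gammaPDF ((n + 1 : ℕ) * θ) 1 (y 0) *
        (ENNReal.ofReal (dixonDens θ v (Fin.tail y)) * G (dixonMap v y))) (Fin.cons s u) =
      ProbabilityTheory.gammaPDF ((n + 1 : ℕ) * θ) 1 s *
        ∫⁻ u, G (fun i => s * upperWt v u i) ∂(dixonKernel θ n v) := by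
    intro s hs
    have hGs' : Measurable fun u : Fin n → ℝ => G (fun i => s * upperWt v u i) :=
      hGs.comp measurable_prodMk_left
    have hGs'' : Measurable fun u : Fin n → ℝ => ENNReal.ofReal (dixonDens θ v u) *
        G (fun i => s * upperWt v u i) := (measurable_dixonDens_right θ v).ennreal_ofReal.mul hGs'
    rw [lintegral_dixonKernel θ v hGs', ← lintegral_const_mul _ hGs'']
    refine lintegral_congr fun u => ?_
    by_cases hmem : (Fin.cons s u : Fin (n + 1) → ℝ) ∈ dixonDomain v
    · rw [Set.indicator_of_mem hmem, hcons, Fin.cons_zero, Fin.tail_cons]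
    · rw [Set.indicator_of_notMem hmem]
      by_cases hs0 : 0 < s
      · have hI : ¬ Interlaces u v := fun hI => hmem ⟨by simpa using hs0, by simpa using hI⟩
        simp [dixonDens, hI]
      · rw [ProbabilityTheory.gammaPDF_of_neg (lt_of_le_of_ne (not_lt.1 hs0) hs), zero_mul]
  calc _ = ∫⁻ y in dixonDomain v, ProbabilityTheory.gammaPDF ((n + 1 : ℕ) * θ) 1 (y 0) *
        (ENNReal.ofReal (dixonDens θ v (Fin.tail y)) * G (dixonMap v y)) := by
        refine setLIntegral_congr_fun (measurableSet_dixonDomain v) fun y hy => ?_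
        have := abs_det_dixonJac_mul_gammaPDF hθ hy
        have hdet : (Matrix.toLin' (dixonJac v y)).toContinuousLinearMap.det =
            (dixonJac v y).det := by
          rw [LinearMap.det_toContinuousLinearMap, LinearMap.det_toLin']
        rw [hdet, ← mul_assoc, this, mul_assoc]
    _ = _ := by
        rw [← lintegral_indicator (measurableSet_dixonDomain v),
          lintegral_volume_cons (hm.indicator (measurableSet_dixonDomain v))]
        refine lintegral_congr_ae ?_
        filter_upwards [Measure.ae_ne volume (0 : ℝ)] with s hs
        exact hfib s hs

lemma isProbabilityMeasure_dixonKernel {θ : ℝ} (hθ : 0 < θ) {n : ℕ} {v : Fin (n + 1) → ℝ}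
    (hv : StrictAnti v) : IsProbabilityMeasure (dixonKernel θ n v) := by
  have h := lintegral_gammaPi_eq_dixonKernel hθ hv (G := fun _ => 1) measurable_const
  have h1 := isProbabilityMeasure_gammaPi hθ one_pos (n + 1)
  have h2 : IsProbabilityMeasure (ProbabilityTheory.gammaMeasure ((n + 1 : ℕ) * θ) 1) :=
    ProbabilityTheory.isProbabilityMeasure_gammaMeasure (by positivity) one_pos
  constructor
  simpa only [lintegral_const, measure_univ, one_mul, mul_one] using h.symm

lemma gammaPi_eq_map_dixonKernel {θ : ℝ} (hθ : 0 < θ) {n : ℕ} {v : Fin (n + 1) → ℝ}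
    (hv : StrictAnti v) :
    gammaPi θ 1 (n + 1) = Measure.map (fun p : ℝ × (Fin n → ℝ) => fun i => p.1 * upperWt v p.2 i)
      ((ProbabilityTheory.gammaMeasure ((n + 1 : ℕ) * θ) 1).prod (dixonKernel θ n v)) := by
  have hm : Measurable fun p : ℝ × (Fin n → ℝ) => fun i => p.1 * upperWt v p.2 i :=
    measurable_pi_iff.2 fun i => measurable_fst.mul
      ((measurable_upperWt i).comp ((measurable_const (a := v)).prodMk measurable_snd))
  refine Measure.ext_of_lintegral _ fun G hG => ?_
  have hGm : Measurable fun p : ℝ × (Fin n → ℝ) => G fun i => p.1 * upperWt v p.2 i := hG.comp hm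
  rw [lintegral_gammaPi_eq_dixonKernel hθ hv hG, lintegral_map hG hm,
    lintegral_prod _ hGm.aemeasurable]

/-- The coordinatewise affine map `x ↦ b x + c`. -/
def affVec (b c : ℝ) {n : ℕ} (x : Fin n → ℝ) : Fin n → ℝ := fun i => b * x i + c

lemma upperWt_affVec {b : ℝ} (hb : b ≠ 0) (c : ℝ) {n : ℕ} (v : Fin (n + 1) → ℝ) (u : Fin n → ℝ)
    (i : Fin (n + 1)) : upperWt (affVec b c v) (affVec b c u) i = upperWt v u i := by
  have h : ∀ x y : ℝ, b * x + c - (b * y + c) = b * (x - y) := fun x y => by ring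
  simp only [upperWt, affVec, h, Finset.prod_mul_distrib, Finset.prod_const]
  rw [Finset.card_erase_of_mem (Finset.mem_univ i), Finset.card_univ, Finset.card_univ,
    Fintype.card_fin, Fintype.card_fin, Nat.add_sub_cancel,
    mul_div_mul_left _ _ (pow_ne_zero _ hb)]

lemma affVec_injective {b : ℝ} (hb : b ≠ 0) (c : ℝ) {n : ℕ} {v : Fin n → ℝ}
    (hv : Function.Injective v) : Function.Injective (affVec b c v) := fun i j h => by
  refine hv (mul_left_cancel₀ hb (add_right_cancel (b := c) h))

lemma prod_map_mul_left {α : Type*} (J : List α) (s : ℝ) (f : α → ℝ) :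
    (J.map fun j => s * f j).prod = s ^ J.length * (J.map f).prod := by
  induction J with
  | nil => simp
  | cons j J ih => simp only [List.map_cons, List.prod_cons, ih, List.length_cons]; ring

lemma Gamma_add_natCast_div {a : ℝ} (ha : 0 < a) (k : ℕ) :
    Real.Gamma (a + k) / Real.Gamma a = ∏ i ∈ Finset.range k, (a + i) := by
  have h := (Real.Gamma_pos_of_pos ha).ne'
  induction k with
  | zero => simp [div_self h]
  | succ k ih =>
    rw [Finset.prod_range_succ, ← ih]
    push_cast
    rw [← add_assoc, Real.Gamma_add_one (by positivity)]
    ring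

lemma dixonKernel_prod_upperWt {θ : ℝ} (hθ : 0 < θ) {n : ℕ} {v : Fin (n + 1) → ℝ}
    (hv : StrictAnti v) (x : Fin (n + 1) → ℝ) (J : List ℕ) :
    Integrable (fun u => (J.map fun j => ∑ i, x i ^ j * upperWt v u i).prod) (dixonKernel θ n v) ∧
    ∫ u, (J.map fun j => ∑ i, x i ^ j * upperWt v u i).prod ∂(dixonKernel θ n v) =
      gammaMoment θ 1 J x / ∏ i ∈ Finset.range J.length, ((n + 1 : ℕ) * θ + i) := by
  set a : ℝ := (n + 1 : ℕ) * θ with ha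
  have ha0 : 0 < a := by positivity
  have hp := isProbabilityMeasure_dixonKernel hθ hv
  have hq := ProbabilityTheory.isProbabilityMeasure_gammaMeasure ha0 one_pos
  have hm : Measurable fun p : ℝ × (Fin n → ℝ) => fun i => p.1 * upperWt v p.2 i :=
    measurable_pi_iff.2 fun i => measurable_fst.mul
      ((measurable_upperWt i).comp ((measurable_const (a := v)).prodMk measurable_snd))
  have hw : ∀ i, Measurable fun u : Fin n → ℝ => upperWt v u i := fun i =>
    (measurable_upperWt i).comp ((measurable_const (a := v)).prodMk measurable_id)
  have hfac : ∀ p : ℝ × (Fin n → ℝ), (J.map fun j => ∑ i, x i ^ j * (p.1 * upperWt v p.2 i)).prod =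
      p.1 ^ J.length * (J.map fun j => ∑ i, x i ^ j * upperWt v p.2 i).prod := by
    intro p
    rw [← prod_map_mul_left]
    congr 1
    refine List.map_congr_left fun j _ => ?_
    rw [Finset.mul_sum]
    exact Finset.sum_congr rfl fun i _ => by ring
  have hgm : Measurable fun g : Fin (n + 1) → ℝ => (J.map fun j => ∑ i, x i ^ j * g i).prod := by
    induction J with
    | nil => simp
    | cons j J ih =>
      simp only [List.map_cons, List.prod_cons]
      exact Measurable.mul (by fun_prop) (ih (fun p => by
        rw [← prod_map_mul_left]
        congr 1
        refine List.map_congr_left fun j _ => ?_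
        rw [Finset.mul_sum]
        exact Finset.sum_congr rfl fun i _ => by ring))
  have hI := integrable_gammaMoment hθ one_pos J x
  have hpow : ∫ s, s ^ J.length ∂(ProbabilityTheory.gammaMeasure a 1) =
      ∏ i ∈ Finset.range J.length, (a + i) := by
    rw [integral_pow_gammaMeasure ha0 one_pos, one_pow, mul_one, Gamma_add_natCast_div ha0]
  have hpos : 0 < ∏ i ∈ Finset.range J.length, (a + i) :=
    Finset.prod_pos fun i _ => by positivity
  rw [gammaPi_eq_map_dixonKernel hθ hv, integrable_map_measure hgm.aestronglyMeasurable
    hm.aemeasurable] at hI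
  simp only [Function.comp_def, hfac] at hI
  constructor
  · have := hI.prod_right_ae
    have hex : ∃ᵐ s ∂(ProbabilityTheory.gammaMeasure a 1), s ≠ 0 := by
      by_contra hcon
      rw [not_frequently] at hcon
      simp only [not_not] at hcon
      have h1 := integral_congr_ae (μ := ProbabilityTheory.gammaMeasure a 1) (f := fun s => s ^ 1)
        (g := fun _ => 0) (by filter_upwards [hcon] with s hs; simp [hs])
      rw [integral_pow_gammaMeasure ha0 one_pos, integral_zero, one_pow, mul_one,
        Gamma_add_natCast_div ha0] at h1
      simp at h1
      exact ha0.ne' h1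
    obtain ⟨s, hs, hs'⟩ := (hex.and_eventually this).exists
    have h2 := hs'.const_mul (s ^ J.length)⁻¹
    refine h2.congr (Eventually.of_forall fun u => ?_)
    simp only
    rw [← mul_assoc, inv_mul_cancel₀ (pow_ne_zero _ hs), one_mul]
  · rw [gammaMoment, gammaPi_eq_map_dixonKernel hθ hv,
      integral_map hm.aemeasurable hgm.aestronglyMeasurable]
    simp only [hfac]
    rw [integral_prod_mul (fun s : ℝ => s ^ J.length)
      (fun u => (J.map fun j => ∑ i, x i ^ j * upperWt v u i).prod), hpow,
      mul_div_cancel_left₀ _ hpos.ne']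

lemma dixonKernel_prod_sgnProd {θ : ℝ} (hθ : 0 < θ) {n : ℕ} {v : Fin (n + 1) → ℝ}
    (hv : StrictAnti v) {b : ℝ} (hb : b ≠ 0) (c : ℝ) (κ J : List ℕ) :
    Integrable (fun u => (J.map fun j => ∑ i, affVec b c v i ^ j * upperWt v u i).prod *
      sgnProd κ (affVec b c u)) (dixonKernel θ n v) ∧
    ∫ u, (J.map fun j => ∑ i, affVec b c v i ^ j * upperWt v u i).prod *
      sgnProd κ (affVec b c u) ∂(dixonKernel θ n v) = dixonMoment θ J κ (affVec b c v) := by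
  induction κ generalizing J with
  | nil => simpa [dixonMoment] using dixonKernel_prod_upperWt hθ hv (affVec b c v) J
  | cons k κ ih =>
    have key : ∀ u, (J.map fun j => ∑ i, affVec b c v i ^ j * upperWt v u i).prod *
        sgnProd (k :: κ) (affVec b c u) =
        sgnEsymm k (affVec b c v) * ((J.map fun j => ∑ i, affVec b c v i ^ j * upperWt v u i).prod *
          sgnProd κ (affVec b c u)) +
        ∑ j ∈ Finset.range k, sgnEsymm (k - 1 - j) (affVec b c v) *
          ((((j + 1) :: J).map fun j => ∑ i, affVec b c v i ^ j * upperWt v u i).prod *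
          sgnProd κ (affVec b c u)) := by
      intro u
      rw [sgnProd_cons, sgnEsymm_lower (affVec_injective hb c hv.injective), Finset.sum_range_succ']
      simp only [upperWt_affVec hb, pow_zero, one_mul, sum_upperWt hv.injective, Nat.sub_zero,
        List.map_cons, List.prod_cons]
      rw [add_mul, mul_add, add_comm, Finset.sum_mul, Finset.mul_sum]
      congr 1
      · ring
      · refine Finset.sum_congr rfl fun j _ => ?_
        rw [show k - (j + 1) = k - 1 - j by omega]
        ring
    simp only [key]
    have h1 := (ih J).1.const_mul (sgnEsymm k (affVec b c v))
    have h2 := fun j (_ : j ∈ Finset.range k) =>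
      (ih ((j + 1) :: J)).1.const_mul (sgnEsymm (k - 1 - j) (affVec b c v))
    refine ⟨h1.add (integrable_finsetSum _ h2), ?_⟩
    rw [integral_add h1 (integrable_finsetSum _ h2), integral_finsetSum _ h2]
    simp only [integral_const_mul, (ih _).2, dixonMoment]

lemma dixonKernel_sgnProd {θ : ℝ} (hθ : 0 < θ) {n : ℕ} {v : Fin (n + 1) → ℝ}
    (hv : StrictAnti v) {b : ℝ} (hb : b ≠ 0) (c : ℝ) (κ : List ℕ) :
    Integrable (fun u => sgnProd κ (affVec b c u)) (dixonKernel θ n v) ∧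
    ∫ u, sgnProd κ (affVec b c u) ∂(dixonKernel θ n v) = dixonMoment θ [] κ (affVec b c v) := by
  simpa using dixonKernel_prod_sgnProd hθ hv hb c κ []

lemma finite_setOf_posList (D : ℤ) : {κ : List ℕ | 0 ∉ κ ∧ (κ.sum : ℤ) ≤ D}.Finite := by
  refine Set.Finite.subset (Set.Finite.biUnion (Set.finite_Iic D.toNat) fun d _ =>
    Set.finite_range fun c : Composition d => c.blocks) ?_
  rintro κ ⟨h0, hD⟩
  simp only [Set.mem_Iic, Set.mem_iUnion, Set.mem_range]
  refine ⟨κ.sum, by omega, ⟨κ, fun {i} hi => Nat.pos_of_ne_zero fun h => h0 (h ▸ hi), rfl⟩, rfl⟩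

lemma abs_one_sub_mul_le {t : ℝ} (ht : t ≤ 1) (d : ℕ) :
    |1 - d * t| ≤ (1 - t) ^ d + d ^ 2 * t ^ 2 := by
  have h1 : 1 + (d : ℝ) * (-t) ≤ (1 + -t) ^ d := one_add_mul_le_pow (by linarith) d
  have h2 : 0 ≤ (1 - t) ^ d := pow_nonneg (by linarith) d
  rw [← sub_eq_add_neg] at h1
  rw [abs_le]
  constructor <;> nlinarith [sq_nonneg ((d : ℝ) * t), sq_nonneg ((d : ℝ) * t - 1)]

/-- One Dixon–Anderson step maps `SymRep` functions to `SymRep` functions with nearly the same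
norm. -/
lemma exists_symRep_step {θ : ℝ} (hθ : 0 < θ) (D : ℤ) : ∃ C : ℝ, 0 ≤ C ∧ ∀ n : ℕ, 1 ≤ n →
    ∀ (B : ℝ) (F : (Fin n → ℝ) → ℝ), SymRep n D B F → ∃ F' : (Fin (n + 1) → ℝ) → ℝ,
      SymRep (n + 1) D (B * (1 + C / ((n : ℝ) + 1) ^ 2)) F' ∧
      ∀ (b c : ℝ), b ≠ 0 → ∀ v : Fin (n + 1) → ℝ, StrictAnti v →
        ∫ u, F (affVec b c u) ∂(dixonKernel θ n v) = F' (affVec b c v) := by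
  choose K hK using fun κ => symFam_dixonMoment_nil hθ κ
  have hK0 : ∀ κ, 0 ≤ K κ := fun κ => by simpa using (hK κ 1 le_rfl).nonneg
  set S := (finite_setOf_posList D).toFinset with hS
  set g : List ℕ → ℝ := fun κ => 2 ^ κ.sum * ((κ.sum : ℝ) ^ 2 + K κ) with hg
  have hg0 : ∀ κ, 0 ≤ g κ := fun κ => mul_nonneg (by positivity) (by have := hK0 κ; positivity)
  refine ⟨∑ κ ∈ S, g κ, Finset.sum_nonneg fun κ _ => hg0 κ, fun n hn B F hF => ?_⟩
  set C := ∑ κ ∈ S, g κ with hC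
  obtain ⟨ι, _, c, κ, h1, h2, h3⟩ := hF
  have hC0 : 0 ≤ C := Finset.sum_nonneg fun κ _ => hg0 κ
  have hn' : (1 : ℝ) ≤ n := by exact_mod_cast hn
  have hone : ∀ i, SymRep (n + 1) D ((n : ℝ) ^ (κ i).sum * (1 + C / ((n : ℝ) + 1) ^ 2))
      (fun x => dixonMoment θ [] (κ i) x) := by
    intro i
    set d := (κ i).sum with hd
    have hCi : g (κ i) ≤ C := Finset.single_le_sum (f := g) (fun κ _ => hg0 κ)
      ((finite_setOf_posList D).mem_toFinset.2 (h1 i))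
    have hr := (hK (κ i) (n + 1) (by omega)).add
      ((SymRep.sgnProd (n := n + 1) (κ i)).smul (1 - (κ i).sum / ((n + 1 : ℕ) : ℝ)))
    have hr' : SymRep (n + 1) ((κ i).sum : ℕ)
        (K (κ i) * ((n + 1 : ℕ) : ℝ) ^ (((κ i).sum : ℤ) - 2) +
          |1 - (κ i).sum / ((n + 1 : ℕ) : ℝ)| * ((n + 1 : ℕ) : ℝ) ^ (κ i).sum)
        (fun x => dixonMoment θ [] (κ i) x) := by
      simpa only [sub_add_cancel] using hr
    refine hr'.weaken (h1 i).2 ?_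
    rw [← hd]
    set t : ℝ := 1 / ((n : ℝ) + 1) with ht
    have ht2 : t ≤ 1 / 2 := by
      rw [ht]; exact one_div_le_one_div_of_le (by norm_num) (by linarith)
    have ht0 : 0 < t := by positivity
    have hab := abs_one_sub_mul_le (t := t) (by linarith) d
    have hn1 : (n : ℝ) = (1 - t) * (n + 1) := by rw [ht]; field_simp; ring
    have e1 : ((n + 1 : ℕ) : ℝ) = (n : ℝ) + 1 := by push_cast; rfl
    have e2 : ((n : ℝ) + 1) ^ ((d : ℤ) - 2) = ((n : ℝ) + 1) ^ d * t ^ 2 := by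
      rw [zpow_sub₀ (by positivity), zpow_natCast, ht]
      rw [div_pow, one_pow, mul_one_div]
      norm_cast
    have e3 : (n : ℝ) ^ d = (1 - t) ^ d * (n + 1) ^ d := by rw [← mul_pow, ← hn1]
    rw [e1, e2, e3, show (d : ℝ) / ((n : ℝ) + 1) = d * t by rw [ht]; ring,
      show C / ((n : ℝ) + 1) ^ 2 = C * t ^ 2 by rw [ht]; field_simp]
    have hp : 0 < ((n : ℝ) + 1) ^ d := by positivity
    have hhalf : 1 ≤ 2 ^ d * (1 - t) ^ d := by
      rw [← mul_pow]; exact one_le_pow₀ (by linarith)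
    have hfin : |1 - d * t| + K (κ i) * t ^ 2 ≤ (1 - t) ^ d * (1 + C * t ^ 2) := by
      have hq : (d : ℝ) ^ 2 + K (κ i) ≤ (1 - t) ^ d * C := by
        have hK' := hK0 (κ i)
        calc (d : ℝ) ^ 2 + K (κ i) ≤ (2 ^ d * (1 - t) ^ d) * ((d : ℝ) ^ 2 + K (κ i)) :=
              le_mul_of_one_le_left (by positivity) hhalf
          _ = (1 - t) ^ d * g (κ i) := by rw [hg]; ring
          _ ≤ _ := mul_le_mul_of_nonneg_left hCi (pow_nonneg (by linarith) d)
      nlinarith [mul_le_mul_of_nonneg_right hq (sq_nonneg t)]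
    nlinarith [mul_le_mul_of_nonneg_left hfin hp.le]
  refine ⟨fun x => ∑ i, c i * dixonMoment θ [] (κ i) x, ?_, ?_⟩
  · refine (SymRep.sum Finset.univ fun i _ => (hone i).smul (c i)).weaken le_rfl ?_
    simp only [← mul_assoc, ← Finset.sum_mul]
    exact mul_le_mul_of_nonneg_right h2 (by positivity)
  · intro b s hb v hv
    simp only [h3]
    rw [integral_finsetSum _ fun i _ => (dixonKernel_sgnProd hθ hv hb s (κ i)).1.const_mul _]
    simp only [integral_const_mul, (dixonKernel_sgnProd hθ hv hb s _).2]

open Polynomial in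
lemma continuous_genPoly_coeff {ι : Type*} (s : Finset ι) (k : ℕ) :
    Continuous fun x : ι → ℝ => (genPoly s x).coeff k := by
  classical
  induction s using Finset.induction_on generalizing k with
  | empty => simp only [genPoly, Finset.prod_empty]; exact continuous_const
  | insert i s hi ih =>
    have h : ∀ x : ι → ℝ, genPoly (insert i s) x = (1 - C (x i) * X) * genPoly s x := fun x => by
      rw [genPoly, genPoly, Finset.prod_insert hi]
    cases k with
    | zero =>
      refine (ih 0).congr fun x => ?_
      simp [h, sub_mul, mul_assoc]
    | succ k =>
      refine ((ih (k + 1)).sub ((continuous_apply i).mul (ih k))).congr fun x => ?_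
      simp only [h, sub_mul, one_mul, coeff_sub, mul_assoc, coeff_C_mul, coeff_X_mul]
      rfl

lemma continuous_sgnEsymm {n : ℕ} (k : ℕ) : Continuous fun x : Fin n → ℝ => sgnEsymm k x :=
  continuous_genPoly_coeff _ k

lemma continuous_sgnProd {n : ℕ} (κ : List ℕ) : Continuous fun x : Fin n → ℝ => sgnProd κ x := by
  induction κ with
  | nil => simpa using continuous_const
  | cons k κ ih => simp only [sgnProd_cons]; exact (continuous_sgnEsymm k).mul ih

lemma SymRep.continuous {n : ℕ} {D : ℤ} {B : ℝ} {F : (Fin n → ℝ) → ℝ} (h : SymRep n D B F) :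
    Continuous F := by
  obtain ⟨ι, _, c, κ, -, -, h3⟩ := h
  rw [funext h3]
  exact continuous_finsetSum _ fun i _ => (continuous_sgnProd (κ i)).const_mul (c i)

lemma continuous_affVec (b c : ℝ) {n : ℕ} : Continuous fun x : Fin n → ℝ => affVec b c x := by
  unfold affVec; fun_prop

lemma measurableSet_strictAnti (m : ℕ) : MeasurableSet {x : Fin m → ℝ | StrictAnti x} := by
  have : {x : Fin m → ℝ | StrictAnti x} = ⋂ i, ⋂ j, {x | i < j → x j < x i} := by
    ext x
    simp only [StrictAnti, Set.mem_iInter]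
    exact Iff.rfl
  rw [this]
  refine MeasurableSet.iInter fun i => MeasurableSet.iInter fun j => ?_
  by_cases hij : i < j
  · simp only [hij, true_imp_iff]
    exact measurableSet_lt (measurable_pi_apply _) (measurable_pi_apply _)
  · simp [hij]

/-- The composition of the Dixon–Anderson kernels from level `m + j + 1` down to level `m + 1`. -/
def chainKernel (θ : ℝ) (m : ℕ) : (j : ℕ) →
    ProbabilityTheory.Kernel (Fin (m + j + 1) → ℝ) (Fin (m + 1) → ℝ)
  | 0 => ProbabilityTheory.Kernel.id
  | j + 1 => (chainKernel θ m j).comp (dixonKernel θ (m + j + 1))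

lemma lintegral_chainKernel_succ (θ : ℝ) (m j : ℕ) (a : Fin (m + (j + 1) + 1) → ℝ)
    {G : (Fin (m + 1) → ℝ) → ℝ≥0∞} (hG : Measurable G) :
    ∫⁻ x, G x ∂(chainKernel θ m (j + 1) a) =
      ∫⁻ u, ∫⁻ x, G x ∂(chainKernel θ m j u) ∂(dixonKernel θ (m + j + 1) a) := by
  rw [chainKernel, ProbabilityTheory.Kernel.lintegral_comp _ _ _ hG]

lemma ae_strictAnti_chainKernel (θ : ℝ) (m j : ℕ) {a : Fin (m + j + 1) → ℝ} (ha : StrictAnti a) {R : ℝ}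
    (hR : ∀ i, |a i| ≤ R) :
    ∀ᵐ x ∂(chainKernel θ m j a), StrictAnti x ∧ ∀ i, |x i| ≤ R := by
  have hset : MeasurableSet {x : Fin (m + 1) → ℝ | StrictAnti x ∧ ∀ i, |x i| ≤ R} := by
    rw [Set.ofPred_and, Set.ofPred_forall]
    refine (measurableSet_strictAnti (m + 1)).inter (MeasurableSet.iInter fun i => ?_)
    exact measurableSet_le (measurable_pi_apply i).abs measurable_const
  induction j with
  | zero =>
    simp only [chainKernel, ProbabilityTheory.Kernel.id_apply]
    exact (ae_dirac_iff hset).2 ⟨ha, hR⟩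
  | succ j ih =>
    rw [ae_iff]
    change chainKernel θ m (j + 1) a {x | StrictAnti x ∧ ∀ i, |x i| ≤ R}ᶜ = 0
    rw [chainKernel, ProbabilityTheory.Kernel.comp_apply' _ _ _ hset.compl, lintegral_eq_zero_iff
      (ProbabilityTheory.Kernel.measurable_coe _ hset.compl)]
    filter_upwards [ae_interlaces_dixonKernel θ a] with u hu
    refine ih hu.strictAnti_lower fun i => ?_
    have h1 := abs_le.1 (hR i.castSucc)
    have h2 := abs_le.1 (hR i.succ)
    exact abs_le.2 ⟨by linarith [(hu i).2], by linarith [(hu i).1]⟩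

lemma isProbabilityMeasure_chainKernel {θ : ℝ} (hθ : 0 < θ) (m j : ℕ) {a : Fin (m + j + 1) → ℝ}
    (ha : StrictAnti a) : IsProbabilityMeasure (chainKernel θ m j a) := by
  induction j with
  | zero =>
    simp only [chainKernel, ProbabilityTheory.Kernel.id_apply]
    infer_instance
  | succ j ih =>
    have := isProbabilityMeasure_dixonKernel hθ ha
    constructor
    rw [← lintegral_one, lintegral_chainKernel_succ θ m j a measurable_const]
    rw [lintegral_congr_ae (g := fun _ => 1)]
    · simp
    · filter_upwards [ae_interlaces_dixonKernel θ a] with u hu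
      have := ih hu.strictAnti_lower
      simp

lemma exists_forall_abs_le {n : ℕ} (a : Fin n → ℝ) : ∃ R, ∀ i, |a i| ≤ R :=
  ⟨∑ i, |a i|, fun i => Finset.single_le_sum (f := fun i => |a i|)
    (fun i _ => abs_nonneg _) (Finset.mem_univ i)⟩

lemma integrable_chainKernel {θ : ℝ} (hθ : 0 < θ) (m j : ℕ) {a : Fin (m + j + 1) → ℝ}
    (ha : StrictAnti a) {F : (Fin (m + 1) → ℝ) → ℝ} (hF : Continuous F) :
    Integrable F (chainKernel θ m j a) := by
  have := isProbabilityMeasure_chainKernel hθ m j ha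
  obtain ⟨R, hR⟩ := exists_forall_abs_le a
  obtain ⟨C, hC⟩ := (isCompact_univ_pi fun _ : Fin (m + 1) => isCompact_Icc (a := -R) (b := R)).exists_bound_of_continuousOn
    hF.continuousOn
  refine Integrable.of_bound hF.aestronglyMeasurable C ?_
  filter_upwards [ae_strictAnti_chainKernel θ m j ha hR] with x hx
  exact hC x fun i _ => abs_le.1 (hx.2 i)

lemma integral_chainKernel_succ {θ : ℝ} (hθ : 0 < θ) (m j : ℕ) {a : Fin (m + (j + 1) + 1) → ℝ}
    (ha : StrictAnti a) {F : (Fin (m + 1) → ℝ) → ℝ} (hF : Continuous F) :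
    ∫ x, F x ∂(chainKernel θ m (j + 1) a) =
      ∫ u, ∫ x, F x ∂(chainKernel θ m j u) ∂(dixonKernel θ (m + j + 1) a) := by
  have h := integrable_chainKernel hθ m (j + 1) ha hF
  rw [chainKernel] at h ⊢
  exact ProbabilityTheory.Kernel.integral_comp h

lemma one_add_div_sq_le_exp {C : ℝ} (hC : 0 ≤ C) {x : ℝ} (hx : 0 < x) :
    1 + C / (x + 1) ^ 2 ≤ Real.exp (C * (1 / x - 1 / (x + 1))) := by
  have h := Real.add_one_le_exp (C * (1 / x - 1 / (x + 1)))
  have h2 : C / (x + 1) ^ 2 ≤ C * (1 / x - 1 / (x + 1)) := by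
    rw [div_eq_mul_one_div]
    refine mul_le_mul_of_nonneg_left ?_ hC
    rw [div_sub_div _ _ hx.ne' (by positivity), div_le_div_iff₀ (by positivity) (by positivity)]
    nlinarith
  linarith

/-- Expectations of symmetric polynomials under the chain of Dixon–Anderson kernels are symmetric
polynomials of the starting point, with norm bounded uniformly in the length of the chain. -/
lemma exists_symRep_chainKernel {θ : ℝ} (hθ : 0 < θ) (D : ℤ) {m : ℕ} {B : ℝ}
    {F : (Fin (m + 1) → ℝ) → ℝ} (hF : SymRep (m + 1) D B F) : ∃ B', ∀ j, ∃ F' : (Fin (m + j + 1) → ℝ) → ℝ,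
      SymRep (m + j + 1) D B' F' ∧ ∀ (b c : ℝ), b ≠ 0 → ∀ a : Fin (m + j + 1) → ℝ, StrictAnti a →
        ∫ x, F (affVec b c x) ∂(chainKernel θ m j a) = F' (affVec b c a) := by
  obtain ⟨C, hC0, hC⟩ := exists_symRep_step hθ D
  have hB : 0 ≤ B := hF.nonneg
  suffices h : ∀ j, ∃ F' : (Fin (m + j + 1) → ℝ) → ℝ,
      SymRep (m + j + 1) D (B * Real.exp (C * (1 / (m + 1) - 1 / (m + j + 1)))) F' ∧
      ∀ (b c : ℝ), b ≠ 0 → ∀ a : Fin (m + j + 1) → ℝ, StrictAnti a →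
        ∫ x, F (affVec b c x) ∂(chainKernel θ m j a) = F' (affVec b c a) by
    refine ⟨B * Real.exp (C * (1 / (m + 1))), fun j => ?_⟩
    obtain ⟨F', h1, h2⟩ := h j
    refine ⟨F', h1.weaken le_rfl ?_, h2⟩
    have : 0 ≤ 1 / ((m : ℝ) + j + 1) := by positivity
    gcongr
    linarith
  intro j
  induction j with
  | zero =>
    refine ⟨F, by simpa using hF, fun b c _ a _ => ?_⟩
    simp only [chainKernel, ProbabilityTheory.Kernel.id_apply]
    exact integral_dirac (fun x => F (affVec b c x)) a
  | succ j ih =>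
    obtain ⟨F', h1, h2⟩ := ih
    obtain ⟨F'', h3, h4⟩ := hC (m + j + 1) (by omega) _ F' h1
    refine ⟨F'', h3.weaken le_rfl ?_, fun b c hb a ha => ?_⟩
    · rw [mul_assoc]
      refine mul_le_mul_of_nonneg_left ?_ hB
      have h5 := one_add_div_sq_le_exp hC0 (x := (m : ℝ) + j + 1) (by positivity)
      push_cast
      calc _ ≤ _ := mul_le_mul_of_nonneg_left h5 (Real.exp_pos _).le
        _ = _ := by rw [← Real.exp_add]; congr 1; ring
    · rw [integral_chainKernel_succ hθ m j ha (F := fun x => F (affVec b c x))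
        (hF.continuous.comp (continuous_affVec b c)), ← h4 b c hb a ha]
      refine integral_congr_ae ?_
      filter_upwards [ae_interlaces_dixonKernel θ a] with u hu
      exact h2 b c hb u hu.strictAnti_lower

open Classical in
/-- The contribution of two consecutive levels to the weight of the orbital beta process. -/
def levelWt (θ : ℝ) {n : ℕ} (v : Fin (n + 1) → ℝ) (u : Fin n → ℝ) : ℝ :=
  if Interlaces u v then absVdm u ^ (2 - 2 * θ) * crossProd v u ^ (θ - 1) else 0

lemma absVdm_rpow {n : ℕ} (x : Fin n → ℝ) (p : ℝ) :
    absVdm x ^ p = ∏ i, ∏ j, if i < j then |x i - x j| ^ p else 1 := by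
  have h : ∀ i j, 0 ≤ if i < j then |x i - x j| else 1 := fun i j => by split_ifs <;> positivity
  rw [absVdm, ← Real.finsetProd_rpow _ _ fun i _ => Finset.prod_nonneg fun j _ => h i j]
  refine Finset.prod_congr rfl fun i _ => ?_
  rw [← Real.finsetProd_rpow _ _ fun j _ => h i j]
  refine Finset.prod_congr rfl fun j _ => ?_
  split_ifs <;> simp

lemma crossProd_rpow {n m : ℕ} (v : Fin n → ℝ) (u : Fin m → ℝ) (p : ℝ) :
    crossProd v u ^ p = ∏ i, ∏ j, |v i - u j| ^ p := by
  rw [crossProd, ← Real.finsetProd_rpow _ _ fun i _ => Finset.prod_nonneg fun j _ => abs_nonneg _]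
  refine Finset.prod_congr rfl fun i _ => ?_
  rw [← Real.finsetProd_rpow _ _ fun j _ => abs_nonneg _]

open Classical in
/-- The weight of the orbital beta process as a product over levels. -/
lemma indicator_obpWt (θ : ℝ) {M : ℕ} (a : Fin (M + 1) → ℝ) (x : Tri M) :
    (obpDomain a).indicator (obpWt θ a) x =
      ∏ k : Fin M, levelWt θ (lvl (N := M + 1) a x (k.1 + 1) (by have := k.isLt; omega)) (x k) := by
  by_cases hx : x ∈ obpDomain a
  · rw [Set.indicator_of_mem hx]
    refine Finset.prod_congr rfl fun k _ => ?_
    rw [levelWt, if_pos (hx k), absVdm_rpow, crossProd_rpow]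
  · rw [Set.indicator_of_notMem hx]
    have : ∃ k : Fin M, ¬ Interlaces (x k)
        (lvl (N := M + 1) a x (k.1 + 1) (by have := k.isLt; omega)) := by
      by_contra! h
      exact hx h
    obtain ⟨k, hk⟩ := this
    exact (Finset.prod_eq_zero (Finset.mem_univ k) (by rw [levelWt, if_neg hk])).symm

lemma levelWt_nonneg (θ : ℝ) {n : ℕ} (v : Fin (n + 1) → ℝ) (u : Fin n → ℝ) :
    0 ≤ levelWt θ v u := by
  unfold levelWt
  split_ifs
  · exact mul_nonneg (Real.rpow_nonneg (absVdm_nonneg _) _)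
      (Real.rpow_nonneg (crossProd_nonneg _ _) _)
  · exact le_rfl

lemma measurable_levelWt (θ : ℝ) (n : ℕ) :
    Measurable (Function.uncurry fun (v : Fin (n + 1) → ℝ) u => levelWt θ v u) := by
  unfold levelWt Function.uncurry
  exact Measurable.ite measurableSet_interlaces
    (((measurable_absVdm.comp measurable_snd).pow_const _).mul (measurable_crossProd.pow_const _))
    measurable_const

/-- Adding a level to a triangular array. -/
def triSnoc {M : ℕ} (x : Tri M) (u : Fin (M + 1) → ℝ) : Tri (M + 1) :=
  Fin.snoc (α := fun k : Fin (M + 1) => Fin (k.1 + 1) → ℝ) x u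

lemma triSnoc_castSucc {M : ℕ} (x : Tri M) (u : Fin (M + 1) → ℝ) (k : Fin M) :
    triSnoc x u k.castSucc = x k := by
  simp only [triSnoc, Fin.snoc_castSucc]

lemma triSnoc_last {M : ℕ} (x : Tri M) (u : Fin (M + 1) → ℝ) :
    triSnoc x u (Fin.last M) = u := by
  simp only [triSnoc, Fin.snoc_last]

lemma lvl_top {M : ℕ} (a : Fin (M + 1) → ℝ) (x : Tri M) (h : M < M + 1) :
    lvl (N := M + 1) a x M h = a := by
  rw [lvl, dif_neg (by omega)]

lemma lvl_triSnoc {M : ℕ} (a : Fin (M + 2) → ℝ) (x : Tri M) (u : Fin (M + 1) → ℝ) {k : ℕ}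
    (hk : k < M + 1) :
    lvl (N := M + 2) a (triSnoc x u) k (by omega) = lvl (N := M + 1) u x k hk := by
  rw [lvl, dif_pos (show k < M + 2 - 1 by omega)]
  rcases Nat.lt_or_ge k M with h | h
  · rw [lvl, dif_pos (show k < M + 1 - 1 by omega)]
    exact triSnoc_castSucc x u ⟨k, h⟩
  · obtain rfl : k = M := by omega
    rw [lvl_top]
    exact triSnoc_last x u

lemma indicator_obpWt_triSnoc (θ : ℝ) {M : ℕ} (a : Fin (M + 2) → ℝ) (x : Tri M)
    (u : Fin (M + 1) → ℝ) :
    (obpDomain a).indicator (obpWt θ a) (triSnoc x u) =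
      (obpDomain u).indicator (obpWt θ u) x * levelWt θ a u := by
  rw [indicator_obpWt, indicator_obpWt, Fin.prod_univ_castSucc]
  congr 1
  · refine Finset.prod_congr rfl fun k _ => ?_
    have := lvl_triSnoc a x u (k := k.1 + 1) (by have := k.isLt; omega)
    rw [triSnoc_castSucc]
    exact congrArg (fun w => levelWt θ w (x k)) this
  · rw [triSnoc_last]
    exact congrArg (fun w => levelWt θ w u) (lvl_top a _ _)

lemma measurable_triSnoc (M : ℕ) :
    Measurable fun p : Tri M × (Fin (M + 1) → ℝ) => triSnoc p.1 p.2 := by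
  refine measurable_pi_iff.2 fun k => ?_
  induction k using Fin.lastCases with
  | last => simp only [triSnoc_last]; exact measurable_snd
  | cast k => simp only [triSnoc_castSucc]; exact (measurable_pi_apply k).comp measurable_fst

lemma map_triSnoc (M : ℕ) :
    Measure.map (fun p : Tri M × (Fin (M + 1) → ℝ) => triSnoc p.1 p.2) volume =
      (volume : Measure (Tri (M + 1))) := by
  refine (Measure.pi_eq fun s hs => ?_).symm
  rw [Measure.map_apply (measurable_triSnoc M) (MeasurableSet.univ_pi hs)]
  have : (fun p : Tri M × (Fin (M + 1) → ℝ) => triSnoc p.1 p.2) ⁻¹' Set.univ.pi s =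
      (Set.univ.pi fun k : Fin M => s k.castSucc) ×ˢ s (Fin.last M) := by
    ext p
    simp only [Set.mem_preimage, Set.mem_univ_pi, Set.mem_prod, Fin.forall_fin_succ', triSnoc_last,
      triSnoc_castSucc]
  rw [this, Measure.volume_eq_prod, Measure.prod_prod, Fin.prod_univ_castSucc]
  congr 1
  exact Measure.pi_pi _ _

lemma measurable_lvl {M : ℕ} (a : Fin (M + 1) → ℝ) (k : ℕ) (hk : k < M + 1) :
    Measurable fun x : Tri M => lvl (N := M + 1) a x k hk := by
  unfold lvl
  split_ifs with h
  · exact measurable_pi_apply (⟨k, h⟩ : Fin M)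
  · exact measurable_const

lemma measurable_indicator_obpWt (θ : ℝ) {M : ℕ} (a : Fin (M + 1) → ℝ) :
    Measurable fun x : Tri M => (obpDomain a).indicator (obpWt θ a) x := by
  simp only [indicator_obpWt]
  refine Finset.measurable_prod _ fun k _ => ?_
  exact (measurable_levelWt θ (k.1 + 1)).comp
    ((measurable_lvl a (k.1 + 1) (by have := k.isLt; omega)).prodMk (measurable_pi_apply k))

lemma indicator_obpWt_nonneg (θ : ℝ) {M : ℕ} (a : Fin (M + 1) → ℝ) (x : Tri M) :
    0 ≤ (obpDomain a).indicator (obpWt θ a) x := by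
  rw [indicator_obpWt]
  exact Finset.prod_nonneg fun k _ => levelWt_nonneg _ _ _

lemma lintegral_obpWt_succ (θ : ℝ) {M : ℕ} (a : Fin (M + 2) → ℝ) {H : Tri (M + 1) → ℝ≥0∞}
    (hH : Measurable H) :
    ∫⁻ x : Tri (M + 1), ENNReal.ofReal ((obpDomain a).indicator (obpWt θ a) x) * H x =
      ∫⁻ u, ENNReal.ofReal (levelWt θ a u) *
        ∫⁻ x : Tri M, ENNReal.ofReal ((obpDomain u).indicator (obpWt θ u) x) * H (triSnoc x u) := by
  have hm : Measurable fun x : Tri (M + 1) =>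
      ENNReal.ofReal ((obpDomain a).indicator (obpWt θ a) x) * H x :=
    (measurable_indicator_obpWt θ a).ennreal_ofReal.mul hH
  conv_lhs => rw [← map_triSnoc]
  have hm' : Measurable fun p : Tri M × (Fin (M + 1) → ℝ) =>
      ENNReal.ofReal ((obpDomain a).indicator (obpWt θ a) (triSnoc p.1 p.2)) * H (triSnoc p.1 p.2) :=
    hm.comp (measurable_triSnoc M)
  rw [lintegral_map hm (measurable_triSnoc M), Measure.volume_eq_prod,
    lintegral_prod_symm _ hm'.aemeasurable]
  refine lintegral_congr fun u => ?_
  rw [← lintegral_const_mul']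
  · refine lintegral_congr fun x => ?_
    rw [indicator_obpWt_triSnoc, ENNReal.ofReal_mul (indicator_obpWt_nonneg θ u x)]
    ring
  · exact ENNReal.ofReal_ne_top

lemma levelWt_mul_absVdm {θ : ℝ} (hθ : 0 < θ) {n : ℕ} (v : Fin (n + 1) → ℝ) (u : Fin n → ℝ) :
    levelWt θ v u * absVdm u ^ (2 * θ - 1) =
      Real.Gamma θ ^ (n + 1) / Real.Gamma ((n + 1 : ℕ) * θ) * absVdm v ^ (2 * θ - 1) *
        dixonDens θ v u := by
  unfold levelWt dixonDens
  split_ifs with h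
  · have h1 := Real.Gamma_pos_of_pos hθ
    have h2 : 0 < Real.Gamma ((n + 1 : ℕ) * θ) := Real.Gamma_pos_of_pos (by positivity)
    have hv := absVdm_pos h.strictAnti_upper.injective
    have hu := absVdm_pos h.strictAnti_lower.injective
    have e1 : absVdm u ^ (2 - 2 * θ) * absVdm u ^ (2 * θ - 1) = absVdm u := by
      rw [← Real.rpow_add hu]; ring_nf; exact Real.rpow_one _
    have e2 : absVdm v ^ (2 * θ - 1) * absVdm v ^ (1 - 2 * θ) = 1 := by
      rw [← Real.rpow_add hv]; ring_nf; exact Real.rpow_zero _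
    have e3 : Real.Gamma θ ^ (n + 1) / Real.Gamma ((n + 1 : ℕ) * θ) *
        (Real.Gamma ((n + 1 : ℕ) * θ) / Real.Gamma θ ^ (n + 1)) = 1 := by
      field_simp
    calc _ = (absVdm u ^ (2 - 2 * θ) * absVdm u ^ (2 * θ - 1)) * crossProd v u ^ (θ - 1) := by ring
      _ = (Real.Gamma θ ^ (n + 1) / Real.Gamma ((n + 1 : ℕ) * θ) *
            (Real.Gamma ((n + 1 : ℕ) * θ) / Real.Gamma θ ^ (n + 1))) *
          (absVdm v ^ (2 * θ - 1) * absVdm v ^ (1 - 2 * θ)) * absVdm u *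
          crossProd v u ^ (θ - 1) := by rw [e1, e2, e3]; ring
      _ = _ := by ring
  · simp

lemma lintegral_levelWt {θ : ℝ} (hθ : 0 < θ) {n : ℕ} (v : Fin (n + 1) → ℝ)
    {G : (Fin n → ℝ) → ℝ≥0∞} (hG : Measurable G) :
    ∫⁻ u, ENNReal.ofReal (levelWt θ v u) * (ENNReal.ofReal (absVdm u ^ (2 * θ - 1)) * G u) =
      ENNReal.ofReal (Real.Gamma θ ^ (n + 1) / Real.Gamma ((n + 1 : ℕ) * θ)) *
        ENNReal.ofReal (absVdm v ^ (2 * θ - 1)) * ∫⁻ u, G u ∂(dixonKernel θ n v) := by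
  have h1 := Real.Gamma_pos_of_pos hθ
  have h2 : 0 < Real.Gamma ((n + 1 : ℕ) * θ) := Real.Gamma_pos_of_pos (by positivity)
  have h3 : 0 ≤ absVdm v ^ (2 * θ - 1) := Real.rpow_nonneg (absVdm_nonneg _) _
  rw [lintegral_dixonKernel θ v hG, ← ENNReal.ofReal_mul (by positivity),
    ← lintegral_const_mul' _ _ ENNReal.ofReal_ne_top]
  refine lintegral_congr fun u => ?_
  rw [← mul_assoc, ← mul_assoc, ← ENNReal.ofReal_mul (levelWt_nonneg _ _ _),
    ← ENNReal.ofReal_mul (by positivity), levelWt_mul_absVdm hθ]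

lemma exists_lintegral_obpWt {θ : ℝ} (hθ : 0 < θ) (M : ℕ) : ∃ Z : ℝ≥0∞, Z ≠ 0 ∧ Z ≠ ∞ ∧
    ∀ a : Fin (M + 1) → ℝ, StrictAnti a →
      ∫⁻ x : Tri M, ENNReal.ofReal ((obpDomain a).indicator (obpWt θ a) x) =
        Z * ENNReal.ofReal (absVdm a ^ (2 * θ - 1)) := by
  have h1 := Real.Gamma_pos_of_pos hθ
  induction M with
  | zero =>
    refine ⟨1, one_ne_zero, ENNReal.one_ne_top, fun a _ => ?_⟩
    simp only [indicator_obpWt]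
    have : (volume : Measure (Tri 0)) Set.univ = 1 := by
      rw [← Set.pi_univ Set.univ]
      exact (Measure.pi_pi _ _).trans (by simp)
    simp [absVdm, this]
  | succ M ih =>
    obtain ⟨Z, hZ0, hZ, ih⟩ := ih
    have h2 : 0 < Real.Gamma ((M + 1 + 1 : ℕ) * θ) := Real.Gamma_pos_of_pos (by positivity)
    refine ⟨Z * ENNReal.ofReal (Real.Gamma θ ^ (M + 1 + 1) / Real.Gamma ((M + 1 + 1 : ℕ) * θ)),
      mul_ne_zero hZ0 ?_, ENNReal.mul_ne_top hZ ENNReal.ofReal_ne_top, fun a ha => ?_⟩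
    · exact (ENNReal.ofReal_pos.2 (by positivity)).ne'
    have hp := isProbabilityMeasure_dixonKernel hθ ha
    have := lintegral_obpWt_succ θ a (H := fun _ => 1) measurable_const
    simp only [mul_one] at this
    rw [this]
    have h3 := lintegral_levelWt hθ a (G := fun _ => 1) measurable_const
    simp only [mul_one, lintegral_const, measure_univ] at h3
    rw [mul_assoc, ← h3, ← lintegral_const_mul' _ _ hZ]
    refine lintegral_congr fun u => ?_
    by_cases hu : Interlaces u a
    · rw [ih u hu.strictAnti_lower]; ring
    · simp [levelWt, hu]

lemma exists_lintegral_obpWt_lvl {θ : ℝ} (hθ : 0 < θ) (m j : ℕ) : ∃ Z : ℝ≥0∞, Z ≠ 0 ∧ Z ≠ ∞ ∧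
    ∀ a : Fin (m + j + 1) → ℝ, StrictAnti a → ∀ G : (Fin (m + 1) → ℝ) → ℝ≥0∞, Measurable G →
      ∫⁻ x : Tri (m + j), ENNReal.ofReal ((obpDomain a).indicator (obpWt θ a) x) *
        G (lvl (N := m + j + 1) a x m (by omega)) =
        Z * ENNReal.ofReal (absVdm a ^ (2 * θ - 1)) * ∫⁻ y, G y ∂(chainKernel θ m j a) := by
  have h1 := Real.Gamma_pos_of_pos hθ
  induction j with
  | zero =>
    obtain ⟨Z, hZ0, hZ, h⟩ := exists_lintegral_obpWt hθ m
    refine ⟨Z, hZ0, hZ, fun a ha G hG => ?_⟩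
    simp only [chainKernel, ProbabilityTheory.Kernel.id_apply, lintegral_dirac' a hG]
    rw [← h a ha, ← lintegral_mul_const _ (measurable_indicator_obpWt θ a).ennreal_ofReal]
    refine lintegral_congr fun x => ?_
    rw [show lvl (N := m + 0 + 1) a x m (by omega) = a from lvl_top a x _]
  | succ j ih =>
    obtain ⟨Z, hZ0, hZ, ih⟩ := ih
    have h2 : 0 < Real.Gamma ((m + j + 1 + 1 : ℕ) * θ) := Real.Gamma_pos_of_pos (by positivity)
    refine ⟨Z * ENNReal.ofReal (Real.Gamma θ ^ (m + j + 1 + 1) /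
      Real.Gamma ((m + j + 1 + 1 : ℕ) * θ)),
      mul_ne_zero hZ0 ?_, ENNReal.mul_ne_top hZ ENNReal.ofReal_ne_top, fun a ha G hG => ?_⟩
    · exact (ENNReal.ofReal_pos.2 (by positivity)).ne'
    have := lintegral_obpWt_succ θ (M := m + j) a
      (H := fun x => G (lvl (N := m + j + 2) a x m (by omega)))
      (hG.comp (measurable_lvl (M := m + j + 1) a m (by omega)))
    refine this.trans ?_
    rw [lintegral_chainKernel_succ θ m j a hG, mul_assoc Z]
    have h3 := lintegral_levelWt hθ a (G := fun u => ∫⁻ x, G x ∂(chainKernel θ m j u))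
      (hG.lintegral_kernel)
    refine Eq.trans ?_ (congrArg (fun t => Z * t) h3 |>.trans (mul_assoc _ _ _).symm)
    rw [← lintegral_const_mul' _ _ hZ]
    refine lintegral_congr fun u => ?_
    by_cases hu : Interlaces u a
    · have e : ∀ x : Tri (m + j), lvl (N := m + j + 2) a (triSnoc x u) m (by omega) =
          lvl (N := m + j + 1) u x m (by omega) := fun x => lvl_triSnoc (M := m + j) a x u (by omega)
      simp only [e]
      rw [ih u hu.strictAnti_lower G hG]
      ring
    · simp [levelWt, hu]

/-- The `m`-th level of the orbital beta process is distributed according to the chain of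
Dixon–Anderson kernels. -/
lemma map_levelProj_obp {θ : ℝ} (hθ : 0 < θ) (m j : ℕ) {a : Fin (m + (j + 1) + 1) → ℝ}
    (ha : StrictAnti a) (h1 : 1 ≤ m + 1) (h2 : m + 1 < m + (j + 1) + 1) :
    Measure.map (levelProj (m + 1) h1 h2) (obp θ a) = chainKernel θ m (j + 1) a := by
  obtain ⟨Z, hZ0, hZ, h⟩ := exists_lintegral_obpWt_lvl hθ m (j + 1)
  have hprob := isProbabilityMeasure_chainKernel hθ m (j + 1) ha
  have hv := absVdm_pos ha.injective
  have hA0 : ENNReal.ofReal (absVdm a ^ (2 * θ - 1)) ≠ 0 :=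
    (ENNReal.ofReal_pos.2 (Real.rpow_pos_of_pos hv _)).ne'
  have hK0 : Z * ENNReal.ofReal (absVdm a ^ (2 * θ - 1)) ≠ 0 := mul_ne_zero hZ0 hA0
  have hK : Z * ENNReal.ofReal (absVdm a ^ (2 * θ - 1)) ≠ ∞ :=
    ENNReal.mul_ne_top hZ ENNReal.ofReal_ne_top
  have hwm := measurable_indicator_obpWt θ (M := m + (j + 1)) a
  have hdom : MeasurableSet (obpDomain a) := by
    refine MeasurableSet.congr (s := ⋂ k : Fin (m + (j + 1)), {x | Interlaces (x k)
      (lvl (N := m + (j + 1) + 1) a x (k.1 + 1) (by have := k.isLt; omega))}) ?_ ?_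
    · refine MeasurableSet.iInter fun k => ?_
      exact ((measurable_lvl a (k.1 + 1) (by have := k.isLt; omega)).prodMk
        (measurable_pi_apply k)) measurableSet_interlaces
    · ext x
      simp only [Set.mem_iInter]
      exact Iff.rfl
  have hmass : ENNReal.ofReal (∫ x in obpDomain a, obpWt θ a x) =
      Z * ENNReal.ofReal (absVdm a ^ (2 * θ - 1)) := by
    have h3 := h a ha (fun _ => 1) measurable_const
    simp only [mul_one, lintegral_const, measure_univ] at h3
    have h4 : ∫ x : Tri (m + (j + 1)), (obpDomain a).indicator (obpWt θ a) x = _ :=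
      integral_eq_lintegral_of_nonneg_ae
        (Eventually.of_forall fun x => indicator_obpWt_nonneg θ a x) hwm.aestronglyMeasurable
    rw [← integral_indicator hdom]
    refine (congrArg ENNReal.ofReal h4).trans ?_
    rw [h3]
    exact ENNReal.ofReal_toReal hK
  have hproj : levelProj (m + 1) h1 h2 =
      fun x : Tri (m + (j + 1)) => lvl (N := m + (j + 1) + 1) a x m (by omega) := by
    funext x
    rw [lvl, dif_pos (by omega)]
    rfl
  rw [hproj]
  have hlm := measurable_lvl (M := m + (j + 1)) a m (by omega)
  ext s hs
  rw [Measure.map_apply hlm hs, obp, hmass, Measure.smul_apply, smul_eq_mul,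
    withDensity_apply _ (hlm hs), ← lintegral_indicator (hlm hs)]
  have h4 := h a ha (s.indicator 1) (measurable_one.indicator hs)
  rw [lintegral_indicator_one hs] at h4
  have h5 : ∀ x : Tri (m + (j + 1)),
      ((fun x : Tri (m + (j + 1)) => lvl (N := m + (j + 1) + 1) a x m (by omega)) ⁻¹' s).indicator
        (fun x => ENNReal.ofReal ((obpDomain a).indicator (obpWt θ a) x)) x =
      ENNReal.ofReal ((obpDomain a).indicator (obpWt θ a) x) *
        s.indicator 1 (lvl (N := m + (j + 1) + 1) a x m (by omega)) := by
    intro x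
    by_cases hx : lvl (N := m + (j + 1) + 1) a x m (by omega) ∈ s
    · rw [Set.indicator_of_mem hx, Set.indicator_of_mem (by exact hx)]; simp
    · rw [Set.indicator_of_notMem hx, Set.indicator_of_notMem (by exact hx)]; simp
  refine (congrArg _ ((lintegral_congr h5).trans h4)).trans ?_
  rw [← mul_assoc, ENNReal.inv_mul_cancel hK0 hK, one_mul]

open Classical in
/-- The unnormalised density of the Gaussian beta ensemble on ordered tuples, with weight
`exp (-(s / 2) ∑ xᵢ²)`. -/
def gDens (θ s : ℝ) {n : ℕ} (x : Fin n → ℝ) : ℝ≥0∞ :=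
  if StrictAnti x then
    ENNReal.ofReal (absVdm x ^ (2 * θ) * Real.exp (-(s / 2) * ∑ i, x i ^ 2)) else 0

lemma measurable_gDens (θ s : ℝ) (n : ℕ) :
    Measurable fun x : Fin n → ℝ => gDens θ s x := by
  unfold gDens
  refine Measurable.ite (measurableSet_strictAnti n) ?_ measurable_const
  exact ((measurable_absVdm.pow_const _).mul (by fun_prop)).ennreal_ofReal

lemma ofReal_indicator_gbeWt {θ : ℝ} (hθ : 0 < θ) {n : ℕ} (x : Fin n → ℝ) :
    ENNReal.ofReal ((weylChamber n).indicator (gbeWt θ n) x) = gDens θ θ x := by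
  unfold gDens
  split_ifs with hx
  · rw [Set.indicator_of_mem (show x ∈ weylChamber n from fun i j hij => hx.antitone hij),
      gbeWt, ← absVdm_rpow]
  · by_cases hw : x ∈ weylChamber n
    · rw [Set.indicator_of_mem hw, gbeWt]
      have : ∃ i j, i < j ∧ x i = x j := by
        by_contra hcon
        push Not at hcon
        exact hx fun i j hij => lt_of_le_of_ne (hw i j hij.le) (hcon i j hij).symm
      obtain ⟨i, j, hij, he⟩ := this
      rw [Finset.prod_eq_zero (Finset.mem_univ i), zero_mul, ENNReal.ofReal_zero]
      refine Finset.prod_eq_zero (Finset.mem_univ j) ?_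
      rw [if_pos hij, he, sub_self, abs_zero, Real.zero_rpow (by positivity)]
    · rw [Set.indicator_of_notMem hw, ENNReal.ofReal_zero]

/-- The law of an independent Gaussian variable and gamma variables describing the passage from
level `n` to level `n + 1` of the Gaussian beta corners process. -/
def cornerNoise (θ s : ℝ) (n : ℕ) : Measure (Fin (n + 1) → ℝ) :=
  Measure.map (fun p : ℝ × (Fin n → ℝ) => (Fin.cons p.1 p.2 : Fin (n + 1) → ℝ))
    ((ProbabilityTheory.gaussianReal 0 (Real.toNNReal s⁻¹)).prod (gammaPi θ s n))

lemma isProbabilityMeasure_cornerNoise {θ s : ℝ} (hθ : 0 < θ) (hs : 0 < s) (n : ℕ) :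
    IsProbabilityMeasure (cornerNoise θ s n) := by
  have := isProbabilityMeasure_gammaPi hθ hs n
  exact Measure.isProbabilityMeasure_map measurable_finCons.aemeasurable

lemma measurableSet_pos_succ (n : ℕ) :
    MeasurableSet {z : Fin (n + 1) → ℝ | ∀ i : Fin n, 0 < z i.succ} := by
  simp only [Set.ofPred_forall]
  exact MeasurableSet.iInter fun i => measurableSet_lt measurable_const (measurable_pi_apply _)

lemma lintegral_cornerNoise {θ s : ℝ} (hθ : 0 < θ) (hs : 0 < s) {n : ℕ}
    {G : (Fin (n + 1) → ℝ) → ℝ≥0∞} (hG : Measurable G) :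
    ∫⁻ z, G z ∂(cornerNoise θ s n) =
      ∫⁻ z in {z | ∀ i : Fin n, 0 < z i.succ},
        ProbabilityTheory.gaussianPDF 0 (Real.toNNReal s⁻¹) (z 0) *
          (∏ i : Fin n, ProbabilityTheory.gammaPDF θ s (z i.succ)) * G z := by
  have := isProbabilityMeasure_gammaPi hθ hs n
  have hv : Real.toNNReal s⁻¹ ≠ 0 := by
    rw [Ne, Real.toNNReal_eq_zero, not_le]; positivity
  have hGc : Measurable fun p : ℝ × (Fin n → ℝ) => G (Fin.cons p.1 p.2) :=
    hG.comp measurable_finCons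
  have hm1 : Measurable fun x : Fin n → ℝ => ∏ i, ProbabilityTheory.gammaPDF θ s (x i) :=
    Finset.measurable_fun_prod _ fun i _ => (measurable_gammaPDF θ s).comp (measurable_pi_apply i)
  have hm : Measurable fun z : Fin (n + 1) → ℝ =>
      ProbabilityTheory.gaussianPDF 0 (Real.toNNReal s⁻¹) (z 0) *
          (∏ i : Fin n, ProbabilityTheory.gammaPDF θ s (z i.succ)) * G z :=
    (((ProbabilityTheory.measurable_gaussianPDF _ _).comp (measurable_pi_apply 0)).mul
      (hm1.comp measurable_finTail)).mul hG
  rw [cornerNoise, lintegral_map hG measurable_finCons, lintegral_prod _ hGc.aemeasurable,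
    ProbabilityTheory.gaussianReal_of_var_ne_zero _ hv,
    lintegral_withDensity_eq_lintegral_mul _ (ProbabilityTheory.measurable_gaussianPDF _ _)
      hGc.lintegral_prod_right', ← lintegral_indicator (measurableSet_pos_succ n),
    lintegral_volume_cons (hm.indicator (measurableSet_pos_succ n))]
  refine lintegral_congr fun t => ?_
  have hS : MeasurableSet {g : Fin n → ℝ | ∀ i, 0 < g i} := by
    simp only [Set.ofPred_forall]
    exact MeasurableSet.iInter fun i => measurableSet_lt measurable_const (measurable_pi_apply i)
  have hGt : Measurable fun q : Fin n → ℝ => G (Fin.cons t q) := hGc.comp measurable_prodMk_left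
  have hGt' : Measurable fun q : Fin n → ℝ =>
      (∏ i, ProbabilityTheory.gammaPDF θ s (q i)) * G (Fin.cons t q) := hm1.mul hGt
  rw [Pi.mul_apply, lintegral_gammaPi hθ hs hGt, ← lintegral_const_mul _ hGt',
    ← lintegral_indicator hS]
  refine lintegral_congr fun q => ?_
  by_cases hq : q ∈ {g : Fin n → ℝ | ∀ i, 0 < g i}
  · rw [Set.indicator_of_mem hq, Set.indicator_of_mem (by simpa using hq)]
    simp [mul_assoc]
  · rw [Set.indicator_of_notMem hq, Set.indicator_of_notMem (by simpa using hq)]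

/-- The ratio of consecutive partition functions of the Gaussian beta ensemble. -/
def cornerConst (θ s : ℝ) (n : ℕ) : ℝ :=
  (√(2 * Real.pi * s⁻¹))⁻¹ * (s ^ θ / Real.Gamma θ) ^ n *
    (Real.Gamma θ ^ (n + 1) / Real.Gamma ((n + 1 : ℕ) * θ))

lemma cornerConst_pos {θ s : ℝ} (hθ : 0 < θ) (hs : 0 < s) (n : ℕ) : 0 < cornerConst θ s n := by
  have := Real.Gamma_pos_of_pos hθ
  have : 0 < Real.Gamma ((n + 1 : ℕ) * θ) := Real.Gamma_pos_of_pos (by positivity)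
  have := Real.pi_pos
  unfold cornerConst
  positivity

open ProbabilityTheory in
lemma gDens_mul_cornerJac {θ s : ℝ} (hθ : 0 < θ) (hs : 0 < s) {n : ℕ} {u : Fin n → ℝ}
    {v : Fin (n + 1) → ℝ} (h : Interlaces u v) :
    gDens θ s u * (ENNReal.ofReal |(cornerJac u v).det| *
      (gaussianPDF 0 (Real.toNNReal s⁻¹) (cornerMap u v 0) *
        ∏ i : Fin n, gammaPDF θ s (cornerMap u v i.succ))) =
      ENNReal.ofReal (cornerConst θ s n) *
        (gDens θ s v * ENNReal.ofReal (dixonDens θ v u)) := by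
  have hG := Real.Gamma_pos_of_pos hθ
  have hG' : 0 < Real.Gamma ((n + 1 : ℕ) * θ) := Real.Gamma_pos_of_pos (by positivity)
  have hq : ∀ i, 0 < lowerWt u v i := h.lowerWt_pos
  have hv := absVdm_pos h.strictAnti_upper.injective
  have hu := absVdm_pos h.strictAnti_lower.injective
  have hc := h.crossProd_pos
  have hpi := Real.pi_pos
  have hK := cornerConst_pos hθ hs n
  have hD := dixonDens_nonneg hθ v u
  simp only [cornerMap, Fin.cons_zero, Fin.cons_succ, gammaPDF_of_nonneg (hq _).le, gaussianPDF]
  rw [gDens, if_pos h.strictAnti_lower, gDens, if_pos h.strictAnti_upper, abs_det_cornerJac h,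
    ← ENNReal.ofReal_prod_of_nonneg (fun i _ => by have := hq i; positivity),
    ← ENNReal.ofReal_mul (gaussianPDFReal_nonneg _ _ _), ← ENNReal.ofReal_mul (by positivity),
    ← ENNReal.ofReal_mul (by positivity), ← ENNReal.ofReal_mul (by positivity),
    ← ENNReal.ofReal_mul hK.le]
  congr 1
  rw [gaussianPDFReal, Real.coe_toNNReal _ (by positivity), Finset.prod_mul_distrib,
    Finset.prod_mul_distrib, ← Real.exp_sum, Finset.prod_const, Finset.card_univ,
    Fintype.card_fin, sum_sq_upper h.strictAnti_lower.injective v,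
    Real.finsetProd_rpow _ _ (fun i _ => (hq i).le),
    ← abs_of_pos (Finset.prod_pos fun i _ => hq i), prod_lowerWt_eq,
    Real.div_rpow hc.le (by positivity), dixonDens, if_pos h, cornerConst]
  have h3 : absVdm v ^ (1 - 2 * θ) = absVdm v * (absVdm v ^ (2 * θ))⁻¹ := by
    rw [← Real.rpow_neg hv.le, sub_eq_add_neg, Real.rpow_add hv, Real.rpow_one]
  have h4 : (absVdm u ^ 2) ^ (θ - 1) = absVdm u ^ (2 * θ) * (absVdm u ^ 2)⁻¹ := by
    rw [← Real.rpow_natCast, ← Real.rpow_mul hu.le, ← Real.rpow_neg hu.le, ← Real.rpow_add hu]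
    congr 1; push_cast; ring
  have h5 : Real.exp (-(s / 2) * (∑ i, u i ^ 2 + (∑ i, v i - ∑ i, u i) ^ 2 +
      2 * ∑ i, lowerWt u v i)) = Real.exp (-(s / 2) * ∑ i, u i ^ 2) *
      Real.exp (-(∑ i, v i - ∑ i, u i - 0) ^ 2 / (2 * s⁻¹)) *
      Real.exp (∑ i, -(s * lowerWt u v i)) := by
    rw [← Real.exp_add, ← Real.exp_add, Finset.sum_neg_distrib, ← Finset.mul_sum]
    congr 1; field_simp; ring
  rw [h3, h4, h5]
  have e1 := Real.exp_pos (-(s / 2) * ∑ i, u i ^ 2)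
  have e2 := Real.rpow_pos_of_pos hu (2 * θ)
  have e3 := Real.rpow_pos_of_pos hv (2 * θ)
  have e4 := Real.rpow_pos_of_pos hc (θ - 1)
  generalize Real.exp (-(s / 2) * ∑ i, u i ^ 2) = E1 at *
  generalize Real.exp (-(∑ i, v i - ∑ i, u i - 0) ^ 2 / (2 * s⁻¹)) = E2
  generalize Real.exp (∑ i, -(s * lowerWt u v i)) = E3
  generalize absVdm u ^ (2 * θ) = U at *
  generalize absVdm v ^ (2 * θ) = V at *
  generalize crossProd v u ^ (θ - 1) = Cc at *
  generalize √(2 * Real.pi * s⁻¹) = Q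
  field_simp

lemma measurable_cornerMap {n : ℕ} :
    Measurable fun p : (Fin n → ℝ) × (Fin (n + 1) → ℝ) => cornerMap p.1 p.2 := by
  unfold cornerMap
  refine (measurable_finCons (n := n)).comp (Measurable.prodMk (by fun_prop) ?_)
  exact measurable_pi_iff.2 fun i => measurable_lowerWt i

/-- The corner decomposition of the Gaussian beta ensemble of size `n + 1`. -/
lemma lintegral_gDens_cornerNoise {θ s : ℝ} (hθ : 0 < θ) (hs : 0 < s) {n : ℕ}
    {H : (Fin n → ℝ) × (Fin (n + 1) → ℝ) → ℝ≥0∞} (hH : Measurable H) :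
    ∫⁻ u, gDens θ s u * ∫⁻ z, H (u, z) ∂(cornerNoise θ s n) =
      ENNReal.ofReal (cornerConst θ s n) *
        ∫⁻ v, gDens θ s v * ∫⁻ u, H (u, cornerMap u v) ∂(dixonKernel θ n v) := by
  have hHc : Measurable fun p : (Fin n → ℝ) × (Fin (n + 1) → ℝ) => H (p.1, cornerMap p.1 p.2) :=
    hH.comp (measurable_fst.prodMk measurable_cornerMap)
  have hD : Measurable fun p : (Fin n → ℝ) × (Fin (n + 1) → ℝ) =>
      ENNReal.ofReal (dixonDens θ p.2 p.1) :=
    ((measurable_dixonDens θ n).comp measurable_swap).ennreal_ofReal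
  have hF : Measurable fun p : (Fin n → ℝ) × (Fin (n + 1) → ℝ) =>
      gDens θ s p.2 * (ENNReal.ofReal (dixonDens θ p.2 p.1) * H (p.1, cornerMap p.1 p.2)) :=
    ((measurable_gDens θ s (n + 1)).comp measurable_snd).mul (hD.mul hHc)
  have hR : ∀ v : Fin (n + 1) → ℝ,
      gDens θ s v * ∫⁻ u, H (u, cornerMap u v) ∂(dixonKernel θ n v) =
      ∫⁻ u, gDens θ s v * (ENNReal.ofReal (dixonDens θ v u) * H (u, cornerMap u v)) := by
    intro v
    have h1 : Measurable fun u => H (u, cornerMap u v) := hHc.comp measurable_prodMk_right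
    have h2 : Measurable fun u : Fin n → ℝ => ENNReal.ofReal (dixonDens θ v u) *
      H (u, cornerMap u v) := (measurable_dixonDens_right θ v).ennreal_ofReal.mul h1
    rw [lintegral_dixonKernel θ v h1, lintegral_const_mul _ h2]
  simp_rw [hR]
  have hF' : Measurable (Function.uncurry fun (v : Fin (n + 1) → ℝ) (u : Fin n → ℝ) =>
      gDens θ s v * (ENNReal.ofReal (dixonDens θ v u) * H (u, cornerMap u v))) :=
    hF.comp measurable_swap
  rw [lintegral_lintegral_swap hF'.aemeasurable,
    ← lintegral_const_mul _ hF.lintegral_prod_right']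
  refine lintegral_congr fun u => ?_
  have hFu : Measurable fun v : Fin (n + 1) → ℝ =>
      gDens θ s v * (ENNReal.ofReal (dixonDens θ v u) * H (u, cornerMap u v)) :=
    hF.comp measurable_prodMk_left
  by_cases hu : StrictAnti u
  swap
  · rw [gDens, if_neg hu, zero_mul]
    symm
    rw [mul_eq_zero]
    right
    rw [lintegral_eq_zero_iff hFu]
    refine Eventually.of_forall fun v => ?_
    have : ¬ Interlaces u v := fun h => hu h.strictAnti_lower
    simp [dixonDens, this]
  have hI : MeasurableSet {v | Interlaces u v} :=
    ((measurable_id.prodMk (measurable_const (a := u))) measurableSet_interlaces :)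
  have hHu : Measurable fun z => H (u, z) := hH.comp measurable_prodMk_left
  rw [lintegral_cornerNoise hθ hs hHu, ← cornerMap_image hu,
    lintegral_image_eq_lintegral_abs_det_fderiv_mul volume hI
      (fun v hv => (hasFDerivAt_cornerMap hv).hasFDerivWithinAt) (cornerMap_injOn hu.injective),
    ← lintegral_const_mul' _ _ (by rw [gDens, if_pos hu]; exact ENNReal.ofReal_ne_top),
    ← lintegral_const_mul' _ _ ENNReal.ofReal_ne_top, ← lintegral_indicator hI]
  refine lintegral_congr fun v => ?_
  by_cases h : v ∈ {v | Interlaces u v}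
  · have hdet : (Matrix.toLin' (cornerJac u v)).toContinuousLinearMap.det =
        (cornerJac u v).det := by
      rw [LinearMap.det_toContinuousLinearMap, LinearMap.det_toLin']
    rw [Set.indicator_of_mem h, hdet]
    have := gDens_mul_cornerJac hθ hs h
    rw [← mul_assoc (ENNReal.ofReal |_|), ← mul_assoc (gDens θ s u), this]
    ring
  · rw [Set.indicator_of_notMem h]
    have : ¬ Interlaces u v := h
    simp [dixonDens, this]

lemma ae_strictAnti_of_lintegral_gDens (θ s : ℝ) {n : ℕ} {G G' : (Fin n → ℝ) → ℝ≥0∞}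
    (h : ∀ x, StrictAnti x → G x = G' x) :
    ∫⁻ x, gDens θ s x * G x = ∫⁻ x, gDens θ s x * G' x := by
  refine lintegral_congr fun x => ?_
  by_cases hx : StrictAnti x
  · rw [h x hx]
  · simp [gDens, hx]

lemma lintegral_gDens_succ {θ s : ℝ} (hθ : 0 < θ) (hs : 0 < s) (n : ℕ) :
    ∫⁻ u : Fin n → ℝ, gDens θ s u = ENNReal.ofReal (cornerConst θ s n) *
      ∫⁻ v : Fin (n + 1) → ℝ, gDens θ s v := by
  have := isProbabilityMeasure_cornerNoise hθ hs n
  have h := lintegral_gDens_cornerNoise hθ hs (n := n) (H := fun _ => 1) measurable_const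
  rw [ae_strictAnti_of_lintegral_gDens θ s (G := fun v : Fin (n + 1) → ℝ =>
    ∫⁻ u : Fin n → ℝ, 1 ∂(dixonKernel θ n v)) (G' := fun _ => 1)] at h
  · simpa using h
  · intro v hv
    have := isProbabilityMeasure_dixonKernel hθ hv
    simp

lemma lintegral_gDens_ne {θ s : ℝ} (hθ : 0 < θ) (hs : 0 < s) (n : ℕ) :
    ∫⁻ u : Fin n → ℝ, gDens θ s u ≠ 0 ∧ ∫⁻ u : Fin n → ℝ, gDens θ s u ≠ ⊤ := by
  induction n with
  | zero =>
    have : ∀ u : Fin 0 → ℝ, gDens θ s u = 1 := fun u => by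
      have h : StrictAnti u := fun i => i.elim0
      simp [gDens, h, absVdm]
    simp [this, volume_pi]
  | succ n ih =>
    rw [lintegral_gDens_succ hθ hs] at ih
    have hK : ENNReal.ofReal (cornerConst θ s n) ≠ 0 := by
      rw [Ne, ENNReal.ofReal_eq_zero, not_le]; exact cornerConst_pos hθ hs n
    exact ⟨right_ne_zero_of_mul ih.1, fun h => ih.2 (by rw [h, ENNReal.mul_top hK])⟩

lemma gbe_eq {θ : ℝ} (hθ : 0 < θ) (n : ℕ) :
    gbe θ n = (∫⁻ x : Fin n → ℝ, gDens θ θ x)⁻¹ •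
      volume.withDensity fun x : Fin n → ℝ => gDens θ θ x := by
  have hW : MeasurableSet (weylChamber n) := by
    simp only [weylChamber, Set.ofPred_forall]
    refine MeasurableSet.iInter fun i => MeasurableSet.iInter fun j =>
      MeasurableSet.iInter fun _ => measurableSet_le (by fun_prop) (by fun_prop)
  have hm : Measurable (gbeWt θ n) := by
    have : gbeWt θ n = fun x => absVdm x ^ (2 * θ) * Real.exp (-(θ / 2) * ∑ i, x i ^ 2) := by
      ext x; rw [gbeWt, absVdm_rpow]
    rw [this]
    exact (measurable_absVdm.pow_const _).mul (by fun_prop)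
  have hnn : ∀ x, 0 ≤ (weylChamber n).indicator (gbeWt θ n) x := by
    refine fun x => Set.indicator_nonneg (fun x _ => ?_) x
    rw [gbeWt, ← absVdm_rpow]
    have := absVdm_nonneg x
    positivity
  rw [gbe]
  simp_rw [ofReal_indicator_gbeWt hθ]
  rw [← integral_indicator hW, integral_eq_lintegral_of_nonneg_ae (Eventually.of_forall hnn)
    (hm.indicator hW).aestronglyMeasurable]
  simp_rw [ofReal_indicator_gbeWt hθ]
  rw [ENNReal.ofReal_toReal (lintegral_gDens_ne hθ hθ n).2]

lemma lintegral_gbe {θ : ℝ} (hθ : 0 < θ) {n : ℕ} {G : (Fin n → ℝ) → ℝ≥0∞} (hG : Measurable G) :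
    ∫⁻ x, G x ∂(gbe θ n) =
      (∫⁻ x : Fin n → ℝ, gDens θ θ x)⁻¹ * ∫⁻ x, gDens θ θ x * G x := by
  rw [gbe_eq hθ, lintegral_smul_measure,
    lintegral_withDensity_eq_lintegral_mul _ (measurable_gDens θ θ n) hG]
  rfl

lemma isProbabilityMeasure_gbe {θ : ℝ} (hθ : 0 < θ) (n : ℕ) : IsProbabilityMeasure (gbe θ n) := by
  constructor
  have h := lintegral_gbe hθ (n := n) (G := fun _ => 1) measurable_const
  simp only [lintegral_const, one_mul, mul_one] at h
  rw [h, ENNReal.inv_mul_cancel (lintegral_gDens_ne hθ hθ n).1 (lintegral_gDens_ne hθ hθ n).2]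

lemma ae_strictAnti_gbe {θ : ℝ} (hθ : 0 < θ) (n : ℕ) : ∀ᵐ x ∂(gbe θ n), StrictAnti x := by
  rw [gbe_eq hθ]
  refine Measure.ae_smul_measure ?_ _
  rw [ae_withDensity_iff (measurable_gDens θ θ n)]
  refine Eventually.of_forall fun x hx => ?_
  by_contra h
  simp [gDens, h] at hx

lemma lintegral_gbe_corner {θ : ℝ} (hθ : 0 < θ) {n : ℕ}
    {H : (Fin n → ℝ) × (Fin (n + 1) → ℝ) → ℝ≥0∞} (hH : Measurable H) :
    ∫⁻ u, ∫⁻ z, H (u, z) ∂(cornerNoise θ θ n) ∂(gbe θ n) =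
      ∫⁻ v, ∫⁻ u, H (u, cornerMap u v) ∂(dixonKernel θ n v) ∂(gbe θ (n + 1)) := by
  have := isProbabilityMeasure_cornerNoise hθ hθ n
  have hHc : Measurable fun p : (Fin (n + 1) → ℝ) × (Fin n → ℝ) => H (p.2, cornerMap p.2 p.1) :=
    hH.comp (measurable_snd.prodMk (measurable_cornerMap.comp measurable_swap))
  have hK := cornerConst_pos hθ hθ n
  rw [lintegral_gbe hθ hH.lintegral_prod_right', lintegral_gbe hθ hHc.lintegral_kernel_prod_right',
    lintegral_gDens_cornerNoise hθ hθ hH, lintegral_gDens_succ hθ hθ,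
    ENNReal.mul_inv (Or.inr (lintegral_gDens_ne hθ hθ _).2) (Or.inl ENNReal.ofReal_ne_top),
    mul_comm _ (_⁻¹), mul_assoc, ← mul_assoc (ENNReal.ofReal _)⁻¹,
    ENNReal.inv_mul_cancel (by simpa using hK) ENNReal.ofReal_ne_top, one_mul]

open ProbabilityTheory in
lemma gbe_prod_cornerNoise {θ : ℝ} (hθ : 0 < θ) (n : ℕ) :
    (gbe θ n).prod (cornerNoise θ θ n) =
      Measure.map (fun p : (Fin (n + 1) → ℝ) × (Fin n → ℝ) => (p.2, cornerMap p.2 p.1))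
        (gbe θ (n + 1) ⊗ₘ dixonKernel θ n) := by
  have := isProbabilityMeasure_cornerNoise hθ hθ n
  have := isProbabilityMeasure_gbe hθ n
  have := isProbabilityMeasure_gbe hθ (n + 1)
  have hm : Measurable fun p : (Fin (n + 1) → ℝ) × (Fin n → ℝ) => (p.2, cornerMap p.2 p.1) :=
    measurable_snd.prodMk (measurable_cornerMap.comp measurable_swap)
  refine Measure.ext_of_lintegral _ fun H hH => ?_
  have hHm : Measurable fun p : (Fin (n + 1) → ℝ) × (Fin n → ℝ) => H (p.2, cornerMap p.2 p.1) :=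
    hH.comp hm
  rw [lintegral_prod _ hH.aemeasurable, lintegral_map hH hm,
    Measure.lintegral_compProd hHm, lintegral_gbe_corner hθ hH]

lemma lintegral_gbe_dixonKernel {θ : ℝ} (hθ : 0 < θ) {n : ℕ} {G : (Fin n → ℝ) → ℝ≥0∞}
    (hG : Measurable G) :
    ∫⁻ v, ∫⁻ u, G u ∂(dixonKernel θ n v) ∂(gbe θ (n + 1)) = ∫⁻ u, G u ∂(gbe θ n) := by
  have := isProbabilityMeasure_cornerNoise hθ hθ n
  have h := lintegral_gbe_corner hθ (H := fun p : (Fin n → ℝ) × (Fin (n + 1) → ℝ) => G p.1)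
    (hG.comp measurable_fst)
  simpa using h.symm

lemma lintegral_gbe_chainKernel {θ : ℝ} (hθ : 0 < θ) (m j : ℕ) {G : (Fin (m + 1) → ℝ) → ℝ≥0∞}
    (hG : Measurable G) :
    ∫⁻ a, ∫⁻ x, G x ∂(chainKernel θ m j a) ∂(gbe θ (m + j + 1)) = ∫⁻ x, G x ∂(gbe θ (m + 1)) := by
  induction j with
  | zero =>
    refine lintegral_congr fun a => ?_
    exact ProbabilityTheory.Kernel.lintegral_id' hG a
  | succ j ih =>
    rw [← ih, lintegral_congr fun a => lintegral_chainKernel_succ θ m j a hG]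
    exact lintegral_gbe_dixonKernel hθ hG.lintegral_kernel

lemma gbe_eq_bind_chainKernel {θ : ℝ} (hθ : 0 < θ) (m j : ℕ) :
    gbe θ (m + 1) = (gbe θ (m + j + 1)).bind (chainKernel θ m j) := by
  refine Measure.ext_of_lintegral _ fun G hG => ?_
  rw [Measure.lintegral_bind (chainKernel θ m j).aemeasurable hG.aemeasurable,
    lintegral_gbe_chainKernel hθ m j hG]

lemma integral_gbe_chainKernel {θ : ℝ} (hθ : 0 < θ) (m j : ℕ) {F : (Fin (m + 1) → ℝ) → ℝ}
    (hF : Integrable F (gbe θ (m + 1))) :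
    ∫ x, F x ∂(gbe θ (m + 1)) = ∫ a, ∫ x, F x ∂(chainKernel θ m j a) ∂(gbe θ (m + j + 1)) := by
  have h := gbe_eq_bind_chainKernel hθ m j
  rw [h, Measure.comp_eq_comp_const_apply] at hF ⊢
  rw [ProbabilityTheory.Kernel.integral_comp hF, ProbabilityTheory.Kernel.const_apply]

/-- Functions growing more slowly than every Gaussian. -/
def SubGauss {n : ℕ} (F : (Fin n → ℝ) → ℝ) : Prop :=
  ∀ ε > 0, ∃ C, ∀ x, |F x| ≤ C * Real.exp (ε * ∑ i, x i ^ 2)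

namespace SubGauss
variable {n : ℕ} {F G : (Fin n → ℝ) → ℝ}

lemma const (c : ℝ) : SubGauss fun _ : Fin n → ℝ => c := fun ε hε => ⟨|c|, fun x =>
  le_mul_of_one_le_right (abs_nonneg c) (Real.one_le_exp
    (mul_nonneg hε.le (Finset.sum_nonneg fun _ _ => sq_nonneg _)))⟩

lemma add (hF : SubGauss F) (hG : SubGauss G) : SubGauss fun x => F x + G x := by
  intro ε hε
  obtain ⟨C, hC⟩ := hF ε hε
  obtain ⟨C', hC'⟩ := hG ε hε
  refine ⟨C + C', fun x => (abs_add_le _ _).trans ?_⟩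
  rw [add_mul]
  exact add_le_add (hC x) (hC' x)

lemma mul (hF : SubGauss F) (hG : SubGauss G) : SubGauss fun x => F x * G x := by
  intro ε hε
  obtain ⟨C, hC⟩ := hF (ε / 2) (by positivity)
  obtain ⟨C', hC'⟩ := hG (ε / 2) (by positivity)
  refine ⟨C * C', fun x => ?_⟩
  rw [abs_mul]
  refine (mul_le_mul (hC x) (hC' x) (abs_nonneg _) ((abs_nonneg _).trans (hC x))).trans_eq ?_
  rw [mul_mul_mul_comm, ← Real.exp_add]
  congr 2; ring

lemma sum {α : Type*} (s : Finset α) {F : α → (Fin n → ℝ) → ℝ} (h : ∀ i ∈ s, SubGauss (F i)) :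
    SubGauss fun x => ∑ i ∈ s, F i x := by
  classical
  induction s using Finset.induction_on with
  | empty => simpa using const 0
  | insert a s ha ih =>
    simp only [Finset.sum_insert ha]
    exact (h a (Finset.mem_insert_self a s)).add
      (ih fun i hi => h i (Finset.mem_insert_of_mem hi))

lemma mono (hF : SubGauss F) (h : ∀ x, |G x| ≤ |F x|) : SubGauss G := fun ε hε =>
  (hF ε hε).imp fun _ hC x => (h x).trans (hC x)

lemma exp_abs (c : ℝ) (i : Fin n) : SubGauss fun x => Real.exp (c * |x i|) := by
  intro ε hε
  refine ⟨Real.exp (c ^ 2 / (4 * ε)), fun x => ?_⟩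
  rw [Real.abs_exp, ← Real.exp_add, Real.exp_le_exp]
  have h1 : x i ^ 2 ≤ ∑ i, x i ^ 2 :=
    Finset.single_le_sum (f := fun i => x i ^ 2) (fun _ _ => sq_nonneg _) (Finset.mem_univ i)
  have h2 : c * |x i| ≤ c ^ 2 / (4 * ε) + ε * x i ^ 2 := by
    rw [← sq_abs (x i), ← sub_nonneg]
    have : c ^ 2 / (4 * ε) + ε * |x i| ^ 2 - c * |x i| = (c - 2 * ε * |x i|) ^ 2 / (4 * ε) := by
      field_simp; ring
    rw [this]; positivity
  nlinarith

lemma eval (i : Fin n) : SubGauss fun x => x i := by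
  refine (exp_abs 1 i).mono fun x => ?_
  rw [Real.abs_exp, one_mul]
  linarith [Real.add_one_le_exp |x i|]

lemma pow (hF : SubGauss F) (k : ℕ) : SubGauss fun x => F x ^ k := by
  induction k with
  | zero => simpa using const 1
  | succ k ih => simpa only [pow_succ] using ih.mul hF

lemma powerSum (k : ℕ) : SubGauss fun x : Fin n → ℝ => powerSum k x := by
  unfold _root_.powerSum
  exact sum _ fun i _ => (eval i).pow k

lemma sgnEsymm (k : ℕ) : SubGauss fun x : Fin n → ℝ => sgnEsymm k x := by
  induction k using Nat.strong_induction_on with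
  | _ k ih =>
    cases k with
    | zero => simpa using const 1
    | succ k =>
      have h : ∀ x : Fin n → ℝ, _root_.sgnEsymm (k + 1) x = (-((k : ℝ) + 1)⁻¹) *
          ∑ j ∈ Finset.range (k + 1), _root_.powerSum (j + 1) x * _root_.sgnEsymm (k - j) x := by
        intro x
        have := sgnEsymm_newton k x
        have hk : (k : ℝ) + 1 ≠ 0 := by positivity
        field_simp
        linarith
      simp only [h]
      exact (const _).mul (sum _ fun j _ => (powerSum (j + 1)).mul (ih (k - j) (by omega)))

lemma sgnProd (κ : List ℕ) : SubGauss fun x : Fin n → ℝ => sgnProd κ x := by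
  induction κ with
  | nil => simpa using const 1
  | cons k κ ih => simpa only [sgnProd_cons] using (sgnEsymm k).mul ih

lemma integrable {θ : ℝ} (hθ : 0 < θ) (hF : SubGauss F) (hc : Continuous F) :
    Integrable F (gbe θ n) := by
  obtain ⟨C, hC⟩ := hF (θ / 4) (by positivity)
  have hm : Measurable fun x : Fin n → ℝ => ENNReal.ofReal (Real.exp (θ / 4 * ∑ i, x i ^ 2)) := by
    fun_prop
  have hE : Integrable (fun x : Fin n → ℝ => Real.exp (θ / 4 * ∑ i, x i ^ 2)) (gbe θ n) := by
    refine ⟨Continuous.aestronglyMeasurable (by fun_prop), ?_⟩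
    rw [hasFiniteIntegral_iff_ofReal (Eventually.of_forall fun x => (Real.exp_pos _).le),
      lintegral_gbe hθ hm]
    have h : ∀ x : Fin n → ℝ, gDens θ θ x * ENNReal.ofReal (Real.exp (θ / 4 * ∑ i, x i ^ 2)) =
        gDens θ (θ / 2) x := by
      intro x
      unfold gDens
      split_ifs with hx
      · have := absVdm_nonneg x
        rw [← ENNReal.ofReal_mul (by positivity), mul_assoc, ← Real.exp_add]
        congr 3; ring
      · simp
    simp_rw [h]
    exact ENNReal.mul_lt_top (ENNReal.inv_lt_top.2 (pos_iff_ne_zero.2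
      (lintegral_gDens_ne hθ hθ n).1)) (lintegral_gDens_ne hθ (by positivity) n).2.lt_top
  exact (hE.const_mul C).mono' hc.aestronglyMeasurable (Eventually.of_forall hC)

end SubGauss

/-- The moments of a centred Gaussian variable of variance `s⁻¹`. -/
def gaussMoment (s : ℝ) (a : ℕ) : ℝ :=
  ∫ t, t ^ a ∂(ProbabilityTheory.gaussianReal 0 (Real.toNNReal s⁻¹))

lemma gaussMoment_zero (s : ℝ) : gaussMoment s 0 = 1 := by simp [gaussMoment]

lemma gaussMoment_one (s : ℝ) : gaussMoment s 1 = 0 := by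
  simp [gaussMoment, ProbabilityTheory.integral_id_gaussianReal]

lemma integrable_pow_gaussianReal (v : NNReal) (a : ℕ) :
    Integrable (fun t : ℝ => t ^ a) (ProbabilityTheory.gaussianReal 0 v) := by
  rcases Nat.eq_zero_or_pos a with rfl | ha
  · simp
  · have h := (ProbabilityTheory.memLp_id_gaussianReal (μ := 0) (v := v) a).integrable_norm_pow
      ha.ne'
    refine h.mono' (by fun_prop) (Eventually.of_forall fun t => ?_)
    simp

/-- The mixed monomials in the Gaussian variable and in weighted sums of the gamma variables. -/
def noiseMono {n : ℕ} (a : ℕ) (J : List ℕ) (u : Fin n → ℝ) (z : Fin (n + 1) → ℝ) : ℝ :=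
  z 0 ^ a * (J.map fun j => ∑ i : Fin n, u i ^ j * z i.succ).prod

/-- The signed elementary symmetric function of the upper level, in terms of the lower level and
the corner coordinates. -/
def cornerEsymm {n : ℕ} (k : ℕ) (u : Fin n → ℝ) (z : Fin (n + 1) → ℝ) : ℝ :=
  sgnEsymm k u - (if 1 ≤ k then z 0 * sgnEsymm (k - 1) u else 0) -
    ∑ j ∈ Finset.range (k - 1), (∑ i : Fin n, u i ^ j * z i.succ) * sgnEsymm (k - 2 - j) u

/-- Products of the functions `cornerEsymm`. -/
def cornerProd {n : ℕ} (κ : List ℕ) (u : Fin n → ℝ) (z : Fin (n + 1) → ℝ) : ℝ :=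
  (κ.map fun k => cornerEsymm k u z).prod

lemma cornerProd_cons {n : ℕ} (k : ℕ) (κ : List ℕ) (u : Fin n → ℝ) (z : Fin (n + 1) → ℝ) :
    cornerProd (k :: κ) u z = cornerEsymm k u z * cornerProd κ u z := by simp [cornerProd]

lemma Interlaces.cornerProd_cornerMap {n : ℕ} {u : Fin n → ℝ} {v : Fin (n + 1) → ℝ}
    (h : Interlaces u v) (κ : List ℕ) : cornerProd κ u (cornerMap u v) = sgnProd κ v := by
  unfold cornerProd sgnProd
  congr 1
  refine List.map_congr_left fun k _ => ?_
  rw [sgnEsymm_upper h.strictAnti_lower.injective v k]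
  simp [cornerEsymm, cornerMap]

lemma continuous_cornerProd {n : ℕ} (κ : List ℕ) :
    Continuous fun p : (Fin n → ℝ) × (Fin (n + 1) → ℝ) => cornerProd κ p.1 p.2 := by
  induction κ with
  | nil => simpa [cornerProd] using continuous_const
  | cons k κ ih =>
    simp only [cornerProd_cons]
    refine Continuous.mul ?_ ih
    have hs : ∀ k, Continuous fun p : (Fin n → ℝ) × (Fin (n + 1) → ℝ) => sgnEsymm k p.1 :=
      fun k => (continuous_sgnEsymm k).comp continuous_fst
    unfold cornerEsymm
    refine ((hs k).sub ?_).sub (continuous_finsetSum _ fun j _ =>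
      Continuous.mul (by fun_prop) (hs _))
    split_ifs
    · exact Continuous.mul (by fun_prop) (hs _)
    · exact continuous_const

lemma noiseMono_integral {θ : ℝ} (hθ : 0 < θ) {n : ℕ} (a : ℕ) (J : List ℕ) (u : Fin n → ℝ) :
    Integrable (noiseMono a J u) (cornerNoise θ θ n) ∧
      ∫ z, noiseMono a J u z ∂(cornerNoise θ θ n) = gaussMoment θ a * gammaMoment θ θ J u := by
  have := isProbabilityMeasure_gammaPi hθ hθ n
  have hc : Continuous (noiseMono a J u) := by
    unfold noiseMono
    refine Continuous.mul (by fun_prop) ?_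
    induction J with
    | nil => simpa using continuous_const
    | cons j J ih =>
      simp only [List.map_cons, List.prod_cons]
      exact Continuous.mul (by fun_prop) ih
  have heq : ∀ p : ℝ × (Fin n → ℝ), noiseMono a J u (Fin.cons p.1 p.2) =
      p.1 ^ a * (J.map fun j => ∑ i : Fin n, u i ^ j * p.2 i).prod := fun p => by
    simp [noiseMono]
  constructor
  · rw [cornerNoise, integrable_map_measure hc.aestronglyMeasurable
      measurable_finCons.aemeasurable]
    simp only [Function.comp_def, heq]
    exact (integrable_pow_gaussianReal _ a).mul_prod (integrable_gammaMoment hθ hθ J u)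
  · rw [cornerNoise, integral_map measurable_finCons.aemeasurable hc.aestronglyMeasurable]
    simp only [heq]
    exact integral_prod_mul (fun t : ℝ => t ^ a)
      fun g : Fin n → ℝ => (J.map fun j => ∑ i : Fin n, u i ^ j * g i).prod

lemma cornerMoment_integral {θ : ℝ} (hθ : 0 < θ) {n : ℕ} (κ : List ℕ) (u : Fin n → ℝ) (a : ℕ)
    (J : List ℕ) :
    Integrable (fun z => noiseMono a J u z * cornerProd κ u z) (cornerNoise θ θ n) ∧
      ∫ z, noiseMono a J u z * cornerProd κ u z ∂(cornerNoise θ θ n) =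
        cornerMoment θ (gaussMoment θ) a J κ u := by
  induction κ generalizing a J with
  | nil => simpa [cornerProd, cornerMoment] using noiseMono_integral hθ a J u
  | cons k κ ih =>
    have heq : ∀ z, noiseMono a J u z * cornerProd (k :: κ) u z =
        sgnEsymm k u * (noiseMono a J u z * cornerProd κ u z) -
        (if 1 ≤ k then sgnEsymm (k - 1) u * (noiseMono (a + 1) J u z * cornerProd κ u z) else 0) -
        ∑ j ∈ Finset.range (k - 1),
          sgnEsymm (k - 2 - j) u * (noiseMono a (j :: J) u z * cornerProd κ u z) := by
      intro z
      have hj : ∀ j, noiseMono a (j :: J) u z =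
          (∑ i : Fin n, u i ^ j * z i.succ) * noiseMono a J u z := fun j => by
        simp only [noiseMono, List.map_cons, List.prod_cons]; ring
      have h1 : noiseMono (a + 1) J u z = z 0 * noiseMono a J u z := by
        simp only [noiseMono]; ring
      simp only [hj, h1]
      rw [cornerProd_cons, cornerEsymm, sub_mul, sub_mul, mul_sub, mul_sub, Finset.sum_mul,
        Finset.mul_sum]
      congr 1
      · congr 1
        · ring
        · split_ifs <;> ring
      · exact Finset.sum_congr rfl fun j _ => by ring
    have i1 := (ih a J).1.const_mul (sgnEsymm k u)
    have i2 : Integrable (fun z => if 1 ≤ k then sgnEsymm (k - 1) u *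
        (noiseMono (a + 1) J u z * cornerProd κ u z) else 0) (cornerNoise θ θ n) := by
      split_ifs
      · exact (ih (a + 1) J).1.const_mul _
      · simp
    have i3 : ∀ j ∈ Finset.range (k - 1), Integrable (fun z => sgnEsymm (k - 2 - j) u *
        (noiseMono a (j :: J) u z * cornerProd κ u z)) (cornerNoise θ θ n) :=
      fun j _ => (ih a (j :: J)).1.const_mul _
    have i12 : Integrable (fun z => sgnEsymm k u * (noiseMono a J u z * cornerProd κ u z) -
        (if 1 ≤ k then sgnEsymm (k - 1) u * (noiseMono (a + 1) J u z * cornerProd κ u z) else 0))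
        (cornerNoise θ θ n) := i1.sub i2
    have i3' := integrable_finsetSum _ i3
    simp only [heq]
    refine ⟨i12.sub i3', ?_⟩
    rw [integral_sub i12 i3', integral_sub i1 i2, integral_finsetSum _ i3, cornerMoment]
    congr 1
    · congr 1
      · rw [integral_const_mul, (ih a J).2]
      · split_ifs
        · rw [integral_const_mul, (ih (a + 1) J).2]
        · simp
    · exact Finset.sum_congr rfl fun j _ => by rw [integral_const_mul, (ih a (j :: J)).2]

open ProbabilityTheory in
/-- The one-step recursion for the moments of the Gaussian beta ensemble. -/
lemma integral_sgnProd_gbe_succ {θ : ℝ} (hθ : 0 < θ) (n : ℕ) (κ : List ℕ) :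
    ∫ v, sgnProd κ v ∂(gbe θ (n + 1)) =
      ∫ u, cornerMoment θ (gaussMoment θ) 0 [] κ u ∂(gbe θ n) := by
  have := isProbabilityMeasure_cornerNoise hθ hθ n
  have := isProbabilityMeasure_gbe hθ n
  have := isProbabilityMeasure_gbe hθ (n + 1)
  have hm : Measurable fun p : (Fin (n + 1) → ℝ) × (Fin n → ℝ) => (p.2, cornerMap p.2 p.1) :=
    measurable_snd.prodMk (measurable_cornerMap.comp measurable_swap)
  have hcp := continuous_cornerProd (n := n) κ
  have hintg : Integrable (fun p : (Fin (n + 1) → ℝ) × (Fin n → ℝ) => sgnProd κ p.1)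
      (gbe θ (n + 1) ⊗ₘ dixonKernel θ n) := by
    have hc : Continuous fun p : (Fin (n + 1) → ℝ) × (Fin n → ℝ) => sgnProd κ p.1 :=
      (continuous_sgnProd κ).comp continuous_fst
    rw [Measure.integrable_compProd_iff hc.aestronglyMeasurable]
    have hae := ae_strictAnti_gbe hθ (n + 1)
    constructor
    · filter_upwards [hae] with v hv
      have := isProbabilityMeasure_dixonKernel hθ hv
      exact integrable_const _
    · refine ((SubGauss.sgnProd κ).integrable hθ (continuous_sgnProd κ)).norm.congr ?_
      filter_upwards [hae] with v hv
      have := isProbabilityMeasure_dixonKernel hθ hv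
      simp
  have hae : (fun p : (Fin (n + 1) → ℝ) × (Fin n → ℝ) => sgnProd κ p.1)
      =ᵐ[gbe θ (n + 1) ⊗ₘ dixonKernel θ n]
      fun p => cornerProd κ p.2 (cornerMap p.2 p.1) := by
    have hI : ∀ᵐ p ∂(gbe θ (n + 1) ⊗ₘ dixonKernel θ n), Interlaces p.2 p.1 :=
      Measure.ae_compProd_of_ae_ae measurableSet_interlaces
        (Eventually.of_forall fun v => ae_interlaces_dixonKernel θ v)
    filter_upwards [hI] with p hp
    exact (hp.cornerProd_cornerMap κ).symm
  have hint2 : Integrable (fun p : (Fin n → ℝ) × (Fin (n + 1) → ℝ) => cornerProd κ p.1 p.2)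
      ((gbe θ n).prod (cornerNoise θ θ n)) := by
    rw [gbe_prod_cornerNoise hθ, integrable_map_measure hcp.aestronglyMeasurable hm.aemeasurable]
    exact hintg.congr hae
  calc ∫ v, sgnProd κ v ∂(gbe θ (n + 1))
      = ∫ p, sgnProd κ p.1 ∂(gbe θ (n + 1) ⊗ₘ dixonKernel θ n) := by
        rw [Measure.integral_compProd hintg]
        refine integral_congr_ae ?_
        filter_upwards [ae_strictAnti_gbe hθ (n + 1)] with v hv
        have := isProbabilityMeasure_dixonKernel hθ hv
        simp
    _ = ∫ p, cornerProd κ p.1 p.2 ∂((gbe θ n).prod (cornerNoise θ θ n)) := by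
        rw [integral_congr_ae hae, gbe_prod_cornerNoise hθ,
          integral_map hm.aemeasurable hcp.aestronglyMeasurable]
    _ = _ := by
        rw [integral_prod _ hint2]
        refine integral_congr_ae (Eventually.of_forall fun u => ?_)
        simpa [noiseMono] using (cornerMoment_integral hθ κ u 0 []).2

lemma tendsto_pow_succ_sub_pow_div (d : ℕ) :
    Tendsto (fun n : ℕ => (((n : ℝ) + 1) ^ (d + 1) - (n : ℝ) ^ (d + 1)) / (n : ℝ) ^ d) atTop
      (𝓝 (d + 1)) := by
  induction d with
  | zero => simp
  | succ d ih =>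
    have h1 : Tendsto (fun n : ℕ => 1 + 1 / (n : ℝ)) atTop (𝓝 (1 + 0)) :=
      tendsto_const_nhds.add tendsto_one_div_atTop_nhds_zero_nat
    have h := (h1.mul ih).add_const 1
    refine (h.congr' ?_).trans_eq (by push_cast; ring_nf)
    filter_upwards [eventually_gt_atTop 0] with n hn
    have hn' : (n : ℝ) ≠ 0 := by positivity
    field_simp
    ring

/-- A Stolz–Cesàro theorem for powers. -/
lemma tendsto_div_pow_of_tendsto_sub {B : ℕ → ℝ} {d : ℕ} {L : ℝ}
    (h : Tendsto (fun n : ℕ => (B (n + 1) - B n) / (n : ℝ) ^ d) atTop (𝓝 ((d + 1) * L))) :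
    Tendsto (fun n : ℕ => B n / (n : ℝ) ^ (d + 1)) atTop (𝓝 L) := by
  set g : ℕ → ℝ := fun n => ((n : ℝ) + 1) ^ (d + 1) - (n : ℝ) ^ (d + 1) with hg
  have hgpow : ∀ n : ℕ, (n : ℝ) ^ d ≤ g n := by
    intro n
    have hle : (n : ℝ) ^ d ≤ ((n : ℝ) + 1) ^ d := by gcongr; linarith
    have hn : (0 : ℝ) ≤ n := n.cast_nonneg
    simp only [hg, pow_succ]
    nlinarith [mul_le_mul_of_nonneg_right hle hn]
  have hg0 : 0 ≤ g := fun n => (by positivity : (0 : ℝ) ≤ (n : ℝ) ^ d).trans (hgpow n)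
  have hsum : ∀ n, ∑ i ∈ Finset.range n, g i = (n : ℝ) ^ (d + 1) := by
    intro n
    have := Finset.sum_range_sub (fun i : ℕ => (i : ℝ) ^ (d + 1)) n
    simpa [hg] using this
  have hf : (fun n => B (n + 1) - B n - L * g n) =o[atTop] g := by
    have h1 : (fun n => B (n + 1) - B n - L * g n) =o[atTop] fun n : ℕ => (n : ℝ) ^ d := by
      rw [Asymptotics.isLittleO_iff_tendsto']
      · have h2 := h.sub ((tendsto_pow_succ_sub_pow_div d).const_mul L)
        rw [show (d + 1) * L - L * (d + 1) = 0 by ring] at h2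
        refine h2.congr fun n => ?_
        simp only [hg]; ring
      · filter_upwards [eventually_gt_atTop 0] with n hn h0
        have : (0 : ℝ) < (n : ℝ) ^ d := by positivity
        exact absurd h0 this.ne'
    refine h1.trans_isBigO (Asymptotics.IsBigO.of_bound 1 (Eventually.of_forall fun n => ?_))
    rw [Real.norm_of_nonneg (by positivity), Real.norm_of_nonneg (hg0 n), one_mul]
    exact hgpow n
  have hpow : Tendsto (fun n : ℕ => (n : ℝ) ^ (d + 1)) atTop atTop :=
    (tendsto_pow_atTop (by omega)).comp tendsto_natCast_atTop_atTop
  have hS := hf.sum_range hg0 (by simpa only [hsum] using hpow)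
  have hS2 : ∀ n, ∑ i ∈ Finset.range n, (B (i + 1) - B i - L * g i) =
      B n - B 0 - L * (n : ℝ) ^ (d + 1) := by
    intro n
    rw [Finset.sum_sub_distrib, Finset.sum_range_sub, ← Finset.mul_sum, hsum]
  simp only [hsum, hS2] at hS
  have hS' := hS.tendsto_div_nhds_zero
  have h0 : Tendsto (fun n : ℕ => B 0 / (n : ℝ) ^ (d + 1)) atTop (𝓝 0) :=
    hpow.const_div_atTop _
  have h := (hS'.add h0).add_const L
  rw [zero_add, zero_add] at h
  refine h.congr' ?_
  filter_upwards [eventually_gt_atTop 0] with n hn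
  have hn' : (n : ℝ) ≠ 0 := by positivity
  field_simp
  ring

/-- The limits of the normalised signed elementary symmetric functions. -/
def sigmaLim : ℕ → ℝ
  | 0 => 1
  | 1 => 0
  | k + 2 => -sigmaLim k / (k + 2)

/-- Products of the limits `sigmaLim`. -/
def sigmaProd (κ : List ℕ) : ℝ := (κ.map sigmaLim).prod

/-- The lists appearing in `cornerMain`. -/
def cornerMainList : List ℕ → List (List ℕ)
  | [] => []
  | k :: κ => (cornerMainList κ).map (k :: ·) ++ if 2 ≤ k then [(k - 2) :: κ] else []

lemma cornerMain_eq {n : ℕ} (κ : List ℕ) (x : Fin n → ℝ) :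
    cornerMain κ x = ((cornerMainList κ).map (sgnProd · x)).sum := by
  induction κ with
  | nil => simp [cornerMain, cornerMainList]
  | cons k κ ih =>
    have h : ∀ l : List (List ℕ), (l.map ((sgnProd · x) ∘ (k :: ·))).sum =
        sgnEsymm k x * (l.map (sgnProd · x)).sum := by
      intro l
      induction l with
      | nil => simp
      | cons a l ih => simp [ih, mul_add]
    rw [cornerMain, cornerMainList, List.map_append, List.sum_append, List.map_map, h, ih]
    split_ifs <;> simp

lemma sum_sigmaProd_cornerMainList (κ : List ℕ) :
    ((cornerMainList κ).map sigmaProd).sum = -(κ.sum * sigmaProd κ) := by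
  induction κ with
  | nil => simp [cornerMainList]
  | cons k κ ih =>
    have h : ∀ l : List (List ℕ), (l.map (sigmaProd ∘ (k :: ·))).sum =
        sigmaLim k * (l.map sigmaProd).sum := by
      intro l
      induction l with
      | nil => simp
      | cons a l ih => simp [ih, mul_add, sigmaProd]
    rw [cornerMainList, List.map_append, List.sum_append, List.map_map, h, ih]
    rw [List.sum_cons, Nat.cast_add, show sigmaProd (k :: κ) = sigmaLim k * sigmaProd κ by
      simp [sigmaProd]]
    generalize hS : ((κ.sum : ℕ) : ℝ) = S
    match k with
    | 0 => simp [sigmaLim]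
    | 1 => simp [sigmaLim]
    | k + 2 =>
      have hk : (k : ℝ) + 2 ≠ 0 := by positivity
      simp [sigmaProd, sigmaLim]
      field_simp
      ring

lemma sum_of_mem_cornerMainList {κ κ' : List ℕ} (h : κ' ∈ cornerMainList κ) :
    κ'.sum + 2 = κ.sum := by
  induction κ generalizing κ' with
  | nil => simp [cornerMainList] at h
  | cons k κ ih =>
    rw [cornerMainList, List.mem_append] at h
    rcases h with h | h
    · obtain ⟨l, hl, rfl⟩ := List.mem_map.1 h
      have := ih hl
      simp; omega
    · split_ifs at h with hk
      · simp at h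
        subst h
        simp; omega
      · simp at h

/-- The moments of the Gaussian beta ensemble. -/
def gbeMoment (θ : ℝ) (κ : List ℕ) (n : ℕ) : ℝ := ∫ x, sgnProd κ x ∂(gbe θ n)

lemma integrable_sgnProd_gbe {θ : ℝ} (hθ : 0 < θ) (κ : List ℕ) (n : ℕ) :
    Integrable (fun x => sgnProd κ x) (gbe θ n) :=
  (SubGauss.sgnProd κ).integrable hθ (continuous_sgnProd κ)

lemma integral_cornerMain_gbe {θ : ℝ} (hθ : 0 < θ) (κ : List ℕ) (n : ℕ) :
    Integrable (fun x => cornerMain κ x) (gbe θ n) ∧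
    ∫ x, cornerMain κ x ∂(gbe θ n) = ((cornerMainList κ).map (gbeMoment θ · n)).sum := by
  simp only [cornerMain_eq]
  generalize cornerMainList κ = l
  induction l with
  | nil => simp
  | cons a l ih =>
    simp only [List.map_cons, List.sum_cons]
    refine ⟨(integrable_sgnProd_gbe hθ a n).add ih.1, ?_⟩
    rw [integral_add (integrable_sgnProd_gbe hθ a n) ih.1, ih.2, gbeMoment]

lemma SymRep.integral_gbe {θ : ℝ} (hθ : 0 < θ) {n : ℕ} {D : ℤ} {B M : ℝ} {F : (Fin n → ℝ) → ℝ}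
    (hF : SymRep n D B F) (hM : ∀ κ : List ℕ, 0 ∉ κ → (κ.sum : ℤ) ≤ D →
      |gbeMoment θ κ n| ≤ M * (n : ℝ) ^ κ.sum) (hM0 : 0 ≤ M) :
    Integrable F (gbe θ n) ∧ |∫ x, F x ∂(gbe θ n)| ≤ M * B := by
  obtain ⟨ι, _, c, κ, h1, h2, h3⟩ := hF
  have hi : ∀ i ∈ Finset.univ, Integrable (fun x => c i * _root_.sgnProd (κ i) x) (gbe θ n) :=
    fun i _ => (integrable_sgnProd_gbe hθ (κ i) n).const_mul _
  rw [show F = fun x => ∑ i, c i * _root_.sgnProd (κ i) x from funext h3]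
  refine ⟨integrable_finsetSum _ hi, ?_⟩
  rw [integral_finsetSum _ hi]
  refine (Finset.abs_sum_le_sum_abs _ _).trans (le_trans ?_ (mul_le_mul_of_nonneg_left h2 hM0))
  rw [Finset.mul_sum]
  refine Finset.sum_le_sum fun i _ => ?_
  rw [integral_const_mul, abs_mul]
  have := mul_le_mul_of_nonneg_left (hM (κ i) (h1 i).1 (h1 i).2) (abs_nonneg (c i))
  rw [gbeMoment] at this
  linarith

lemma exists_forall_abs_le_mul_pow {A : ℕ → ℝ} {d : ℕ} {L : ℝ}
    (h : Tendsto (fun n : ℕ => A n / (n : ℝ) ^ d) atTop (𝓝 L)) :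
    ∃ M, 0 ≤ M ∧ ∀ n : ℕ, 1 ≤ n → |A n| ≤ M * (n : ℝ) ^ d := by
  obtain ⟨M, hM⟩ := h.abs.bddAbove_range
  refine ⟨M, (abs_nonneg _).trans (hM ⟨0, rfl⟩), fun n hn => ?_⟩
  have h1 := hM ⟨n, rfl⟩
  have hn' : (0 : ℝ) < (n : ℝ) ^ d := by positivity
  simp only [abs_div, abs_of_pos hn'] at h1
  rwa [div_le_iff₀ hn'] at h1

lemma exists_forall_posList_abs_le {A : List ℕ → ℕ → ℝ} {D : ℤ}
    (h : ∀ κ : List ℕ, (κ.sum : ℤ) ≤ D →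
      ∃ L, Tendsto (fun n : ℕ => A κ n / (n : ℝ) ^ κ.sum) atTop (𝓝 L)) :
    ∃ M, 0 ≤ M ∧ ∀ κ : List ℕ, 0 ∉ κ → (κ.sum : ℤ) ≤ D → ∀ n : ℕ, 1 ≤ n →
      |A κ n| ≤ M * (n : ℝ) ^ κ.sum := by
  have hb : ∀ κ : List ℕ, ∃ M, 0 ≤ M ∧ ((κ.sum : ℤ) ≤ D → ∀ n : ℕ, 1 ≤ n →
      |A κ n| ≤ M * (n : ℝ) ^ κ.sum) := by
    intro κ
    by_cases hκ : (κ.sum : ℤ) ≤ D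
    · obtain ⟨L, hL⟩ := h κ hκ
      obtain ⟨M, h0, hM⟩ := exists_forall_abs_le_mul_pow hL
      exact ⟨M, h0, fun _ => hM⟩
    · exact ⟨0, le_rfl, fun h => absurd h hκ⟩
  choose M hM0 hM using hb
  have hfin := finite_setOf_posList D
  refine ⟨∑ κ ∈ hfin.toFinset, M κ, Finset.sum_nonneg fun κ _ => hM0 κ, fun κ h0 hD n hn => ?_⟩
  refine (hM κ hD n hn).trans (mul_le_mul_of_nonneg_right ?_ (by positivity))
  exact Finset.single_le_sum (f := M) (fun κ _ => hM0 κ) (hfin.mem_toFinset.2 ⟨h0, hD⟩)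

lemma tendsto_list_map_sum {α : Type*} {l : List α} {f : α → ℕ → ℝ} {L : α → ℝ}
    (h : ∀ a ∈ l, Tendsto (f a) atTop (𝓝 (L a))) :
    Tendsto (fun n => (l.map (f · n)).sum) atTop (𝓝 (l.map L).sum) := by
  induction l with
  | nil => simp
  | cons a l ih =>
    simp only [List.map_cons, List.sum_cons]
    exact (h a (by simp)).add (ih fun b hb => h b (by simp [hb]))

/-- The asymptotics of the moments of the Gaussian beta ensemble. -/
lemma tendsto_gbeMoment {θ : ℝ} (hθ : 0 < θ) (κ : List ℕ) :
    Tendsto (fun n : ℕ => gbeMoment θ κ n / (n : ℝ) ^ κ.sum) atTop (𝓝 (sigmaProd κ)) := by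
  induction hd : κ.sum using Nat.strong_induction_on generalizing κ with
  | _ d ih =>
  cases d with
  | zero =>
    have hz : ∀ k ∈ κ, k = 0 := List.sum_eq_zero_iff.1 hd
    have h1 : ∀ n, gbeMoment θ κ n = 1 := by
      intro n
      have := isProbabilityMeasure_gbe hθ n
      have : ∀ x : Fin n → ℝ, sgnProd κ x = 1 := fun x =>
        List.prod_eq_one (by simp only [List.mem_map]; rintro _ ⟨k, hk, rfl⟩; simp [hz k hk])
      simp [gbeMoment, this]
    have h2 : sigmaProd κ = 1 :=
      List.prod_eq_one (by simp only [List.mem_map]; rintro _ ⟨k, hk, rfl⟩; simp [hz k hk, sigmaLim])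
    simp [h1, h2]
  | succ d =>
    obtain ⟨C, hC⟩ := symFam_cornerMoment_nil hθ (gaussMoment_zero θ) (gaussMoment_one θ) κ
    obtain ⟨M, hM0, hM⟩ := exists_forall_posList_abs_le (A := gbeMoment θ) (D := κ.sum - 2)
      (fun κ' hκ' => ⟨_, ih κ'.sum (by omega) κ' rfl⟩)
    refine tendsto_div_pow_of_tendsto_sub ?_
    have hrec : ∀ n : ℕ, 1 ≤ n → |gbeMoment θ κ (n + 1) - gbeMoment θ κ n +
        n * ((cornerMainList κ).map (gbeMoment θ · n)).sum| ≤
        M * (C * (n : ℝ) ^ (κ.sum - 2 : ℤ)) := by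
      intro n hn
      obtain ⟨hi, hb⟩ := (hC n hn).integral_gbe hθ (fun κ' h0 hD => hM κ' h0 hD n hn) hM0
      obtain ⟨hm, hme⟩ := integral_cornerMain_gbe hθ κ n
      have hs := integrable_sgnProd_gbe hθ κ n
      have hcm : Integrable (fun x => cornerMoment θ (gaussMoment θ) 0 [] κ x) (gbe θ n) := by
        refine ((hi.sub (hm.const_mul (n : ℝ))).add hs).congr (Eventually.of_forall fun x => ?_)
        simp
      rw [← hme, gbeMoment, integral_sgnProd_gbe_succ hθ, gbeMoment]
      have hsub : Integrable (fun x => cornerMoment θ (gaussMoment θ) 0 [] κ x - sgnProd κ x)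
          (gbe θ n) := hcm.sub hs
      rw [integral_add hsub (hm.const_mul _), integral_sub hcm hs,
        integral_const_mul] at hb
      exact hb
    have hmain : Tendsto (fun n : ℕ => n * ((cornerMainList κ).map (gbeMoment θ · n)).sum /
        (n : ℝ) ^ d) atTop (𝓝 (-((d + 1) * sigmaProd κ))) := by
      have h1 := tendsto_list_map_sum (l := cornerMainList κ)
        (f := fun κ' n => gbeMoment θ κ' n / (n : ℝ) ^ κ'.sum) (L := sigmaProd) fun κ' hκ' =>
          ih κ'.sum (by have := sum_of_mem_cornerMainList hκ'; omega) κ' rfl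
      rw [sum_sigmaProd_cornerMainList, hd] at h1
      push_cast at h1
      refine h1.congr' ?_
      filter_upwards [eventually_gt_atTop 0] with n hn
      have hn' : (n : ℝ) ≠ 0 := by positivity
      rw [mul_div_right_comm, ← List.sum_map_mul_left]
      congr 1
      refine List.map_congr_left fun κ' hκ' => ?_
      have := sum_of_mem_cornerMainList hκ'
      obtain rfl : d = κ'.sum + 1 := by omega
      field_simp
      ring
    have hrem : Tendsto (fun n : ℕ => (gbeMoment θ κ (n + 1) - gbeMoment θ κ n +
        n * ((cornerMainList κ).map (gbeMoment θ · n)).sum) / (n : ℝ) ^ d) atTop (𝓝 0) := by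
      refine squeeze_zero_norm' (a := fun n : ℕ => M * C * (1 / (n : ℝ))) ?_ ?_
      · filter_upwards [eventually_ge_atTop 1] with n hn
        have hn' : (0 : ℝ) < n := by positivity
        rw [norm_div, Real.norm_eq_abs, Real.norm_of_nonneg (by positivity),
          div_le_iff₀ (by positivity)]
        refine (hrec n hn).trans_eq ?_
        rw [hd, show ((d + 1 : ℕ) - 2 : ℤ) = (d : ℤ) - 1 by push_cast; ring,
          zpow_sub₀ hn'.ne', zpow_natCast, zpow_one]
        ring
      · simpa using tendsto_one_div_atTop_nhds_zero_nat.const_mul (M * C)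
    have := hrem.sub hmain
    rw [zero_sub, neg_neg] at this
    refine this.congr fun n => ?_
    ring

lemma tendsto_sgnEsymm_div_pow {x : (N : ℕ) → Fin N → ℝ}
    (hx : ∀ j : ℕ, Tendsto (fun N : ℕ => powerSum (j + 1) (x N) / (N : ℝ) ^ (j + 1)) atTop
      (𝓝 (if j = 1 then 1 else 0))) (k : ℕ) :
    Tendsto (fun N : ℕ => sgnEsymm k (x N) / (N : ℝ) ^ k) atTop (𝓝 (sigmaLim k)) := by
  induction k using Nat.strong_induction_on with
  | _ k ih =>
  cases k with
  | zero => simp [sigmaLim]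
  | succ k =>
    have h1 : Tendsto (fun N : ℕ => -(∑ j ∈ Finset.range (k + 1),
        powerSum (j + 1) (x N) / (N : ℝ) ^ (j + 1) * (sgnEsymm (k - j) (x N) / (N : ℝ) ^ (k - j))) /
        (k + 1)) atTop
        (𝓝 (-(∑ j ∈ Finset.range (k + 1), (if j = 1 then 1 else 0) * sigmaLim (k - j)) / (k + 1))) :=
      (tendsto_finsetSum _ fun j _ => (hx j).mul (ih (k - j) (by omega))).neg.div_const _
    have h2 : -(∑ j ∈ Finset.range (k + 1), (if j = 1 then 1 else 0) * sigmaLim (k - j)) /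
        ((k : ℝ) + 1) = sigmaLim (k + 1) := by
      cases k with
      | zero => simp [sigmaLim]
      | succ k =>
        simp only [ite_mul, one_mul, zero_mul, Finset.sum_ite_eq', Finset.mem_range]
        rw [if_pos (by omega), sigmaLim]
        push_cast
        congr 1
        ring
    rw [← h2]
    refine h1.congr fun N => ?_
    have hk : (k : ℝ) + 1 ≠ 0 := by positivity
    rw [div_eq_iff hk, div_mul_eq_mul_div, mul_comm (sgnEsymm _ _), sgnEsymm_newton, neg_div,
      Finset.sum_div]
    congr 1
    refine Finset.sum_congr rfl fun j hj => ?_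
    have hj' : k + 1 = (j + 1) + (k - j) := by have := Finset.mem_range.1 hj; omega
    rw [div_mul_div_comm, ← pow_add, ← hj']

lemma tendsto_sgnProd_div_pow {x : (N : ℕ) → Fin N → ℝ}
    (hx : ∀ j : ℕ, Tendsto (fun N : ℕ => powerSum (j + 1) (x N) / (N : ℝ) ^ (j + 1)) atTop
      (𝓝 (if j = 1 then 1 else 0))) (κ : List ℕ) :
    Tendsto (fun N : ℕ => sgnProd κ (x N) / (N : ℝ) ^ κ.sum) atTop (𝓝 (sigmaProd κ)) := by
  induction κ with
  | nil => simp [sigmaProd]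
  | cons k κ ih =>
    have h := (tendsto_sgnEsymm_div_pow hx k).mul ih
    rw [show sigmaProd (k :: κ) = sigmaLim k * sigmaProd κ by simp [sigmaProd]]
    refine h.congr fun N => ?_
    rw [div_mul_div_comm, ← pow_add, sgnProd_cons, List.sum_cons]

/-- Convergence of symmetric moments along the chain of levels. -/
lemma tendsto_integral_chainKernel {θ : ℝ} (hθ : 0 < θ) {m : ℕ} {D : ℤ} {B : ℝ}
    {F : (Fin (m + 1) → ℝ) → ℝ} (hF : SymRep (m + 1) D B F)
    {a : (j : ℕ) → Fin (m + j + 1) → ℝ} {b c : ℕ → ℝ} (ha : ∀ j, StrictAnti (a j))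
    (hb : ∀ j, b j ≠ 0)
    (hs : ∀ κ : List ℕ, Tendsto (fun j : ℕ => sgnProd κ (affVec (b j) (c j) (a j)) /
      ((m + j + 1 : ℕ) : ℝ) ^ κ.sum) atTop (𝓝 (sigmaProd κ))) :
    Tendsto (fun j => ∫ x, F (affVec (b j) (c j) x) ∂(chainKernel θ m j (a j))) atTop
      (𝓝 (∫ x, F x ∂(gbe θ (m + 1)))) := by
  have hFi : Integrable F (gbe θ (m + 1)) := by
    obtain ⟨ι, _, c, κ, h1, h2, h3⟩ := hF
    rw [show F = fun x => ∑ i, c i * sgnProd (κ i) x from funext h3]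
    exact integrable_finsetSum _ fun i _ => (integrable_sgnProd_gbe hθ (κ i) _).const_mul _
  obtain ⟨B', hB'⟩ := exists_symRep_chainKernel hθ D hF
  choose F' hF' hintg using hB'
  have hg : ∀ j, ∫ x, F x ∂(gbe θ (m + 1)) = ∫ x, F' j x ∂(gbe θ (m + j + 1)) := by
    intro j
    rw [integral_gbe_chainKernel hθ m j hFi]
    refine integral_congr_ae ?_
    filter_upwards [ae_strictAnti_gbe hθ (m + j + 1)] with u hu
    have hid : ∀ {n : ℕ} (x : Fin n → ℝ), affVec 1 0 x = x := fun x => by ext; simp [affVec]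
    simpa only [hid] using hintg j 1 0 one_ne_zero u hu
  have hNs : Tendsto (fun j : ℕ => m + j + 1) atTop atTop :=
    tendsto_atTop_mono (fun j => by simp only [id]; omega) tendsto_id
  have hfin := finite_setOf_posList D
  set δ : ℕ → ℝ := fun j => ∑ κ ∈ hfin.toFinset,
    |sgnProd κ (affVec (b j) (c j) (a j)) / ((m + j + 1 : ℕ) : ℝ) ^ κ.sum -
      gbeMoment θ κ (m + j + 1) / ((m + j + 1 : ℕ) : ℝ) ^ κ.sum| with hδ
  have hδ0 : Tendsto δ atTop (𝓝 0) := by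
    have : Tendsto δ atTop (𝓝 (∑ κ ∈ hfin.toFinset, |sigmaProd κ - sigmaProd κ|)) :=
      tendsto_finsetSum _ fun κ _ => ((hs κ).sub ((tendsto_gbeMoment hθ κ).comp hNs)).abs
    simpa using this
  rw [tendsto_iff_norm_sub_tendsto_zero]
  refine squeeze_zero (fun _ => norm_nonneg _) (g := fun j => B' * δ j) (fun j => ?_)
    (by simpa using hδ0.const_mul B')
  rw [hintg j _ _ (hb j) _ (ha j), hg j, Real.norm_eq_abs]
  have hδj : 0 ≤ δ j := Finset.sum_nonneg fun _ _ => abs_nonneg _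
  obtain ⟨ι, _, e, κ, h1, h2, h3⟩ := hF' j
  have hi : ∀ i ∈ Finset.univ, Integrable (fun x => e i * sgnProd (κ i) x) (gbe θ (m + j + 1)) :=
    fun i _ => (integrable_sgnProd_gbe hθ (κ i) _).const_mul _
  simp only [h3]
  rw [integral_finsetSum _ hi, ← Finset.sum_sub_distrib]
  refine (Finset.abs_sum_le_sum_abs _ _).trans (le_trans ?_ (mul_le_mul_of_nonneg_right h2 hδj))
  rw [Finset.sum_mul]
  refine Finset.sum_le_sum fun i _ => ?_
  rw [integral_const_mul, ← mul_sub, abs_mul, mul_assoc]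
  refine mul_le_mul_of_nonneg_left ?_ (abs_nonneg _)
  have hN : (0 : ℝ) < ((m + j + 1 : ℕ) : ℝ) ^ (κ i).sum := by positivity
  have hle := Finset.single_le_sum (f := fun κ => |sgnProd κ (affVec (b j) (c j) (a j)) /
    ((m + j + 1 : ℕ) : ℝ) ^ κ.sum - gbeMoment θ κ (m + j + 1) / ((m + j + 1 : ℕ) : ℝ) ^ κ.sum|)
    (fun _ _ => abs_nonneg _) (hfin.mem_toFinset.2 (h1 i))
  refine le_trans (le_of_eq ?_) (mul_le_mul_of_nonneg_left hle hN.le)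
  rw [← sub_div, abs_div, abs_of_pos hN, mul_div_cancel₀ _ hN.ne', gbeMoment]

lemma integral_empMeasure {N : ℕ} (a : Fin N → ℝ) (g : ℝ → ℝ) :
    ∫ t, g t ∂(empMeasure a) = (∑ i, g (a i / N)) / N := by
  rw [empMeasure, integral_smul_measure, integral_finsetSum_measure]
  · simp [div_eq_inv_mul]
  · intro i _
    exact integrable_dirac (by simp)

lemma RegularSeq.exists_bound {a : (N : ℕ) → Fin N → ℝ} {μ : Measure ℝ} (h : RegularSeq a μ) :
    ∃ C, 0 ≤ C ∧ ∀ N i, |a N i| ≤ C * N := by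
  obtain ⟨h1, ⟨C, hC⟩, -⟩ := h
  have hbd : ∀ N i, |a N i| ≤ C * N := by
    intro N i
    have hN : 1 ≤ N := by have := i.isLt; omega
    obtain ⟨h2, h3⟩ := hC N hN
    have ha := (h1 N hN).antitone
    have h4 := ha (show (⟨0, by omega⟩ : Fin N) ≤ i from Nat.zero_le _)
    have h5 := ha (show i ≤ (⟨N - 1, by omega⟩ : Fin N) from by
      change i.1 ≤ N - 1
      omega)
    rw [abs_le] at *
    constructor <;> linarith
  exact ⟨C, by simpa using (abs_nonneg _).trans (hbd 1 0), hbd⟩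

lemma RegularSeq.tendsto_integral {a : (N : ℕ) → Fin N → ℝ} {μ : Measure ℝ} (h : RegularSeq a μ)
    {g : ℝ → ℝ} (hg : Continuous g) :
    Tendsto (fun N => ∫ t, g t ∂(empMeasure (a N))) atTop (𝓝 (∫ t, g t ∂μ)) := by
  obtain ⟨C, hC0, hC⟩ := h.exists_bound
  obtain ⟨-, -, -, ⟨R, hR⟩, hw⟩ := h
  set S := max C R
  have hS0 : 0 ≤ S := hC0.trans (le_max_left _ _)
  have hcl : ∀ t, |t| ≤ S → max (-S) (min S t) = t := by
    intro t ht
    rw [abs_le] at ht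
    rw [min_eq_right ht.2, max_eq_right ht.1]
  obtain ⟨K, hK⟩ := (isCompact_Icc (a := -S) (b := S)).exists_bound_of_continuousOn hg.continuousOn
  let f : BoundedContinuousFunction ℝ ℝ := BoundedContinuousFunction.ofNormedAddCommGroup
    (fun t => g (max (-S) (min S t))) (by fun_prop) K
    (fun t => hK _ ⟨le_max_left _ _, max_le (by linarith) (min_le_left _ _)⟩)
  have hf := hw f
  have e1 : ∫ t, f t ∂μ = ∫ t, g t ∂μ := by
    refine integral_congr_ae ?_
    have : ∀ᵐ t ∂μ, |t| ≤ R := by rw [ae_iff]; exact hR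
    filter_upwards [this] with t ht
    exact congrArg g (hcl t (ht.trans (le_max_right _ _)))
  rw [e1] at hf
  refine hf.congr fun N => ?_
  rw [integral_empMeasure, integral_empMeasure]
  congr 1
  refine Finset.sum_congr rfl fun i _ => congrArg g (hcl _ ?_)
  have hN : (0 : ℝ) < N := by have := i.isLt; exact_mod_cast (by omega : 0 < N)
  rw [abs_div, abs_of_pos hN, div_le_iff₀ hN]
  exact (hC N i).trans (mul_le_mul_of_nonneg_right (le_max_left _ _) hN.le)

/-- The centred and rescaled top level. -/
def normVec (v : ℝ) {N : ℕ} (a : Fin N → ℝ) : Fin N → ℝ :=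
  affVec (1 / √(N * v)) (-(N * meanM (empMeasure a)) / √(N * v)) a

lemma RegularSeq.tendsto_powerSum {a : (N : ℕ) → Fin N → ℝ} {μ : Measure ℝ} (h : RegularSeq a μ)
    (hv : 0 < varM μ) (j : ℕ) :
    Tendsto (fun N : ℕ => powerSum (j + 1) (normVec (varM μ) (a N)) / (N : ℝ) ^ (j + 1)) atTop
      (𝓝 (if j = 1 then 1 else 0)) := by
  set v := varM μ with hvdef
  have hn : ∀ N i, normVec v (a N) i = (a N i - N * meanM (empMeasure (a N))) / √(N * v) := by
    intro N i
    simp only [normVec, affVec]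
    ring
  have hmean : ∀ N : ℕ, 0 < N → ∑ i, a N i = N * (N * meanM (empMeasure (a N))) := by
    intro N hN
    have hN' : (N : ℝ) ≠ 0 := by positivity
    rw [meanM, integral_empMeasure, ← Finset.sum_div]
    field_simp
  rcases Nat.lt_trichotomy j 1 with hj | rfl | hj
  · obtain rfl : j = 0 := by omega
    refine Tendsto.congr' ?_ tendsto_const_nhds
    filter_upwards [eventually_gt_atTop 0] with N hN
    simp only [powerSum, zero_add, pow_one, hn, ← Finset.sum_div, Finset.sum_sub_distrib, hmean N hN]
    simp
  · have h2 := h.tendsto_integral (g := fun t => t ^ 2) (by fun_prop)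
    have h1 := h.tendsto_integral (g := fun t => t) (by fun_prop)
    have h3 := (h2.sub (h1.pow 2)).div_const v
    rw [show (∫ t, t ^ 2 ∂μ) - (∫ t, t ∂μ) ^ 2 = v from rfl, div_self hv.ne'] at h3
    simp only [if_true]
    refine h3.congr' ?_
    filter_upwards [eventually_gt_atTop 0] with N hN
    have hN' : (0 : ℝ) < N := by positivity
    have hs : ∑ i, a N i ^ 2 = N ^ 3 * ∫ t, t ^ 2 ∂(empMeasure (a N)) := by
      rw [integral_empMeasure]
      simp only [div_pow]
      rw [← Finset.sum_div]
      field_simp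
    have hsq : √(N * v) ^ 2 = N * v := Real.sq_sqrt (by positivity)
    change _ = powerSum 2 _ / (N : ℝ) ^ 2
    simp only [powerSum, hn, div_pow, hsq, ← Finset.sum_div, sub_sq, Finset.sum_sub_distrib,
      Finset.sum_add_distrib, hs, mul_assoc, ← Finset.mul_sum, ← Finset.sum_mul]
    rw [hmean N hN, ← meanM]
    simp only [Finset.sum_const, Finset.card_univ, Fintype.card_fin, nsmul_eq_mul]
    field_simp
    ring
  · rw [if_neg (by omega)]
    obtain ⟨C, hC0, hC⟩ := h.exists_bound
    set K := 2 * C / √v with hK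
    have hsv : 0 < √v := Real.sqrt_pos.2 hv
    have hbound : ∀ N : ℕ, 0 < N → ∀ i, |normVec v (a N) i| ≤ K * √N := by
      intro N hN i
      have hN' : (0 : ℝ) < N := by positivity
      have hsN : 0 < √(N : ℝ) := Real.sqrt_pos.2 hN'
      have hM : |N * meanM (empMeasure (a N))| ≤ C * N := by
        have h1 : N * meanM (empMeasure (a N)) = (∑ i, a N i) / N := by
          rw [hmean N hN]; field_simp
        rw [h1, abs_div, abs_of_pos hN', div_le_iff₀ hN']
        refine (Finset.abs_sum_le_sum_abs _ _).trans ((Finset.sum_le_sum fun i _ => hC N i).trans ?_)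
        simp only [Finset.sum_const, Finset.card_univ, Fintype.card_fin, nsmul_eq_mul]
        linarith
      rw [hn, Real.sqrt_mul hN'.le, abs_div, abs_of_pos (mul_pos hsN hsv), div_le_iff₀ (by positivity)]
      have e : K * √N * (√N * √v) = 2 * C * N := by
        rw [hK]
        field_simp
        rw [Real.sq_sqrt hN'.le]
      rw [e]
      refine (abs_sub _ _).trans ?_
      linarith [hC N i]
    have hlim : Tendsto (fun N : ℕ => K ^ (j + 1) * (1 / √(N : ℝ))) atTop (𝓝 0) := by
      have : Tendsto (fun N : ℕ => 1 / √(N : ℝ)) atTop (𝓝 0) :=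
        (Real.tendsto_sqrt_atTop.comp tendsto_natCast_atTop_atTop).const_div_atTop 1
      simpa using this.const_mul (K ^ (j + 1))
    refine squeeze_zero_norm' ?_ hlim
    filter_upwards [eventually_gt_atTop 0] with N hN
    have hN' : (0 : ℝ) < N := by positivity
    have hs1 : 1 ≤ √(N : ℝ) := Real.one_le_sqrt.2 (by exact_mod_cast hN)
    rw [norm_div, Real.norm_eq_abs, Real.norm_of_nonneg (by positivity), div_le_iff₀ (by positivity)]
    have hK0 : 0 ≤ K := by positivity
    have h1 : |powerSum (j + 1) (normVec v (a N))| ≤ N * (K * √N) ^ (j + 1) := by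
      refine (Finset.abs_sum_le_sum_abs _ _).trans ?_
      refine (Finset.sum_le_sum (g := fun _ => (K * √N) ^ (j + 1)) fun i _ => ?_).trans (by simp)
      rw [abs_pow]
      exact pow_le_pow_left₀ (abs_nonneg _) (hbound N hN i) _
    refine h1.trans ?_
    generalize hsd : √(N : ℝ) = s at *
    have hNs : (N : ℝ) = s ^ 2 := by rw [← hsd, Real.sq_sqrt hN'.le]
    obtain ⟨i, rfl⟩ : ∃ i, j = i + 2 := ⟨j - 2, by omega⟩
    rw [hNs, mul_pow]
    have hs0 : 0 < s := by linarith
    have e : K ^ (i + 2 + 1) * (1 / s) * (s ^ 2) ^ (i + 2 + 1) =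
        s ^ 2 * (K ^ (i + 2 + 1) * s ^ (i + 2 + 1)) * s ^ i := by
      field_simp
      ring
    rw [e]
    exact le_mul_of_one_le_right (by positivity) (one_le_pow₀ hs1)

open Polynomial in
lemma sgnEsymm_eq_eval_esymm {n : ℕ} (k : ℕ) (x : Fin n → ℝ) :
    sgnEsymm k x = (-1) ^ k * MvPolynomial.eval x (MvPolynomial.esymm (Fin n) ℝ k) := by
  have h : genPoly Finset.univ x = ∑ t ∈ (Finset.univ : Finset (Fin n)).powerset,
      C (∏ i ∈ t, -x i) * X ^ t.card := by
    simp only [genPoly, sub_eq_add_neg]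
    rw [Finset.prod_one_add]
    refine Finset.sum_congr rfl fun t _ => ?_
    rw [map_prod, ← Finset.prod_const, ← Finset.prod_mul_distrib]
    exact Finset.prod_congr rfl fun i _ => by simp
  rw [sgnEsymm, h, finsetSum_coeff, MvPolynomial.esymm, map_sum, Finset.mul_sum,
    Finset.powersetCard_eq_filter, Finset.sum_filter]
  refine Finset.sum_congr rfl fun t _ => ?_
  rw [coeff_C_mul_X_pow]
  by_cases htk : t.card = k
  · rw [if_pos htk, if_pos htk.symm, Finset.prod_neg, htk, map_prod]
    simp
  · rw [if_neg htk, if_neg (Ne.symm htk)]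

lemma exists_symRep_of_isSymmetric {n : ℕ} {p : MvPolynomial (Fin n) ℝ} (hp : p.IsSymmetric) :
    ∃ D B, SymRep n D B (fun x => MvPolynomial.eval x p) := by
  obtain ⟨q, hq⟩ := MvPolynomial.esymmAlgHom_surjective (σ := Fin n) (R := ℝ) (n := n) (by simp)
    ⟨p, hp⟩
  have hpq : p = MvPolynomial.aeval (fun i : Fin n => MvPolynomial.esymm (Fin n) ℝ (i + 1)) q := by
    rw [← MvPolynomial.esymmAlgHom_apply, hq]
  rw [hpq]
  clear hpq hq hp
  induction q using MvPolynomial.induction_on with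
  | C c => exact ⟨0, |c|, by simpa using SymRep.const (n := n) c⟩
  | add q r hq hr =>
    obtain ⟨D, B, h⟩ := hq
    obtain ⟨D', B', h'⟩ := hr
    exact ⟨max D D', B + B', by
      simpa using (h.weaken (le_max_left _ D') le_rfl).add (h'.weaken (le_max_right D _) le_rfl)⟩
  | mul_X q i hq =>
    obtain ⟨D, B, h⟩ := hq
    have he := (SymRep.sgnEsymm (n := n) (i + 1)).smul ((-1) ^ (i.1 + 1))
    simp only [sgnEsymm_eq_eval_esymm, ← mul_assoc, ← mul_pow] at he
    exact ⟨_, _, by simpa using h.mul he⟩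

lemma exists_symRep_sum_perm_pow {n : ℕ} (t : Fin n → ℝ) (k : ℕ) :
    ∃ D B, SymRep n D B
      (fun x => ∑ σ : Equiv.Perm (Fin n), (∑ i, t i * x (σ i)) ^ k) := by
  let p : MvPolynomial (Fin n) ℝ := ∑ σ : Equiv.Perm (Fin n),
    MvPolynomial.rename σ ((∑ i, MvPolynomial.C (t i) * MvPolynomial.X i) ^ k)
  have hp : p.IsSymmetric := by
    intro τ
    simp only [p, map_sum, MvPolynomial.rename_rename]
    refine Fintype.sum_equiv (Equiv.mulLeft τ) _ _ fun σ => ?_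
    rfl
  obtain ⟨D, B, h⟩ := exists_symRep_of_isSymmetric hp
  refine ⟨D, B, ?_⟩
  simpa [p] using h

lemma norm_exp_sub_sum_range_le {c : ℂ} (hc : c.re = 0) (hc1 : ‖c‖ = 1) (K : ℕ) {y : ℝ}
    (hy : 0 ≤ y) :
    ‖Complex.exp (c * y) - ∑ k ∈ Finset.range K, (c * y) ^ k / (k.factorial : ℂ)‖ ≤
      y ^ K / K.factorial := by
  induction K generalizing y with
  | zero => simp [Complex.norm_exp, hc]
  | succ K ih =>
    set f : ℝ → ℂ := fun y =>
      Complex.exp (c * y) - ∑ k ∈ Finset.range (K + 1), (c * y) ^ k / (k.factorial : ℂ) with hf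
    have hlin : ∀ y : ℝ, HasDerivAt (fun y : ℝ => c * (y : ℂ)) c y := fun y => by
      simpa using (Complex.ofRealCLM.hasDerivAt (x := y)).const_mul c
    have hd : ∀ y : ℝ, HasDerivAt f (c * (Complex.exp (c * y) -
        ∑ k ∈ Finset.range K, (c * y) ^ k / (k.factorial : ℂ))) y := by
      intro y
      have h1 := (hlin y).cexp
      have h2 : ∀ k ∈ Finset.range K, HasDerivAt
          (fun y : ℝ => (c * (y : ℂ)) ^ (k + 1) / ((k + 1).factorial : ℂ))
          (c * ((c * y) ^ k / (k.factorial : ℂ))) y := by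
        intro k _
        refine (((hlin y).pow (k + 1)).div_const _).congr_deriv ?_
        have h3 : (k.factorial : ℂ) ≠ 0 := by exact_mod_cast k.factorial_ne_zero
        have h4 : (k : ℂ) + 1 ≠ 0 := by exact_mod_cast k.succ_ne_zero
        rw [Nat.factorial_succ]
        push_cast
        field_simp
      have h3 := (HasDerivAt.fun_sum h2).add_const (1 : ℂ)
      have h4 := h1.sub h3
      rw [← Finset.mul_sum] at h4
      refine (h4.congr_deriv (by ring)).congr_of_eventuallyEq (Eventually.of_forall fun z => ?_)
      simp only [hf, Finset.sum_range_succ', Pi.sub_apply]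
      simp
    have hB : ∀ y : ℝ, HasDerivAt (fun y : ℝ => y ^ (K + 1) / ((K + 1).factorial : ℝ))
        (y ^ K / K.factorial) y := by
      intro y
      refine ((hasDerivAt_pow (K + 1) y).div_const _).congr_deriv ?_
      rw [Nat.factorial_succ]
      push_cast
      have h3 : (K.factorial : ℝ) ≠ 0 := by exact_mod_cast K.factorial_ne_zero
      field_simp
    have h0 : f 0 = 0 := by simp [hf, Finset.sum_range_succ']
    refine image_norm_le_of_norm_deriv_right_le_deriv_boundary (f := f) (a := 0) (b := y)
      (fun z _ => (hd z).continuousAt.continuousWithinAt) (fun z _ => (hd z).hasDerivWithinAt)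
      (by simp [h0]) hB (fun z hz => ?_) ⟨hy, le_rfl⟩
    rw [norm_mul, hc1, one_mul]
    exact ih hz.1

lemma norm_exp_mul_I_sub_sum_range_le (K : ℕ) (y : ℝ) :
    ‖Complex.exp (y * Complex.I) - ∑ k ∈ Finset.range K, (y * Complex.I) ^ k / (k.factorial : ℂ)‖ ≤
      |y| ^ K / K.factorial := by
  rcases le_total 0 y with hy | hy
  · rw [abs_of_nonneg hy]
    simpa only [mul_comm] using norm_exp_sub_sum_range_le (c := Complex.I) (by simp) (by simp) K hy
  · rw [abs_of_nonpos hy]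
    have h := norm_exp_sub_sum_range_le (c := -Complex.I) (by simp) (by simp) K (neg_nonneg.2 hy)
    rwa [show -Complex.I * ((-y : ℝ) : ℂ) = y * Complex.I by push_cast; ring] at h

lemma SubGauss.exp_sum_abs {n : ℕ} (t : Fin n → ℝ) (σ : Equiv.Perm (Fin n)) :
    SubGauss fun x : Fin n → ℝ => Real.exp |∑ i, t i * x (σ i)| := by
  have h : ∀ s : Finset (Fin n), SubGauss fun x : Fin n → ℝ =>
      ∏ i ∈ s, Real.exp (|t i| * |x (σ i)|) := by
    classical
    intro s
    induction s using Finset.induction_on with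
    | empty => simpa using SubGauss.const 1
    | insert i s hi ih =>
      simp only [Finset.prod_insert hi]
      exact (SubGauss.exp_abs _ _).mul ih
  refine (h Finset.univ).mono fun x => ?_
  rw [Real.abs_exp, ← Real.exp_sum, Real.abs_exp, Real.exp_le_exp]
  refine (Finset.abs_sum_le_sum_abs _ _).trans_eq ?_
  simp only [abs_mul]

/-- The symmetrised power `∑_σ (t · x_σ) ^ k`. -/
def symPow {n : ℕ} (t : Fin n → ℝ) (k : ℕ) (x : Fin n → ℝ) : ℝ :=
  ∑ σ : Equiv.Perm (Fin n), (∑ i, t i * x (σ i)) ^ k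

lemma continuous_symPow {n : ℕ} (t : Fin n → ℝ) (k : ℕ) : Continuous (symPow t k) := by
  unfold symPow
  fun_prop

lemma subGauss_symPow {n : ℕ} (t : Fin n → ℝ) (k : ℕ) : SubGauss (symPow t k) := by
  unfold symPow
  exact SubGauss.sum _ fun σ _ => (SubGauss.sum _ fun i _ =>
    (SubGauss.const (t i)).mul (SubGauss.eval (σ i))).pow k

/-- The symmetrised character `∑_σ exp(i t · x_σ)`. -/
def symChar {n : ℕ} (t : Fin n → ℝ) (x : Fin n → ℝ) : ℂ :=
  ∑ σ : Equiv.Perm (Fin n), Complex.exp ((∑ i, t i * x (σ i) : ℝ) * Complex.I)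

lemma continuous_symChar {n : ℕ} (t : Fin n → ℝ) : Continuous (symChar t) := by
  unfold symChar
  fun_prop

lemma integrable_symChar {n : ℕ} (t : Fin n → ℝ) (ν : Measure (Fin n → ℝ)) [IsFiniteMeasure ν] :
    Integrable (symChar t) ν := by
  refine Integrable.of_bound (continuous_symChar t).aestronglyMeasurable
    (∑ σ : Equiv.Perm (Fin n), 1) (Eventually.of_forall fun x => ?_)
  refine (norm_sum_le _ _).trans (Finset.sum_le_sum fun σ _ => ?_)
  rw [Complex.norm_exp_ofReal_mul_I]

/-- The Taylor polynomial of `symChar`. -/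
def symTaylor {n : ℕ} (t : Fin n → ℝ) (K : ℕ) (x : Fin n → ℝ) : ℂ :=
  ∑ k ∈ Finset.range K, Complex.I ^ k / (k.factorial : ℂ) * (symPow t k x : ℝ)

lemma norm_symChar_sub_symTaylor_le {n : ℕ} (t : Fin n → ℝ) {K : ℕ} (hK : Even K)
    (x : Fin n → ℝ) : ‖symChar t x - symTaylor t K x‖ ≤ symPow t K x / K.factorial := by
  have h : symTaylor t K x = ∑ σ : Equiv.Perm (Fin n), ∑ k ∈ Finset.range K,
      ((∑ i, t i * x (σ i) : ℝ) * Complex.I) ^ k / (k.factorial : ℂ) := by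
    rw [Finset.sum_comm, symTaylor]
    refine Finset.sum_congr rfl fun k _ => ?_
    rw [symPow, Complex.ofReal_sum, Finset.mul_sum]
    refine Finset.sum_congr rfl fun σ _ => ?_
    rw [Complex.ofReal_pow, mul_pow]
    ring
  rw [h, symChar, ← Finset.sum_sub_distrib, symPow, Finset.sum_div]
  refine (norm_sum_le _ _).trans (Finset.sum_le_sum fun σ _ => ?_)
  refine (norm_exp_mul_I_sub_sum_range_le K _).trans_eq ?_
  rw [hK.pow_abs]

lemma integral_symTaylor {n : ℕ} (t : Fin n → ℝ) (K : ℕ) {ν : Measure (Fin n → ℝ)}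
    (h : ∀ k, Integrable (symPow t k) ν) :
    Integrable (symTaylor t K) ν ∧ ∫ x, symTaylor t K x ∂ν =
      ∑ k ∈ Finset.range K, Complex.I ^ k / (k.factorial : ℂ) * ((∫ x, symPow t k x ∂ν : ℝ) : ℂ) := by
  have hi : ∀ k ∈ Finset.range K, Integrable
      (fun x => Complex.I ^ k / (k.factorial : ℂ) * (symPow t k x : ℝ)) ν :=
    fun k _ => ((h k).ofReal).const_mul _
  refine ⟨integrable_finsetSum _ hi, ?_⟩
  unfold symTaylor
  rw [integral_finsetSum _ hi]
  refine Finset.sum_congr rfl fun k _ => ?_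
  rw [integral_const_mul]
  congr 1
  exact integral_ofReal

lemma norm_integral_symChar_sub_le {n : ℕ} (t : Fin n → ℝ) {K : ℕ} (hK : Even K)
    {ν : Measure (Fin n → ℝ)} [IsFiniteMeasure ν] (h : ∀ k, Integrable (symPow t k) ν) :
    ‖∫ x, symChar t x ∂ν - ∫ x, symTaylor t K x ∂ν‖ ≤ (∫ x, symPow t K x ∂ν) / K.factorial := by
  rw [← integral_sub (integrable_symChar t ν) (integral_symTaylor t K h).1, ← integral_div]
  exact norm_integral_le_of_norm_le ((h K).div_const _)
    (Eventually.of_forall (norm_symChar_sub_symTaylor_le t hK))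

lemma tendsto_integral_symPow_div_factorial {θ : ℝ} (hθ : 0 < θ) {n : ℕ} (t : Fin n → ℝ) :
    Tendsto (fun l : ℕ => (∫ x, symPow t (2 * l) x ∂(gbe θ n)) / ((2 * l).factorial : ℝ)) atTop
      (𝓝 0) := by
  have hlim : Tendsto (fun l : ℕ => ∫ x, symPow t (2 * l) x / ((2 * l).factorial : ℝ) ∂(gbe θ n))
      atTop (𝓝 (∫ _, (0 : ℝ) ∂(gbe θ n))) := by
    refine tendsto_integral_of_dominated_convergence
      (fun x => ∑ σ : Equiv.Perm (Fin n), Real.exp |∑ i, t i * x (σ i)|)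
      (fun l => ((continuous_symPow t _).div_const _).aestronglyMeasurable) ?_ (fun l => ?_) ?_
    · exact (SubGauss.sum _ fun σ _ => SubGauss.exp_sum_abs t σ).integrable hθ (by fun_prop)
    · refine Eventually.of_forall fun x => ?_
      rw [symPow, Finset.sum_div]
      refine (norm_sum_le _ _).trans (Finset.sum_le_sum fun σ _ => ?_)
      rw [norm_div, norm_pow, Real.norm_eq_abs, Real.norm_of_nonneg (by positivity)]
      exact Real.pow_div_factorial_le_exp _ (abs_nonneg _) _
    · refine Eventually.of_forall fun x => ?_
      have h2 : Tendsto (fun l : ℕ => 2 * l) atTop atTop :=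
        tendsto_atTop_mono (fun l => by simp only [id]; omega) tendsto_id
      have h : Tendsto (fun l : ℕ => ∑ σ : Equiv.Perm (Fin n),
          (∑ i, t i * x (σ i)) ^ (2 * l) / ((2 * l).factorial : ℝ)) atTop
          (𝓝 (∑ σ : Equiv.Perm (Fin n), 0)) :=
        tendsto_finsetSum _ fun σ _ =>
          (FloorSemiring.tendsto_pow_div_factorial_atTop (∑ i, t i * x (σ i))).comp h2
      simpa only [symPow, Finset.sum_div, Finset.sum_const_zero] using h
  simpa only [integral_div, integral_zero] using hlim

/-- Convergence of symmetric moments to those of the Gaussian beta ensemble implies convergence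
of the symmetrised characteristic functions. -/
lemma tendsto_integral_symChar {θ : ℝ} (hθ : 0 < θ) {n : ℕ} {ν : ℕ → Measure (Fin n → ℝ)}
    (hν : ∀ j, IsProbabilityMeasure (ν j))
    (hi : ∀ j (F : (Fin n → ℝ) → ℝ), Continuous F → Integrable F (ν j))
    (hF : ∀ D B F, SymRep n D B F → Tendsto (fun j => ∫ x, F x ∂(ν j)) atTop
      (𝓝 (∫ x, F x ∂(gbe θ n)))) (t : Fin n → ℝ) :
    Tendsto (fun j => ∫ x, symChar t x ∂(ν j)) atTop (𝓝 (∫ x, symChar t x ∂(gbe θ n))) := by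
  have := isProbabilityMeasure_gbe hθ n
  have hpow : ∀ k, Tendsto (fun j => ∫ x, symPow t k x ∂(ν j)) atTop
      (𝓝 (∫ x, symPow t k x ∂(gbe θ n))) := by
    intro k
    obtain ⟨D, B, h⟩ := exists_symRep_sum_perm_pow t k
    exact hF D B _ h
  have hiν : ∀ j k, Integrable (symPow t k) (ν j) := fun j k => hi j _ (continuous_symPow t k)
  have hig : ∀ k, Integrable (symPow t k) (gbe θ n) := fun k =>
    (subGauss_symPow t k).integrable hθ (continuous_symPow t k)
  rw [Metric.tendsto_nhds]
  intro ε hε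
  obtain ⟨l, hl⟩ := ((tendsto_integral_symPow_div_factorial hθ t).eventually
    (gt_mem_nhds (show (0 : ℝ) < ε / 3 by positivity))).exists
  have hK : Even (2 * l) := even_two_mul l
  have e1 := ((hpow (2 * l)).div_const ((2 * l).factorial : ℝ)).eventually (gt_mem_nhds hl)
  have e2 : Tendsto (fun j => ∫ x, symTaylor t (2 * l) x ∂(ν j)) atTop
      (𝓝 (∫ x, symTaylor t (2 * l) x ∂(gbe θ n))) := by
    rw [(integral_symTaylor t (2 * l) hig).2]
    simp only [fun j => (integral_symTaylor t (2 * l) (hiν j)).2]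
    exact tendsto_finsetSum _ fun k _ =>
      ((Complex.continuous_ofReal.tendsto _).comp (hpow k)).const_mul _
  have e3 := Metric.tendsto_nhds.1 e2 (ε / 3) (by positivity)
  filter_upwards [e1, e3] with j h1 h3
  have := hν j
  have b1 := norm_integral_symChar_sub_le t hK (hiν j)
  have b2 := norm_integral_symChar_sub_le t hK hig
  rw [← dist_eq_norm] at b1 b2
  rw [dist_comm] at b2
  have := dist_triangle4 (∫ x, symChar t x ∂(ν j)) (∫ x, symTaylor t (2 * l) x ∂(ν j))
    (∫ x, symTaylor t (2 * l) x ∂(gbe θ n)) (∫ x, symChar t x ∂(gbe θ n))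
  linarith

/-- The decreasing rearrangement of a vector. -/
def sortVec {n : ℕ} (x : Fin n → ℝ) (k : Fin n) : ℝ :=
  (Finset.univ : Finset (Fin (k.1 + 1) ↪ Fin n)).sup'
    ⟨Fin.castLEEmb k.isLt, Finset.mem_univ _⟩ fun e =>
      (Finset.univ : Finset (Fin (k.1 + 1))).inf' Finset.univ_nonempty fun i => x (e i)

lemma continuous_sortVec {n : ℕ} : Continuous (sortVec : (Fin n → ℝ) → Fin n → ℝ) :=
  continuous_pi fun k => Continuous.finset_sup'_apply _ fun e _ =>
    Continuous.finset_inf'_apply _ fun i _ => continuous_apply (e i)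

lemma sortVec_comp_perm {n : ℕ} {y : Fin n → ℝ} (hy : Antitone y) (σ : Equiv.Perm (Fin n)) :
    sortVec (y ∘ σ) = y := by
  funext k
  refine le_antisymm (Finset.sup'_le _ _ fun e _ => ?_) ?_
  · obtain ⟨i, hi⟩ : ∃ i, k ≤ σ (e i) := by
      by_contra! h
      have hinj : Function.Injective fun i : Fin (k.1 + 1) => (⟨(σ (e i)).1, h i⟩ : Fin k.1) := by
        intro i j hij
        exact e.injective (σ.injective (Fin.ext (Fin.mk.inj_iff.1 hij)))
      have := Fintype.card_le_of_injective _ hinj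
      simp at this
    exact (Finset.inf'_le _ (Finset.mem_univ i)).trans (hy hi)
  · refine le_trans ?_ (Finset.le_sup' _
      (Finset.mem_univ ((Fin.castLEEmb k.isLt).trans σ.symm.toEmbedding)))
    refine Finset.le_inf' _ _ fun i _ => ?_
    simp only [Function.comp_apply, Function.Embedding.trans_apply, Equiv.coe_toEmbedding,
      Equiv.apply_symm_apply]
    refine hy ?_
    change i.1 ≤ k.1
    omega

/-- The symmetrisation of a measure, on Euclidean space. -/
def symMeasure {n : ℕ} (ν : Measure (Fin n → ℝ)) : Measure (EuclideanSpace ℝ (Fin n)) :=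
  (Fintype.card (Equiv.Perm (Fin n)) : ℝ≥0∞)⁻¹ •
    ∑ σ : Equiv.Perm (Fin n), ν.map fun x => WithLp.toLp 2 (x ∘ σ)

lemma continuous_toLp_comp {n : ℕ} (σ : Equiv.Perm (Fin n)) :
    Continuous fun x : Fin n → ℝ => (WithLp.toLp 2 (x ∘ σ) : EuclideanSpace ℝ (Fin n)) := by
  fun_prop

lemma isProbabilityMeasure_symMeasure {n : ℕ} (ν : Measure (Fin n → ℝ)) [IsProbabilityMeasure ν] :
    IsProbabilityMeasure (symMeasure ν) := by
  constructor
  have h : ∀ σ : Equiv.Perm (Fin n), (ν.map fun x => (WithLp.toLp 2 (x ∘ σ) :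
      EuclideanSpace ℝ (Fin n))) Set.univ = 1 := fun σ =>
    (Measure.isProbabilityMeasure_map (continuous_toLp_comp σ).measurable.aemeasurable).measure_univ
  simp only [symMeasure, Measure.smul_apply, Measure.finsetSum_apply, h, smul_eq_mul,
    Finset.sum_const, Finset.card_univ, nsmul_eq_mul, mul_one]
  exact ENNReal.inv_mul_cancel (by simp [Fintype.card_ne_zero]) (by simp)

lemma integral_symMeasure {n : ℕ} {E : Type*} [NormedAddCommGroup E] [NormedSpace ℝ E]
    (ν : Measure (Fin n → ℝ)) [IsFiniteMeasure ν]
    (f : BoundedContinuousFunction (EuclideanSpace ℝ (Fin n)) E) [CompleteSpace E]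
    [SecondCountableTopology E] [MeasurableSpace E] [BorelSpace E] :
    ∫ x, f x ∂(symMeasure ν) = (Fintype.card (Equiv.Perm (Fin n)) : ℝ)⁻¹ •
      ∑ σ : Equiv.Perm (Fin n), ∫ x, f (WithLp.toLp 2 (x ∘ σ)) ∂ν := by
  rw [symMeasure, integral_smul_measure, integral_finsetSum_measure]
  · congr 1
    · simp
    · refine Finset.sum_congr rfl fun σ _ => ?_
      exact integral_map (continuous_toLp_comp σ).measurable.aemeasurable
        f.continuous.aestronglyMeasurable
  · exact fun σ _ => f.integrable _

lemma charFun_symMeasure {n : ℕ} (ν : Measure (Fin n → ℝ)) [IsFiniteMeasure ν]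
    (t : EuclideanSpace ℝ (Fin n)) :
    charFun (symMeasure ν) t =
      (Fintype.card (Equiv.Perm (Fin n)) : ℝ)⁻¹ • ∫ x, symChar (fun i => t i) x ∂ν := by
  rw [charFun_eq_integral_innerProbChar, integral_symMeasure, ← integral_finsetSum]
  · congr 1
  · intro σ _
    exact ((BoundedContinuousFunction.innerProbChar t).compContinuous
      ⟨_, continuous_toLp_comp σ⟩).integrable ν

/-- The method of moments for symmetric functions of ordered vectors, with a Gaussian beta
ensemble limit. -/
lemma tendsto_integral_of_symRep {θ : ℝ} (hθ : 0 < θ) {n : ℕ} {ν : ℕ → Measure (Fin n → ℝ)}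
    (hν : ∀ j, IsProbabilityMeasure (ν j))
    (hi : ∀ j (F : (Fin n → ℝ) → ℝ), Continuous F → Integrable F (ν j))
    (hanti : ∀ j, ∀ᵐ x ∂(ν j), Antitone x)
    (hF : ∀ D B F, SymRep n D B F → Tendsto (fun j => ∫ x, F x ∂(ν j)) atTop
      (𝓝 (∫ x, F x ∂(gbe θ n)))) (f : BoundedContinuousFunction (Fin n → ℝ) ℝ) :
    Tendsto (fun j => ∫ x, f x ∂(ν j)) atTop (𝓝 (∫ x, f x ∂(gbe θ n))) := by
  have hg := isProbabilityMeasure_gbe hθ n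
  have hc := ProbabilityMeasure.tendsto_iff_tendsto_charFun
    (μ := fun j => (⟨symMeasure (ν j), isProbabilityMeasure_symMeasure (ν j)⟩ :
      ProbabilityMeasure (EuclideanSpace ℝ (Fin n))))
    (μ₀ := ⟨symMeasure (gbe θ n), isProbabilityMeasure_symMeasure (gbe θ n)⟩)
  have h := hc.2 fun t => by
    simp only [ProbabilityMeasure.coe_mk, charFun_symMeasure]
    exact (tendsto_integral_symChar hθ hν hi hF _).const_smul _
  have hs := ProbabilityMeasure.tendsto_iff_forall_integral_tendsto.1 h (f.compContinuous ⟨fun x => sortVec (WithLp.ofLp x), continuous_sortVec.comp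
    (PiLp.continuous_ofLp 2 _)⟩)
  have key : ∀ ρ : Measure (Fin n → ℝ), IsProbabilityMeasure ρ → (∀ᵐ x ∂ρ, Antitone x) →
      ∫ x, (f.compContinuous ⟨fun x : EuclideanSpace ℝ (Fin n) => sortVec (WithLp.ofLp x),
        continuous_sortVec.comp (PiLp.continuous_ofLp 2 _)⟩) x ∂(symMeasure ρ) = ∫ x, f x ∂ρ := by
    intro ρ _ hρ
    rw [integral_symMeasure]
    have hσ : ∀ σ : Equiv.Perm (Fin n), ∫ x, f (sortVec (x ∘ σ)) ∂ρ = ∫ x, f x ∂ρ := by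
      intro σ
      refine integral_congr_ae ?_
      filter_upwards [hρ] with x hx
      rw [sortVec_comp_perm hx σ]
    simp only [BoundedContinuousFunction.compContinuous_apply, ContinuousMap.coe_mk, hσ,
      Finset.sum_const, Finset.card_univ]
    rw [← Nat.cast_smul_eq_nsmul ℝ, smul_smul, inv_mul_cancel₀ (by positivity), one_smul]
  simp only [ProbabilityMeasure.coe_mk, key _ hg ((ae_strictAnti_gbe hθ n).mono
    fun x hx => hx.antitone), fun j => key _ (hν j) (hanti j)] at hs
  exact hs

lemma measurable_levelProj {N : ℕ} (m : ℕ) (h1 : 1 ≤ m) (h2 : m < N) :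
    Measurable (levelProj m h1 h2) :=
  measurable_pi_lambda _ fun _ => (measurable_pi_apply _).comp (measurable_pi_apply _)

/-- Weak convergence of the rescaled kernels of the orbital beta process. -/
lemma RegularSeq.tendsto_map_chainKernel {θ : ℝ} (hθ : 0 < θ) (m : ℕ)
    {a : (N : ℕ) → Fin N → ℝ} {μ : Measure ℝ} (h : RegularSeq a μ) (hv : 0 < varM μ)
    (f : BoundedContinuousFunction (Fin (m + 1) → ℝ) ℝ) :
    Tendsto (fun j : ℕ => ∫ x, f x ∂((chainKernel θ m j (a (m + j + 1))).map
        (affVec (1 / √((m + j + 1 : ℕ) * varM μ))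
          (-((m + j + 1 : ℕ) * meanM (empMeasure (a (m + j + 1)))) / √((m + j + 1 : ℕ) * varM μ)))))
      atTop (𝓝 (∫ x, f x ∂(gbe θ (m + 1)))) := by
  set b : ℕ → ℝ := fun j => 1 / √((m + j + 1 : ℕ) * varM μ) with hb
  set c : ℕ → ℝ := fun j => -((m + j + 1 : ℕ) * meanM (empMeasure (a (m + j + 1)))) /
    √((m + j + 1 : ℕ) * varM μ) with hc
  have hb0 : ∀ j, 0 < b j := fun j => one_div_pos.2 (Real.sqrt_pos.2 (by positivity))
  have ha : ∀ j, StrictAnti (a (m + j + 1)) := fun j => h.1 _ (by omega)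
  have hmeas : ∀ j, AEMeasurable (affVec (b j) (c j) : (Fin (m + 1) → ℝ) → Fin (m + 1) → ℝ)
      (chainKernel θ m j (a (m + j + 1))) :=
    fun j => (continuous_affVec _ _).measurable.aemeasurable
  have hNs : Tendsto (fun j : ℕ => m + j + 1) atTop atTop :=
    tendsto_atTop_mono (fun j => by simp only [id]; omega) tendsto_id
  have hprob := fun j => isProbabilityMeasure_chainKernel hθ m j (ha j)
  refine tendsto_integral_of_symRep hθ (fun j => ?_) (fun j F hF => ?_) (fun j => ?_)
    (fun D B F hF => ?_) f
  · exact Measure.isProbabilityMeasure_map (hmeas j)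
  · rw [integrable_map_measure hF.aestronglyMeasurable (hmeas j)]
    exact integrable_chainKernel hθ m j (ha j) (hF.comp (continuous_affVec _ _))
  · have hset : MeasurableSet {x : Fin (m + 1) → ℝ | StrictAnti x} := measurableSet_strictAnti _
    have hae : ∀ᵐ x ∂((chainKernel θ m j (a (m + j + 1))).map (affVec (b j) (c j))),
        StrictAnti x := by
      rw [ae_map_iff (hmeas j) hset]
      obtain ⟨R, hR⟩ := exists_forall_abs_le (a (m + j + 1))
      filter_upwards [ae_strictAnti_chainKernel θ m j (ha j) hR] with x hx i k hik
      have := mul_lt_mul_of_pos_left (hx.1 hik) (hb0 j)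
      simp only [affVec]
      linarith
    exact hae.mono fun x hx => hx.antitone
  · have key := tendsto_integral_chainKernel hθ hF ha (fun j => (hb0 j).ne') (c := c)
      (fun κ => (tendsto_sgnProd_div_pow (h.tendsto_powerSum hv) κ).comp hNs)
    refine key.congr fun j => ?_
    rw [integral_map (hmeas j) hF.continuous.aestronglyMeasurable]

/-- (Theorem 1.3) Universality of the `m`-th level of the orbital beta
process: the rescaled `m`-th level converges weakly to the Gaussian beta ensemble. -/
theorem orbital_beta_mth_level_to_GBE
    (θ : ℝ) (hθ : 0 < θ) (m : ℕ) (hm : 1 ≤ m)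
    (a : (N : ℕ) → Fin N → ℝ) (μ : Measure ℝ)
    (hreg : RegularSeq a μ) (hvar : 0 < varM μ) :
    ∀ f : BoundedContinuousFunction (Fin m → ℝ) ℝ,
      Tendsto (fun N : ℕ =>
          if h : m < N then
            ∫ v, f v ∂(Measure.map
              (fun x (i : Fin m) =>
                (levelProj m hm h x i - N * meanM (empMeasure (a N))) /
                  Real.sqrt (N * varM μ))
              (obp θ (a N)))
          else 0)
        atTop (𝓝 (∫ v, f v ∂(gbe θ m))) := by
  obtain ⟨m, rfl⟩ : ∃ k, m = k + 1 := ⟨m - 1, by omega⟩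
  intro f
  have hshift : ∀ {G : ℕ → ℝ} {L : Filter ℝ}, Tendsto (fun j => G (m + j + 1)) atTop L →
      Tendsto G atTop L := by
    intro G L hG
    refine (tendsto_add_atTop_iff_nat (m + 1)).1 (hG.congr fun j => ?_)
    rw [show m + j + 1 = j + (m + 1) by omega]
  refine hshift ((hreg.tendsto_map_chainKernel hθ m hvar f).congr' ?_)
  filter_upwards [eventually_ge_atTop 1] with j hj
  obtain ⟨j, rfl⟩ : ∃ i, j = i + 1 := ⟨j - 1, by omega⟩
  have hN : m + 1 < m + (j + 1) + 1 := by omega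
  rw [dif_pos hN, ← map_levelProj_obp hθ m j (hreg.1 _ (by omega)) hm hN,
    Measure.map_map (continuous_affVec _ _).measurable (measurable_levelProj _ hm hN)]
  congr 2
  funext x i
  simp only [Function.comp_apply, affVec]
  ring

end
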